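/- For every real number ε₁ with ε₁ ≠ 1 and every p ∈ (1, ∞), there exists a constant C = C(p, ε₁) > 0 such that for every Schwartz function f : ℝ → ℂ one has ‖C_{ε₁}^{even} f‖_{L^p(ℝ)} ≤ C ‖f‖_{L^p(ℝ)}. -/

import Mathlib

open MeasureTheory Filter Set
open scoped ENNReal Topology

/-- Principal value integral: the limit, as `δ → 0⁺` and `R → ∞`, of
`∫_{δ ≤ |y| ≤ R} g(y) dy`. -/
noncomputable def pvIntegral (g : ℝ → ℂ) : ℂ :=
  limUnder ((nhdsWithin (0 : ℝ) (Set.Ioi 0)) ×ˢ Filter.atTop)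
    (fun p : ℝ × ℝ => ∫ y in {y : ℝ | p.1 ≤ |y| ∧ |y| ≤ p.2}, g y)

/-- The even fractional Carleson operator
`C_ε^{even} f(x) = sup_{A ∈ ℝ} | p.v. ∫ e^{i A |y|^ε} f(x-y) dy/y |`. -/
noncomputable def carlesonEven (ε : ℝ) (f : ℝ → ℂ) (x : ℝ) : ℝ≥0∞ :=
  ⨆ A : ℝ, (‖pvIntegral (fun y =>
    Complex.exp (Complex.I * (A : ℂ) * ((|y| ^ ε : ℝ) : ℂ)) * f (x - y) / (y : ℂ))‖₊ : ℝ≥0∞)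

/-- centered maximal function -/
noncomputable def MF (g : ℝ → ℝ≥0∞) (x : ℝ) : ℝ≥0∞ :=
  ⨆ (r : ℝ) (_ : 0 < r), (∫⁻ y in Metric.closedBall x r, g y) / ENNReal.ofReal (2 * r)

lemma MF_ball_le (g : ℝ → ℝ≥0∞) (x r : ℝ) (hr : 0 < r) :
    (∫⁻ y in Metric.closedBall x r, g y) ≤ ENNReal.ofReal (2 * r) * MF g x := by
  have h : (∫⁻ y in Metric.closedBall x r, g y) / ENNReal.ofReal (2 * r) ≤ MF g x :=
    le_iSup₂ (f := fun (r : ℝ) (_ : 0 < r) =>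
      (∫⁻ y in Metric.closedBall x r, g y) / ENNReal.ofReal (2 * r)) r hr
  rw [ENNReal.div_le_iff (by simpa using hr) ENNReal.ofReal_ne_top] at h
  rwa [mul_comm]

lemma MF_lt_iff (g : ℝ → ℝ≥0∞) (x : ℝ) (t : ℝ≥0∞) :
    t < MF g x ↔ ∃ r : ℝ, 0 < r ∧ t * ENNReal.ofReal (2 * r) < ∫⁻ y in Metric.closedBall x r, g y := by
  unfold MF
  simp only [lt_iSup_iff, exists_prop]
  refine exists_congr fun r => and_congr_right fun hr => ?_
  rw [ENNReal.lt_div_iff_mul_lt (Or.inl (by simpa using hr)) (Or.inl ENNReal.ofReal_ne_top)]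

lemma MF_isOpen (g : ℝ → ℝ≥0∞) (t : ℝ≥0∞) : IsOpen {x | t < MF g x} := by
  rw [Metric.isOpen_iff]
  intro x hx
  obtain ⟨r, hr, h⟩ := (MF_lt_iff g x t).1 hx
  have hc : Tendsto (fun d : ℝ => t * ENNReal.ofReal (2 * (r + d))) (𝓝 0)
      (𝓝 (t * ENNReal.ofReal (2 * (r + 0)))) := by
    by_cases ht : t = ⊤
    · exfalso
      rw [ht, ENNReal.top_mul (by simpa using hr)] at h
      simp at h
    · apply ENNReal.Tendsto.const_mul _ (Or.inr ht)
      apply ENNReal.tendsto_ofReal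
      exact (by fun_prop : Continuous fun d : ℝ => 2 * (r + d)).tendsto 0
  rw [add_zero] at hc
  have := hc.eventually (gt_mem_nhds h)
  obtain ⟨δ, hδ, hh⟩ := Metric.eventually_nhds_iff.1 this
  refine ⟨δ, hδ, fun y hy => ?_⟩
  rw [mem_ofPred_eq, MF_lt_iff]
  refine ⟨r + dist y x, by positivity, ?_⟩
  refine (hh (y := dist y x) ?_).trans_le ?_
  · simpa [Real.dist_eq] using hy
  · apply lintegral_mono_set
    apply Metric.closedBall_subset_closedBall'
    rw [dist_comm x y]

lemma MF_measurable (g : ℝ → ℝ≥0∞) : Measurable (MF g) :=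
  measurable_of_Ioi fun t => (MF_isOpen g t).measurableSet

lemma MF_mono {g h : ℝ → ℝ≥0∞} (H : ∀ x, g x ≤ h x) (x : ℝ) : MF g x ≤ MF h x := by
  unfold MF
  gcongr with r hr
  exact H _

lemma MF_add_const (g : ℝ → ℝ≥0∞) (hg : Measurable g) (c : ℝ≥0∞) (x : ℝ) :
    MF (fun y => g y + c) x ≤ MF g x + c := by
  conv_lhs => unfold MF
  refine iSup₂_le fun r hr => ?_
  rw [lintegral_add_left hg, ENNReal.add_div]
  gcongr
  · exact le_iSup₂ (f := fun (r : ℝ) (_ : 0 < r) =>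
      (∫⁻ y in Metric.closedBall x r, g y) / ENNReal.ofReal (2 * r)) r hr
  · rw [setLIntegral_const, Real.volume_closedBall, mul_div_assoc,
      ENNReal.div_self (by simpa using hr) ENNReal.ofReal_ne_top, mul_one]

lemma MF_weak (g : ℝ → ℝ≥0∞) (t : ℝ≥0∞) (ht : t ≠ 0) :
    t * volume {x | t < MF g x} ≤ 4 * ∫⁻ y, g y := by
  by_cases hI : ∫⁻ y, g y = ⊤
  · rw [hI, ENNReal.mul_top (by norm_num)]; exact le_top
  by_cases htt : t = ⊤
  · have : {x | t < MF g x} = ∅ := by ext x; simp [htt]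
    rw [this]; simp
  have hex : ∀ x, x ∈ {x | t < MF g x} →
      ∃ r : ℝ, 0 < r ∧ t * ENNReal.ofReal (2 * r) < ∫⁻ y in Metric.closedBall x r, g y :=
    fun x hx => (MF_lt_iff g x t).1 hx
  classical
  let r : ℝ → ℝ := fun x => if hx : x ∈ {x | t < MF g x} then (hex x hx).choose else 1
  have hr : ∀ x ∈ {x | t < MF g x}, 0 < r x ∧
      t * ENNReal.ofReal (2 * r x) < ∫⁻ y in Metric.closedBall x (r x), g y := by
    intro x hx
    simp only [r, dif_pos hx]
    exact (hex x hx).choose_spec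
  have hbd : ∀ x ∈ {x | t < MF g x}, r x ≤ ((∫⁻ y, g y) / t).toReal := by
    intro x hx
    obtain ⟨h1, h2⟩ := hr x hx
    have h3 : ENNReal.ofReal (r x) ≤ (∫⁻ y, g y) / t := by
      rw [ENNReal.le_div_iff_mul_le (Or.inl ht) (Or.inl htt), mul_comm]
      refine le_trans ?_ (h2.le.trans (setLIntegral_le_lintegral _ _))
      gcongr; linarith
    have := ENNReal.toReal_mono (ENNReal.div_ne_top hI ht) h3
    rwa [ENNReal.toReal_ofReal h1.le] at this
  obtain ⟨u, hu, hd, hcov⟩ := Vitali.exists_disjoint_subfamily_covering_enlargement_closedBall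
    {x | t < MF g x} (fun x => x) r _ hbd 4 (by norm_num)
  have huc : u.Countable := by
    apply hd.countable_of_nonempty_interior
    intro x hx
    rw [interior_closedBall _ (hr x (hu hx)).1.ne']
    exact ⟨x, Metric.mem_ball_self (hr x (hu hx)).1⟩
  have hsub : {x | t < MF g x} ⊆ ⋃ b ∈ u, Metric.closedBall b (4 * r b) := by
    intro x hx
    obtain ⟨b, hb, h⟩ := hcov x hx
    exact mem_biUnion hb (h (Metric.mem_closedBall_self (hr x hx).1.le))
  calc t * volume {x | t < MF g x}
      ≤ t * ∑' b : u, volume (Metric.closedBall (b : ℝ) (4 * r b)) := by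
        gcongr
        exact (measure_mono hsub).trans (measure_biUnion_le _ huc _)
    _ = ∑' b : u, t * volume (Metric.closedBall (b : ℝ) (4 * r b)) := by
        rw [ENNReal.tsum_mul_left]
    _ ≤ ∑' b : u, 4 * ∫⁻ y in Metric.closedBall (b : ℝ) (r b), g y := by
        apply ENNReal.tsum_le_tsum
        intro b
        rw [Real.volume_closedBall, show 2 * (4 * r b) = 4 * (2 * r b) by ring,
          ENNReal.ofReal_mul (by norm_num), mul_left_comm]
        gcongr
        · norm_num
        · exact (hr b (hu b.2)).2.le
    _ = 4 * ∫⁻ y in ⋃ b ∈ u, Metric.closedBall (b : ℝ) (r b), g y := by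
        rw [ENNReal.tsum_mul_left, lintegral_biUnion huc (fun b _ => measurableSet_closedBall) hd]
    _ ≤ 4 * ∫⁻ y, g y := by
        gcongr; exact Measure.restrict_le_self

lemma layer_val (q : ℝ) (hq : 0 < q) (c : ℝ≥0∞) :
    ∫⁻ t in Ioi (0:ℝ), (if ENNReal.ofReal t < c then ENNReal.ofReal (t ^ (q - 1)) else 0)
      = c ^ q / ENNReal.ofReal q := by
  by_cases hc : c = ⊤
  · simp only [hc, ENNReal.ofReal_lt_top, if_true, ENNReal.top_rpow_of_pos hq]
    rw [ENNReal.top_div_of_ne_top ENNReal.ofReal_ne_top]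
    by_contra hne
    have : IntegrableOn (fun t : ℝ => t ^ (q - 1)) (Ioi 0) := by
      refine ⟨by fun_prop, ?_⟩
      rw [hasFiniteIntegral_iff_ofReal]
      · exact lt_top_iff_ne_top.2 hne
      · filter_upwards [self_mem_ae_restrict measurableSet_Ioi] with t ht
        exact Real.rpow_nonneg (le_of_lt ht) _
    exact not_integrableOn_Ioi_rpow _ this
  · lift c to NNReal using hc
    have h1 : ∫⁻ t in Ioi (0:ℝ), (if ENNReal.ofReal t < c then ENNReal.ofReal (t ^ (q - 1)) else 0)
        = ∫⁻ t in Ioo (0:ℝ) c, ENNReal.ofReal (t ^ (q - 1)) := by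
      rw [← lintegral_indicator measurableSet_Ioi, ← lintegral_indicator measurableSet_Ioo]
      congr 1; ext t
      simp only [indicator, mem_Ioi, mem_Ioo]
      by_cases h0 : 0 < t
      · have : ENNReal.ofReal t < c ↔ t < c := by
          rw [← ENNReal.ofReal_coe_nnreal, ENNReal.ofReal_lt_ofReal_iff_of_nonneg h0.le]
        simp [h0, this]
      · simp [h0]
    rw [h1, setLIntegral_congr Ioo_ae_eq_Ioc, ← ofReal_integral_eq_lintegral_ofReal,
      ← intervalIntegral.integral_of_le c.coe_nonneg, integral_rpow (Or.inl (by linarith))]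
    · simp only [sub_add_cancel, Real.zero_rpow hq.ne', sub_zero]
      rw [ENNReal.ofReal_div_of_pos hq, ← ENNReal.ofReal_rpow_of_nonneg c.coe_nonneg hq.le,
        ENNReal.ofReal_coe_nnreal]
    · rw [← IntegrableOn, ← intervalIntegrable_iff_integrableOn_Ioc_of_le c.coe_nonneg]
      exact intervalIntegral.intervalIntegrable_rpow' (by linarith)
    · filter_upwards [self_mem_ae_restrict measurableSet_Ioc] with t ht
      exact Real.rpow_nonneg (le_of_lt ht.1) _

lemma layer_val2 (q : ℝ) (hq : 0 < q) (c : ℝ≥0∞) (hc : c ≠ 0) :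
    ∫⁻ t in Ioi (0:ℝ), (if c ≤ ENNReal.ofReal t then ENNReal.ofReal (t ^ (-q - 1)) else 0)
      ≤ c ^ (-q) / ENNReal.ofReal q := by
  by_cases hct : c = ⊤
  · simp [hct]
  lift c to NNReal using hct
  have hc0 : 0 < (c:ℝ) := by
    have : c ≠ 0 := by simpa using hc
    exact_mod_cast pos_iff_ne_zero.2 this
  have h1 : ∫⁻ t in Ioi (0:ℝ), (if c ≤ ENNReal.ofReal t then ENNReal.ofReal (t ^ (-q - 1)) else 0)
      = ∫⁻ t in Ici (c:ℝ), ENNReal.ofReal (t ^ (-q - 1)) := by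
    rw [← lintegral_indicator measurableSet_Ioi, ← lintegral_indicator measurableSet_Ici]
    congr 1; ext t
    simp only [indicator, mem_Ioi, mem_Ici]
    by_cases h0 : 0 < t
    · have : (c:ℝ≥0∞) ≤ ENNReal.ofReal t ↔ c ≤ t := by
        rw [← ENNReal.ofReal_coe_nnreal, ENNReal.ofReal_le_ofReal_iff h0.le]
      simp [h0, this]
    · have : ¬ (c:ℝ) ≤ t := by push Not at *; linarith
      simp [h0, this]
  rw [h1, setLIntegral_congr Ioi_ae_eq_Ici.symm, ← ofReal_integral_eq_lintegral_ofReal,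
    integral_Ioi_rpow_of_lt (by linarith) hc0]
  · rw [sub_add_cancel, neg_div_neg_eq,
      ENNReal.ofReal_div_of_pos hq, ← ENNReal.ofReal_rpow_of_pos hc0,
        ENNReal.ofReal_coe_nnreal]
  · exact integrableOn_Ioi_rpow_of_lt (by linarith) hc0
  · filter_upwards [self_mem_ae_restrict measurableSet_Ioi] with t ht
    exact Real.rpow_nonneg (hc0.le.trans (le_of_lt ht)) _

lemma layer_cake (p : ℝ) (hp : 0 < p) (F : ℝ → ℝ≥0∞) (hF : Measurable F) :
    ∫⁻ x, F x ^ p = ENNReal.ofReal p *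
      ∫⁻ t in Ioi (0:ℝ), ENNReal.ofReal (t ^ (p - 1)) * volume {x | ENNReal.ofReal t < F x} := by
  have h1 : ∀ x, F x ^ p = ENNReal.ofReal p *
      ∫⁻ t in Ioi (0:ℝ), (if ENNReal.ofReal t < F x then ENNReal.ofReal (t ^ (p - 1)) else 0) := by
    intro x
    rw [layer_val p hp, ENNReal.mul_div_cancel (by simpa using hp) ENNReal.ofReal_ne_top]
  simp_rw [h1]
  have hm : Measurable (Function.uncurry fun (x t : ℝ) =>
      (if ENNReal.ofReal t < F x then ENNReal.ofReal (t ^ (p - 1)) else 0)) := by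
    unfold Function.uncurry
    refine Measurable.ite (measurableSet_lt (by fun_prop) (by fun_prop)) (by fun_prop) (by fun_prop)
  rw [lintegral_const_mul]
  · rw [lintegral_lintegral_swap hm.aemeasurable]
    congr 1
    refine lintegral_congr fun t => ?_
    have : (fun x => if ENNReal.ofReal t < F x then ENNReal.ofReal (t ^ (p - 1)) else 0)
      = {x | ENNReal.ofReal t < F x}.indicator (fun _ => ENNReal.ofReal (t ^ (p - 1))) := by
      ext x; simp [indicator]
    rw [this, lintegral_indicator_const (measurableSet_lt (by fun_prop) (by fun_prop))]
  · exact hm.lintegral_prod_right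

lemma mk_hi (k p : ℝ) (hk : 0 < k) (hkp : k < p) (g : ℝ → ℝ≥0∞) (hg : Measurable g)
    (D : ℝ≥0∞) :
    ∫⁻ t in Ioi (0:ℝ), ENNReal.ofReal (t ^ (p - 1)) * (ENNReal.ofReal (t ^ (-k)) *
      ∫⁻ x, if ENNReal.ofReal t < D * g x then g x ^ k else 0)
    = D ^ (p - k) / ENNReal.ofReal (p - k) * ∫⁻ x, g x ^ p := by
  have hm : Measurable (Function.uncurry fun (t x : ℝ) => ENNReal.ofReal (t ^ (p - k - 1)) *
      (if ENNReal.ofReal t < D * g x then g x ^ k else 0)) := by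
    unfold Function.uncurry
    refine Measurable.mul (by fun_prop) ?_
    refine Measurable.ite (measurableSet_lt (by fun_prop) (by fun_prop)) (by fun_prop) (by fun_prop)
  have hm2 : ∀ t : ℝ, Measurable fun x => (if ENNReal.ofReal t < D * g x then g x ^ k else 0) :=
    fun t => Measurable.ite (measurableSet_lt (by fun_prop) (by fun_prop)) (by fun_prop)
      (by fun_prop)
  calc _ = ∫⁻ t in Ioi (0:ℝ), ∫⁻ x, ENNReal.ofReal (t ^ (p - k - 1)) *
        (if ENNReal.ofReal t < D * g x then g x ^ k else 0) := by
        refine setLIntegral_congr_fun measurableSet_Ioi fun t ht => ?_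
        have ht : 0 < t := ht
        rw [lintegral_const_mul _ (hm2 t), ← mul_assoc, ← ENNReal.ofReal_mul (by positivity),
          ← Real.rpow_add ht]
        ring_nf
    _ = ∫⁻ x, ∫⁻ t in Ioi (0:ℝ), ENNReal.ofReal (t ^ (p - k - 1)) *
        (if ENNReal.ofReal t < D * g x then g x ^ k else 0) :=
        lintegral_lintegral_swap hm.aemeasurable
    _ = ∫⁻ x, D ^ (p - k) / ENNReal.ofReal (p - k) * g x ^ p := by
        refine lintegral_congr fun x => ?_
        have : ∀ t : ℝ, ENNReal.ofReal (t ^ (p - k - 1)) *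
            (if ENNReal.ofReal t < D * g x then g x ^ k else 0) = g x ^ k *
            (if ENNReal.ofReal t < D * g x then ENNReal.ofReal (t ^ (p - k - 1)) else 0) := by
          intro t; split_ifs <;> simp [mul_comm]
        simp_rw [this]
        rw [lintegral_const_mul, layer_val _ (by linarith), ENNReal.mul_rpow_of_nonneg _ _ (by linarith)]
        · rw [show p = k + (p - k) by ring, ENNReal.rpow_add_of_nonneg _ _ hk.le (by linarith)]
          simp only [div_eq_mul_inv, add_sub_cancel_left]
          ring
        · exact Measurable.ite (measurableSet_lt (by fun_prop) (by fun_prop)) (by fun_prop) (by fun_prop)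
    _ = _ := lintegral_const_mul _ (by fun_prop)

lemma mk_lo (k p : ℝ) (hkp : p < k) (hk : 0 < k) (g : ℝ → ℝ≥0∞) (hg : Measurable g)
    (hgt : ∀ x, g x ≠ ⊤) (D : ℝ≥0∞) (hD : D ≠ 0) (hDt : D ≠ ⊤) :
    ∫⁻ t in Ioi (0:ℝ), ENNReal.ofReal (t ^ (p - 1)) * (ENNReal.ofReal (t ^ (-k)) *
      ∫⁻ x, if D * g x ≤ ENNReal.ofReal t then g x ^ k else 0)
    ≤ D ^ (p - k) / ENNReal.ofReal (k - p) * ∫⁻ x, g x ^ p := by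
  have hm : Measurable (Function.uncurry fun (t x : ℝ) => ENNReal.ofReal (t ^ (-(k - p) - 1)) *
      (if D * g x ≤ ENNReal.ofReal t then g x ^ k else 0)) := by
    unfold Function.uncurry
    refine Measurable.mul (by fun_prop) ?_
    refine Measurable.ite (measurableSet_le (by fun_prop) (by fun_prop)) (by fun_prop) (by fun_prop)
  have hm2 : ∀ t : ℝ, Measurable fun x => (if D * g x ≤ ENNReal.ofReal t then g x ^ k else 0) :=
    fun t => Measurable.ite (measurableSet_le (by fun_prop) (by fun_prop)) (by fun_prop)
      (by fun_prop)
  calc _ = ∫⁻ t in Ioi (0:ℝ), ∫⁻ x, ENNReal.ofReal (t ^ (-(k - p) - 1)) *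
        (if D * g x ≤ ENNReal.ofReal t then g x ^ k else 0) := by
        refine setLIntegral_congr_fun measurableSet_Ioi fun t ht => ?_
        have ht : 0 < t := ht
        rw [lintegral_const_mul _ (hm2 t), ← mul_assoc, ← ENNReal.ofReal_mul (by positivity),
          ← Real.rpow_add ht]
        ring_nf
    _ = ∫⁻ x, ∫⁻ t in Ioi (0:ℝ), ENNReal.ofReal (t ^ (-(k - p) - 1)) *
        (if D * g x ≤ ENNReal.ofReal t then g x ^ k else 0) :=
        lintegral_lintegral_swap hm.aemeasurable
    _ ≤ ∫⁻ x, D ^ (p - k) / ENNReal.ofReal (k - p) * g x ^ p := by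
        refine lintegral_mono fun x => ?_
        have : ∀ t : ℝ, ENNReal.ofReal (t ^ (-(k - p) - 1)) *
            (if D * g x ≤ ENNReal.ofReal t then g x ^ k else 0) = g x ^ k *
            (if D * g x ≤ ENNReal.ofReal t then ENNReal.ofReal (t ^ (-(k - p) - 1)) else 0) := by
          intro t; split_ifs <;> simp [mul_comm]
        simp_rw [this]
        rw [lintegral_const_mul]
        · by_cases h0 : g x = 0
          · simp [h0, hk]
          refine (mul_le_mul_right (layer_val2 _ (by linarith) _ (mul_ne_zero hD h0)) _).trans ?_
          rw [ENNReal.mul_rpow_of_ne_top hDt (hgt x), neg_sub,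
            show p = k + (p - k) by ring, ENNReal.rpow_add _ _ h0 (hgt x)]
          simp only [div_eq_mul_inv, add_sub_cancel_left]
          apply le_of_eq; ring
        · exact Measurable.ite (measurableSet_le (by fun_prop) (by fun_prop)) (by fun_prop) (by fun_prop)
    _ = _ := lintegral_const_mul _ (by fun_prop)

lemma MF_weak2 (g : ℝ → ℝ≥0∞) (hg : Measurable g) (t : ℝ) (ht : 0 < t) :
    volume {x | ENNReal.ofReal t < MF g x} ≤ 8 * (ENNReal.ofReal (t ^ (-(1:ℝ))) *
      ∫⁻ x, if ENNReal.ofReal t < 2 * g x then g x ^ (1:ℝ) else 0) := by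
  set τ := ENNReal.ofReal t
  have hτ0 : τ ≠ 0 := by simpa [τ] using ht
  have hτt : τ ≠ ⊤ := ENNReal.ofReal_ne_top
  set g1 : ℝ → ℝ≥0∞ := fun x => if τ < 2 * g x then g x ^ (1:ℝ) else 0
  have hg1 : Measurable g1 :=
    Measurable.ite (measurableSet_lt (by fun_prop) (by fun_prop)) (by fun_prop) (by fun_prop)
  have h1 : ∀ x, MF g x ≤ MF g1 x + τ / 2 := by
    intro x
    refine (MF_mono (fun y => ?_) x).trans (MF_add_const g1 hg1 _ x)
    simp only [g1]
    split_ifs with h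
    · simp
    · rw [zero_add, ENNReal.le_div_iff_mul_le (by simp) (by simp), mul_comm]
      exact not_lt.1 h
  have h2 : {x | τ < MF g x} ⊆ {x | τ / 2 < MF g1 x} := by
    intro x hx
    by_contra hcon
    have h3 : MF g1 x ≤ τ / 2 := not_lt.1 hcon
    have h4 : τ < MF g x := hx
    have := (h1 x).trans (add_le_add_left h3 _)
    rw [ENNReal.add_halves] at this
    exact absurd h4 (not_lt.2 this)
  have h3 := MF_weak g1 (τ / 2) (by simp [hτ0])
  have h4 : volume {x | τ < MF g x} ≤ volume {x | τ / 2 < MF g1 x} := measure_mono h2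
  have h5 : ENNReal.ofReal (t ^ (-(1:ℝ))) = τ⁻¹ := by
    rw [Real.rpow_neg_one, ENNReal.ofReal_inv_of_pos ht]
  rw [h5]
  refine h4.trans ?_
  calc volume {x | τ / 2 < MF g1 x} = (τ/2)⁻¹ * ((τ / 2) * volume {x | τ / 2 < MF g1 x}) := by
        rw [← mul_assoc, ENNReal.inv_mul_cancel (by simp [hτ0]) (by simp [ENNReal.div_eq_top, hτt]), one_mul]
    _ ≤ (τ/2)⁻¹ * (4 * ∫⁻ y, g1 y) := by gcongr
    _ = _ := by
        rw [ENNReal.inv_div (by simp) (by simp), div_eq_mul_inv]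
        ring_nf

/-- constant for the maximal function -/
lemma MF_strong (p : ℝ) (hp : 1 < p) : ∃ C : ℝ≥0∞, C ≠ ⊤ ∧ ∀ g : ℝ → ℝ≥0∞, Measurable g →
    ∫⁻ x, MF g x ^ p ≤ C * ∫⁻ x, g x ^ p := by
  refine ⟨ENNReal.ofReal p * (8 * (2 ^ (p - 1) / ENNReal.ofReal (p - 1))), ?_, fun g hg => ?_⟩
  · refine ENNReal.mul_ne_top ENNReal.ofReal_ne_top (ENNReal.mul_ne_top (by simp) ?_)
    refine ENNReal.div_ne_top (ENNReal.rpow_ne_top_of_nonneg (by linarith) (by simp)) (by simpa using hp)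
  rw [layer_cake p (by linarith) _ (MF_measurable g), mul_assoc, mul_assoc]
  gcongr
  rw [← mk_hi 1 p (by norm_num) hp g hg 2, ← lintegral_const_mul' _ _ (by simp)]
  refine setLIntegral_mono' measurableSet_Ioi fun t ht => ?_
  refine (mul_le_mul_right (MF_weak2 g hg t ht) _).trans (le_of_eq ?_)
  ring

lemma radial_le (φ : ℝ → ℝ≥0∞) (hφ : Measurable φ) (hanti : ∀ s t, 0 ≤ s → s ≤ t → φ t ≤ φ s)
    (hfin : ∫⁻ y, φ |y| ≠ ⊤) (g : ℝ → ℝ≥0∞) (hg : Measurable g) (x : ℝ) :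
    ∫⁻ y, φ |x - y| * g y ≤ (∫⁻ y, φ |y|) * MF g x := by
  have hval : ∀ c : ℝ≥0∞, c = ∫⁻ t in Ioi (0:ℝ), (if ENNReal.ofReal t < c then 1 else 0) := by
    intro c
    have := layer_val 1 one_pos c
    simpa using this.symm
  have hset : ∀ t : ℝ, 0 < t → ∫⁻ y, (if ENNReal.ofReal t < φ |x - y| then 1 else 0) * g y
      ≤ (∫⁻ y, (if ENNReal.ofReal t < φ |y| then 1 else 0)) * MF g x := by
    intro t ht
    have hvol : (∫⁻ y, (if ENNReal.ofReal t < φ |y| then 1 else 0) : ℝ≥0∞)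
        = volume {y | ENNReal.ofReal t < φ |y|} := by
      have : (fun y : ℝ => (if ENNReal.ofReal t < φ |y| then 1 else 0 : ℝ≥0∞))
          = {y | ENNReal.ofReal t < φ |y|}.indicator 1 := by ext y; simp [indicator]
      rw [this, lintegral_indicator_one (measurableSet_lt (by fun_prop) (by fun_prop))]
    rw [hvol]
    have hM : ENNReal.ofReal t * volume {y : ℝ | ENNReal.ofReal t < φ |y|} ≤ ∫⁻ y, φ |y| := by
      refine le_trans ?_ (mul_meas_ge_le_lintegral₀ (by fun_prop) (ENNReal.ofReal t))
      gcongr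
      intro hh; exact le_of_lt hh
    have hvt : volume {y : ℝ | ENNReal.ofReal t < φ |y|} ≠ ⊤ := by
      intro h
      rw [h, ENNReal.mul_top (by simpa using ht)] at hM
      exact hfin (top_le_iff.1 hM)
    -- the set of radii
    set S : Set ℝ := {s | 0 ≤ s ∧ ENNReal.ofReal t < φ s} with hS
    have hball : ∀ s ∈ S, Metric.ball (0:ℝ) s ⊆ {y | ENNReal.ofReal t < φ |y|} := by
      intro s hs y hy
      have : |y| < s := by simpa using hy
      exact hs.2.trans_le (hanti _ _ (abs_nonneg _) this.le)
    have hbdd : BddAbove S := by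
      refine ⟨(volume {y : ℝ | ENNReal.ofReal t < φ |y|}).toReal, fun s hs => ?_⟩
      have h1 := measure_mono (μ := volume) (hball s hs)
      rw [Real.volume_ball] at h1
      have h2 := ENNReal.toReal_mono hvt h1
      rw [ENNReal.toReal_ofReal (by linarith [hs.1])] at h2
      linarith [hs.1]
    have hind : (∫⁻ y, (if ENNReal.ofReal t < φ |x - y| then 1 else 0) * g y)
        = ∫⁻ y in {y | ENNReal.ofReal t < φ |x - y|}, g y := by
      rw [← lintegral_indicator (measurableSet_lt (by fun_prop) (by fun_prop))]
      refine lintegral_congr fun y => ?_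
      by_cases h : ENNReal.ofReal t < φ |x - y| <;> simp [indicator, h]
    rw [hind]
    set ρ := sSup S with hρ
    have hsub : {y | ENNReal.ofReal t < φ |x - y|} ⊆ Metric.closedBall x ρ := by
      intro y hy
      rw [Metric.mem_closedBall, dist_comm, Real.dist_eq]
      exact le_csSup hbdd ⟨abs_nonneg _, hy⟩
    by_cases hρ0 : 0 < ρ
    · refine (lintegral_mono_set hsub).trans ((MF_ball_le g x ρ hρ0).trans ?_)
      gcongr
      rw [← Real.volume_ball 0]
      refine measure_mono fun y hy => ?_
      have hy : |y| < ρ := by simpa using hy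
      have hne : S.Nonempty := by
        by_contra hne
        rw [not_nonempty_iff_eq_empty] at hne
        rw [hρ, hne, Real.sSup_empty] at hρ0
        exact lt_irrefl _ hρ0
      obtain ⟨s, hs, hys⟩ := exists_lt_of_lt_csSup hne hy
      exact hball s hs (by simpa using hys)
    · have : ∫⁻ y in {y | ENNReal.ofReal t < φ |x - y|}, g y = 0 := by
        apply setLIntegral_measure_zero
        refine measure_mono_null hsub ?_
        rw [Real.volume_closedBall, ENNReal.ofReal_eq_zero]; linarith
      rw [this]; exact zero_le
  have hm1 : Measurable (Function.uncurry fun (y t : ℝ) =>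
      (if ENNReal.ofReal t < φ |x - y| then 1 else 0 : ℝ≥0∞)) := by
    unfold Function.uncurry
    exact Measurable.ite (measurableSet_lt (by fun_prop) (by fun_prop)) (by fun_prop) (by fun_prop)
  have hm2 : Measurable (Function.uncurry fun (y t : ℝ) =>
      (if ENNReal.ofReal t < φ |y| then 1 else 0 : ℝ≥0∞)) := by
    unfold Function.uncurry
    exact Measurable.ite (measurableSet_lt (by fun_prop) (by fun_prop)) (by fun_prop) (by fun_prop)
  calc ∫⁻ y, φ |x - y| * g y
      = ∫⁻ y, ∫⁻ t in Ioi (0:ℝ), (if ENNReal.ofReal t < φ |x - y| then 1 else 0) * g y := by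
        refine lintegral_congr fun y => ?_
        rw [lintegral_mul_const _ (hm1.of_uncurry_left)]
        congr 1
        exact hval _
    _ = ∫⁻ t in Ioi (0:ℝ), ∫⁻ y, (if ENNReal.ofReal t < φ |x - y| then 1 else 0) * g y := by
        apply lintegral_lintegral_swap
        exact (hm1.mul (hg.comp measurable_fst)).aemeasurable
    _ ≤ ∫⁻ t in Ioi (0:ℝ), (∫⁻ y, (if ENNReal.ofReal t < φ |y| then 1 else 0)) * MF g x :=
        setLIntegral_mono' measurableSet_Ioi fun t ht => hset t ht
    _ = (∫⁻ t in Ioi (0:ℝ), (∫⁻ y, (if ENNReal.ofReal t < φ |y| then 1 else 0))) * MF g x := by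
        rw [lintegral_mul_const]
        exact hm2.lintegral_prod_left
    _ = (∫⁻ y, ∫⁻ t in Ioi (0:ℝ), (if ENNReal.ofReal t < φ |y| then 1 else 0)) * MF g x := by
        rw [lintegral_lintegral_swap hm2.aemeasurable]
    _ = _ := by
        congr 1
        exact lintegral_congr fun y => (hval _).symm

lemma poisson_integral (s : ℝ) (hs : 0 < s) :
    Integrable (fun y : ℝ => s / (y ^ 2 + s ^ 2)) ∧ ∫ y : ℝ, s / (y ^ 2 + s ^ 2) = Real.pi := by
  have h : (fun y : ℝ => s / (y ^ 2 + s ^ 2)) = fun y => s⁻¹ * (1 + (y / s) ^ 2)⁻¹ := by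
    ext y; field_simp; ring
  rw [h]
  constructor
  · exact (integrable_inv_one_add_sq.comp_div hs.ne').const_mul _
  · rw [integral_const_mul, Measure.integral_comp_div (fun y => (1 + y ^ 2)⁻¹),
      integral_univ_inv_one_add_sq, abs_of_pos hs, smul_eq_mul, ← mul_assoc,
      inv_mul_cancel₀ hs.ne', one_mul]

lemma poisson_le (s : ℝ) (hs : 0 < s) (g : ℝ → ℝ≥0∞) (hg : Measurable g) (x : ℝ) :
    ∫⁻ y, ENNReal.ofReal (s / ((x - y) ^ 2 + s ^ 2)) * g y ≤ ENNReal.ofReal Real.pi * MF g x := by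
  have hint : ∫⁻ y : ℝ, ENNReal.ofReal (s / (|y| ^ 2 + s ^ 2)) = ENNReal.ofReal Real.pi := by
    simp only [sq_abs]
    rw [← (poisson_integral s hs).2, ofReal_integral_eq_lintegral_ofReal (poisson_integral s hs).1]
    exact Eventually.of_forall fun y => by positivity
  have := radial_le (fun y => ENNReal.ofReal (s / (y ^ 2 + s ^ 2))) (by fun_prop) ?_ ?_ g hg x
  · rw [hint] at this
    simpa only [sq_abs] using this
  · intro a b ha hab
    apply ENNReal.ofReal_le_ofReal
    gcongr
  · rw [hint]; exact ENNReal.ofReal_ne_top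


lemma MF_zero (x : ℝ) : MF (fun _ => 0) x = 0 := by simp [MF]

lemma MF_le_of_le (h : ℝ → ℝ≥0∞) (c : ℝ≥0∞) (H : ∀ y, h y ≤ c) (x : ℝ) : MF h x ≤ c := by
  refine (MF_mono (h := fun y => 0 + c) (by simpa using H) x).trans ?_
  refine (MF_add_const (fun _ => 0) measurable_const c x).trans ?_
  rw [MF_zero, zero_add]

lemma cheb2 (F : ℝ → ℝ≥0∞) (hF : Measurable F) (t : ℝ) (ht : 0 < t) (B : ℝ≥0∞)
    (h : ∫⁻ x, F x ^ (2:ℝ) ≤ B) :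
    volume {x | ENNReal.ofReal (t / 2) < F x} ≤ 4 * (ENNReal.ofReal (t ^ (-(2:ℝ))) * B) := by
  have h1 := mul_meas_ge_le_lintegral₀ (μ := volume) (f := fun x => F x ^ (2:ℝ)) (by fun_prop)
    (ENNReal.ofReal (t / 2) ^ (2:ℝ))
  have h2 : volume {x | ENNReal.ofReal (t / 2) < F x} ≤
      volume {x | ENNReal.ofReal (t / 2) ^ (2:ℝ) ≤ F x ^ (2:ℝ)} := by
    refine measure_mono fun x hx => ?_
    have hx : ENNReal.ofReal (t / 2) < F x := hx
    exact ENNReal.rpow_le_rpow hx.le (by norm_num)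
  have h3 : ENNReal.ofReal (t / 2) ^ (2:ℝ) * (4 * ENNReal.ofReal (t ^ (-(2:ℝ)))) = 1 := by
    rw [ENNReal.ofReal_rpow_of_pos (by positivity), show (4:ℝ≥0∞) = ENNReal.ofReal 4 by simp,
      ← ENNReal.ofReal_mul (by positivity), ← ENNReal.ofReal_mul (by positivity),
      ENNReal.ofReal_eq_one, Real.rpow_neg ht.le]
    norm_num
    field_simp
    norm_num
  calc volume {x | ENNReal.ofReal (t / 2) < F x}
      = (4 * ENNReal.ofReal (t ^ (-(2:ℝ)))) *
        (ENNReal.ofReal (t / 2) ^ (2:ℝ) * volume {x | ENNReal.ofReal (t / 2) < F x}) := by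
        rw [← mul_assoc, mul_comm (4 * _), h3, one_mul]
    _ ≤ (4 * ENNReal.ofReal (t ^ (-(2:ℝ)))) * B := by
        gcongr
        refine le_trans ?_ (h1.trans h)
        gcongr
    _ = _ := by ring

lemma cheb1 (F g : ℝ → ℝ≥0∞) (A : ℝ) (hA : 0 < A)
    (h : ∀ x, F x ≤ ENNReal.ofReal A * MF g x) (t : ℝ) (ht : 0 < t) :
    volume {x | ENNReal.ofReal (t / 2) < F x} ≤
      ENNReal.ofReal (8 * A) * (ENNReal.ofReal (t ^ (-(1:ℝ))) * ∫⁻ x, g x) := by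
  set τ := ENNReal.ofReal (t / (2 * A))
  have h1 := MF_weak g τ (by simp [τ]; positivity)
  have h2 : volume {x | ENNReal.ofReal (t / 2) < F x} ≤ volume {x | τ < MF g x} := by
    refine measure_mono fun x hx => ?_
    have hx : ENNReal.ofReal (t / 2) < F x := hx
    have h3 := hx.trans_le (h x)
    rw [show t / 2 = A * (t / (2 * A)) by field_simp, ENNReal.ofReal_mul hA.le] at h3
    exact lt_of_mul_lt_mul_left' h3
  have h3 : τ * (ENNReal.ofReal (2 * A) * ENNReal.ofReal (t ^ (-(1:ℝ)))) = 1 := by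
    rw [← ENNReal.ofReal_mul (by positivity), ← ENNReal.ofReal_mul (by positivity),
      ENNReal.ofReal_eq_one, Real.rpow_neg_one]
    field_simp
  calc volume {x | ENNReal.ofReal (t / 2) < F x} ≤ volume {x | τ < MF g x} := h2
    _ = (ENNReal.ofReal (2 * A) * ENNReal.ofReal (t ^ (-(1:ℝ)))) *
        (τ * volume {x | τ < MF g x}) := by
        rw [← mul_assoc, mul_comm (_ * _) τ, h3, one_mul]
    _ ≤ (ENNReal.ofReal (2 * A) * ENNReal.ofReal (t ^ (-(1:ℝ)))) * (4 * ∫⁻ x, g x) := by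
        gcongr
    _ = _ := by
        rw [show 8 * A = 4 * (2 * A) by ring, ENNReal.ofReal_mul (by norm_num : (0:ℝ) ≤ 4)]
        rw [show ENNReal.ofReal 4 = 4 by simp]
        ring

lemma interp (p : ℝ) (hp : 1 < p) (A : ℝ) (hA : 0 < A) : ∃ C δ : ℝ, 0 < C ∧ 0 < δ ∧
    ∀ (F : ℝ → ℝ≥0∞) (g : ℝ → ℝ≥0∞) (Fh Fl : ℝ≥0∞ → ℝ → ℝ≥0∞) (b : ℝ), 0 < b → b ≤ 1 →
      Measurable F → Measurable g → (∀ x, g x ≠ ⊤) →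
      (∀ t, Measurable (Fh t)) → (∀ t, Measurable (Fl t)) → 
      (∀ t x, F x ≤ Fh t x + Fl t x) →
      (∀ t x, Fh t x ≤ ENNReal.ofReal A * MF (fun y => if t < g y then g y else 0) x) →
      (∀ t x, Fl t x ≤ ENNReal.ofReal A * MF (fun y => if g y ≤ t then g y else 0) x) →
      (∀ t, ∫⁻ x, Fh t x ^ (2:ℝ) ≤ ENNReal.ofReal b * ∫⁻ y, (if t < g y then g y ^ (2:ℝ) else 0)) →
      (∀ t, ∫⁻ x, Fl t x ^ (2:ℝ) ≤ ENNReal.ofReal b * ∫⁻ y, (if g y ≤ t then g y ^ (2:ℝ) else 0)) →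
      ∫⁻ x, F x ^ p ≤ ENNReal.ofReal (C * b ^ δ) * ∫⁻ x, g x ^ p := by
  have hsplit : ∀ (F Fh Fl : ℝ → ℝ≥0∞) (t : ℝ), 0 < t → (∀ x, F x ≤ Fh x + Fl x) → 
      {x | ENNReal.ofReal t < F x} ⊆
        {x | ENNReal.ofReal (t / 2) < Fh x} ∪ {x | ENNReal.ofReal (t / 2) < Fl x} := by
    intro F Fh Fl t ht h x hx
    by_contra hcon
    have h1 : ¬ (ENNReal.ofReal (t / 2) < Fh x) := fun hh => hcon (Or.inl hh)
    have h2 : ¬ (ENNReal.ofReal (t / 2) < Fl x) := fun hh => hcon (Or.inr hh)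
    have hx : ENNReal.ofReal t < F x := hx
    have h3 := (h x).trans (add_le_add (not_lt.1 h1) (not_lt.1 h2))
    rw [← ENNReal.ofReal_add (by positivity) (by positivity), add_halves] at h3
    exact absurd hx (not_lt.2 h3)
  have hth : ∀ (D t : ℝ) (_ : 0 < D) (c : ℝ≥0∞), 
      ENNReal.ofReal (t / D) < c ↔ ENNReal.ofReal t < ENNReal.ofReal D * c := by
    intro D t hD c
    rw [ENNReal.ofReal_div_of_pos hD, ENNReal.div_lt_iff (by simp [hD]) (by simp), mul_comm]
  rcases lt_trichotomy p 2 with h2 | h2 | h2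
  · -- p < 2
    refine ⟨p * (8 * A / (p - 1) + 4 / (2 - p)), p - 1, ?_, by linarith, ?_⟩
    · have : 0 < p - 1 := by linarith
      have : 0 < 2 - p := by linarith
      positivity
    intro F g Fh Fl b hb hb1 hF hg hgt hFh hFl hFs hh1 hl1 hh2 hl2
    have hDh := mk_hi 1 p one_pos hp g hg (ENNReal.ofReal b)
    have hDl := mk_lo 2 p h2 two_pos g hg hgt (ENNReal.ofReal b) (by simpa using hb) (by simp)
    rw [layer_cake p (by linarith) F hF]
    have key : ∀ t ∈ Ioi (0:ℝ), ENNReal.ofReal (t ^ (p - 1)) * volume {x | ENNReal.ofReal t < F x}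
        ≤ ENNReal.ofReal (8 * A) * (ENNReal.ofReal (t ^ (p - 1)) * (ENNReal.ofReal (t ^ (-(1:ℝ))) *
          ∫⁻ x, if ENNReal.ofReal t < ENNReal.ofReal b * g x then g x ^ (1:ℝ) else 0)) +
          ENNReal.ofReal (4 * b) * (ENNReal.ofReal (t ^ (p - 1)) * (ENNReal.ofReal (t ^ (-(2:ℝ))) *
          ∫⁻ x, if ENNReal.ofReal b * g x ≤ ENNReal.ofReal t then g x ^ (2:ℝ) else 0)) := by
      intro t ht
      have ht : 0 < t := ht
      set τ := ENNReal.ofReal (t / b) with hτ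
      have e1 := cheb1 (Fh τ) _ A hA (hh1 τ) t ht
      have e2 := cheb2 (Fl τ) (hFl τ) t ht _ (hl2 τ)
      have e3 := (measure_mono (μ := volume) (hsplit F (Fh τ) (Fl τ) t ht (hFs τ))).trans
        (measure_union_le _ _)
      have c1 : (∫⁻ x, if τ < g x then g x else 0) =
          ∫⁻ x, if ENNReal.ofReal t < ENNReal.ofReal b * g x then g x ^ (1:ℝ) else 0 := by
        refine lintegral_congr fun x => ?_
        simp only [hτ, hth b t hb, ENNReal.rpow_one]
      have c2 : (∫⁻ x, if g x ≤ τ then g x ^ (2:ℝ) else 0) =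
          ∫⁻ x, if ENNReal.ofReal b * g x ≤ ENNReal.ofReal t then g x ^ (2:ℝ) else 0 := by
        refine lintegral_congr fun x => ?_
        have : g x ≤ τ ↔ ENNReal.ofReal b * g x ≤ ENNReal.ofReal t := by
          rw [← not_lt, ← not_lt, hτ, hth b t hb]
        simp only [this]
      rw [c1] at e1
      rw [c2] at e2
      refine (mul_le_mul_right (e3.trans (add_le_add e1 e2)) _).trans (le_of_eq ?_)
      rw [ENNReal.ofReal_mul (by norm_num : (0:ℝ) ≤ 4), show ENNReal.ofReal 4 = 4 by simp]
      ring
    have hmeas : Measurable fun t : ℝ => ENNReal.ofReal (8 * A) * (ENNReal.ofReal (t ^ (p - 1)) * (ENNReal.ofReal (t ^ (-(1:ℝ))) *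
          ∫⁻ x, if ENNReal.ofReal t < ENNReal.ofReal b * g x then g x ^ (1:ℝ) else 0)) := by
      have hm : Measurable (Function.uncurry fun (t x : ℝ) => 
          if ENNReal.ofReal t < ENNReal.ofReal b * g x then g x ^ (1:ℝ) else 0) := by
        unfold Function.uncurry
        exact Measurable.ite (measurableSet_lt (by fun_prop) (by fun_prop)) (by fun_prop) (by fun_prop)
      have := hm.lintegral_prod_right (ν := volume)
      fun_prop
    refine (mul_le_mul_right (setLIntegral_mono' measurableSet_Ioi key) _).trans ?_
    rw [lintegral_add_left hmeas, lintegral_const_mul' _ _ ENNReal.ofReal_ne_top,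
      lintegral_const_mul' _ _ ENNReal.ofReal_ne_top, hDh]
    refine (mul_le_mul_right (add_le_add le_rfl (mul_le_mul_right hDl _)) _).trans (le_of_eq ?_)
    have p1 : 0 < p - 1 := by linarith
    have p2 : 0 < 2 - p := by linarith
    rw [← mul_assoc, ← mul_assoc, ← add_mul, ← mul_assoc]
    congr 1
    rw [ENNReal.ofReal_rpow_of_pos hb, ENNReal.ofReal_rpow_of_pos hb, ← ENNReal.ofReal_div_of_pos p1,
      ← ENNReal.ofReal_div_of_pos p2, ← ENNReal.ofReal_mul (by positivity), 
      ← ENNReal.ofReal_mul (by positivity), ← ENNReal.ofReal_add (by positivity) (by positivity),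
      ← ENNReal.ofReal_mul (by positivity)]
    congr 1
    rw [show p - 1 = (p - 2) + 1 by ring, Real.rpow_add hb, Real.rpow_one]
    ring
  · -- p = 2
    subst h2
    refine ⟨1, 1, one_pos, one_pos, ?_⟩
    intro F g Fh Fl b hb hb1 hF hg hgt hFh hFl hFs hh1 hl1 hh2 hl2
    have : ∀ x, F x ≤ Fl ⊤ x := by
      intro x
      have h3 := hh1 ⊤ x
      simp only [not_top_lt, if_false, MF_zero, mul_zero] at h3
      refine (hFs ⊤ x).trans ?_
      rw [le_antisymm h3 zero_le, zero_add]
    have h4 := hl2 ⊤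
    simp only [le_top, if_true] at h4
    rw [one_mul, Real.rpow_one]
    refine le_trans ?_ h4
    gcongr with x
    exact this x
  · -- p > 2
    refine ⟨p * (4 * (2 * A) ^ (p - 2) / (p - 2)), 1, ?_, one_pos, ?_⟩
    · have : 0 < p - 2 := by linarith
      positivity
    intro F g Fh Fl b hb hb1 hF hg hgt hFh hFl hFs hh1 hl1 hh2 hl2
    have hDh := mk_hi 2 p two_pos h2 g hg (ENNReal.ofReal (2 * A))
    rw [layer_cake p (by linarith) F hF]
    have key : ∀ t ∈ Ioi (0:ℝ), ENNReal.ofReal (t ^ (p - 1)) * volume {x | ENNReal.ofReal t < F x}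
        ≤ ENNReal.ofReal (4 * b) * (ENNReal.ofReal (t ^ (p - 1)) * (ENNReal.ofReal (t ^ (-(2:ℝ))) *
          ∫⁻ x, if ENNReal.ofReal t < ENNReal.ofReal (2 * A) * g x then g x ^ (2:ℝ) else 0)) := by
      intro t ht
      have ht : 0 < t := ht
      set τ := ENNReal.ofReal (t / (2 * A)) with hτ
      have e2 := cheb2 (Fh τ) (hFh τ) t ht _ (hh2 τ)
      have e3 := (measure_mono (μ := volume) (hsplit F (Fh τ) (Fl τ) t ht (hFs τ))).trans
        (measure_union_le _ _)
      have e4 : {x | ENNReal.ofReal (t / 2) < Fl τ x} = ∅ := by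
        ext x
        simp only [mem_ofPred_eq, mem_empty_iff_false, iff_false, not_lt]
        refine (hl1 τ x).trans ?_
        have h5 : MF (fun y => if g y ≤ τ then g y else 0) x ≤ τ := by
          apply MF_le_of_le
          intro y; split_ifs with h
          · exact h
          · exact zero_le
        refine (mul_le_mul_right h5 _).trans ?_
        rw [hτ, ← ENNReal.ofReal_mul hA.le]
        apply le_of_eq; congr 1; field_simp
      rw [e4, measure_empty, add_zero] at e3
      have c2 : (∫⁻ x, if τ < g x then g x ^ (2:ℝ) else 0) =
          ∫⁻ x, if ENNReal.ofReal t < ENNReal.ofReal (2 * A) * g x then g x ^ (2:ℝ) else 0 := by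
        refine lintegral_congr fun x => ?_
        simp only [hτ, hth (2 * A) t (by positivity)]
      rw [c2] at e2
      refine (mul_le_mul_right (e3.trans e2) _).trans (le_of_eq ?_)
      rw [ENNReal.ofReal_mul (by norm_num : (0:ℝ) ≤ 4), show ENNReal.ofReal 4 = 4 by simp]
      ring
    refine (mul_le_mul_right (setLIntegral_mono' measurableSet_Ioi key) _).trans ?_
    rw [lintegral_const_mul' _ _ ENNReal.ofReal_ne_top, hDh]
    have p2 : 0 < p - 2 := by linarith
    rw [← mul_assoc, ← mul_assoc]
    apply le_of_eq
    congr 1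
    rw [ENNReal.ofReal_rpow_of_pos (by positivity), ← ENNReal.ofReal_div_of_pos p2, 
      ← ENNReal.ofReal_mul (by positivity), 
      ← ENNReal.ofReal_mul (by positivity)]
    congr 1
    rw [Real.rpow_one]
    ring

lemma hp_cauchy (G : ℂ → ℂ) (s : ℝ) (hs : 0 < s) (hG : DifferentiableOn ℂ G {z | -s < z.im})
    (p : ℝ) (hp : 1 < p) (C : ℝ) (hb : ∀ z : ℂ, 0 ≤ z.im → ‖G z‖ ≤ C * (1 + ‖z‖) ^ (-p)) :
    Integrable (fun x : ℝ => G x) ∧ ∫ x : ℝ, G x = 0 := by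
  have hcont : Continuous fun x : ℝ => G x := by
    have h1 : ContinuousOn (fun x : ℝ => G x) univ := by
      refine hG.continuousOn.comp Complex.continuous_ofReal.continuousOn ?_
      intro x _
      show -s < (x:ℂ).im
      simpa using hs
    exact continuousOn_univ.1 h1
  have hint : Integrable (fun x : ℝ => G x) := by
    have h1 : Integrable (fun x : ℝ => C * (1 + ‖x‖) ^ (-p)) :=
      (integrable_one_add_norm (by simpa using hp)).const_mul C
    refine h1.mono' hcont.aestronglyMeasurable (Eventually.of_forall fun x => ?_)
    have := hb x (by simp)
    simpa using this
  refine ⟨hint, ?_⟩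
  have hC : 0 ≤ C := by
    have := (norm_nonneg _).trans (hb 0 (by simp))
    simpa using this
  have hlim := intervalIntegral_tendsto_integral hint tendsto_neg_atTop_atBot tendsto_id
  have hlim2 : Tendsto (fun R : ℝ => ∫ x in (-R)..R, G x) atTop (𝓝 0) := by
    have hz : Tendsto (fun R : ℝ => 4 * C * (1 + R) ^ (-(p - 1))) atTop (𝓝 0) := by
      have h1 : Tendsto (fun R : ℝ => (1 + R) ^ (-(p - 1))) atTop (𝓝 0) :=
        (tendsto_rpow_neg_atTop (by linarith)).comp (tendsto_atTop_add_const_left _ 1 tendsto_id)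
      simpa using h1.const_mul (4 * C)
    refine squeeze_zero_norm' ?_ hz
    filter_upwards [eventually_gt_atTop 0] with R hR
    have hrect := Complex.integral_boundary_rect_eq_zero_of_differentiableOn G
      ((-R : ℝ) : ℂ) ((R : ℂ) + R * Complex.I) (hG.mono ?_)
    · simp only [Complex.ofReal_re, Complex.add_re, Complex.mul_re, Complex.I_re, mul_zero,
        Complex.ofReal_im, Complex.I_im, mul_one, sub_self, add_zero, Complex.add_im,
        Complex.mul_im, zero_add, Complex.ofReal_zero, zero_mul] at hrect
      have hside : ∀ z : ℂ, 0 ≤ z.im → R ≤ ‖z‖ → ‖G z‖ ≤ C * (1 + R) ^ (-p) := by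
        intro z hz hzR
        refine (hb z hz).trans ?_
        gcongr 1
        exact Real.rpow_le_rpow_of_nonpos (by positivity) (by linarith) (by linarith)
      have e1 : ‖∫ x in (-R)..R, G (x + R * Complex.I)‖ ≤ C * (1 + R) ^ (-p) * |R - (-R)| := by
        refine intervalIntegral.norm_integral_le_of_norm_le_const fun x _ => hside _ ?_ ?_
        · simp [hR.le]
        · have := Complex.abs_im_le_norm ((x:ℂ) + R * Complex.I)
          simp [abs_of_pos hR] at this
          simpa using this
      have e2 : ∀ c : ℝ, |c| = R →
          ‖∫ y in (0:ℝ)..R, G (c + y * Complex.I)‖ ≤ C * (1 + R) ^ (-p) * |R - 0| := by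
        intro c hc
        refine intervalIntegral.norm_integral_le_of_norm_le_const fun y hy => hside _ ?_ ?_
        · rw [uIoc_of_le hR.le] at hy; simp [hy.1.le]
        · have := Complex.abs_re_le_norm ((c:ℂ) + y * Complex.I)
          simp [hc] at this
          simpa using this
      have e3 := e2 R (abs_of_pos hR)
      have e4 := e2 (-R) (by rw [abs_neg, abs_of_pos hR])
      have hEq : ∫ x in (-R)..R, G x = (∫ x in (-R)..R, G (x + R * Complex.I))
          - Complex.I • (∫ y in (0:ℝ)..R, G (R + y * Complex.I))
          + Complex.I • ∫ y in (0:ℝ)..R, G ((-R : ℝ) + y * Complex.I) := by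
        linear_combination hrect
      rw [hEq]
      refine (norm_add_le _ _).trans ((add_le_add (norm_sub_le _ _) le_rfl).trans ?_)
      rw [norm_smul, norm_smul, Complex.norm_I, one_mul, one_mul]
      have h5 : (1 + R) ^ (-(p - 1)) = (1 + R) ^ (-p) * (1 + R) := by
        rw [show -(p-1) = -p + 1 by ring, Real.rpow_add (by linarith), Real.rpow_one]
      rw [h5]
      rw [sub_neg_eq_add, abs_of_pos (by linarith : (0:ℝ) < R + R)] at e1
      rw [sub_zero, abs_of_pos hR] at e3 e4
      have h6 : 0 ≤ C * (1 + R) ^ (-p) := by positivity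
      nlinarith
    · intro z hz
      simp only [Complex.ofReal_re, Complex.add_re, Complex.mul_re, Complex.I_re, mul_zero,
        Complex.ofReal_im, Complex.I_im, mul_one, sub_self, add_zero, Complex.add_im,
        Complex.mul_im, zero_add] at hz
      have := hz.2
      rw [mem_preimage, uIcc_of_le hR.le] at this
      show -s < z.im
      linarith [this.1]
  exact tendsto_nhds_unique hlim hlim2

lemma inv_bound (a z : ℂ) (ha : a.im < 0) (hz : 0 ≤ z.im) :
    ‖(z - a)⁻¹‖ ≤ (1 + (‖a‖ + 1) / (-a.im)) * (1 + ‖z‖)⁻¹ := by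
  have h1 : -a.im ≤ ‖z - a‖ := by
    have := (le_abs_self _).trans (Complex.abs_im_le_norm (z - a))
    rw [Complex.sub_im] at this
    linarith
  have h0 : 0 < -a.im := by linarith
  have h2 : ‖z‖ ≤ ‖z - a‖ + ‖a‖ := by
    simpa using norm_add_le (z - a) a
  have h3 : 0 < ‖z - a‖ := by linarith
  rw [norm_inv, ← div_eq_mul_inv, inv_eq_one_div, div_le_div_iff₀ h3 (by positivity)]
  have h4 : ‖a‖ + 1 ≤ (‖a‖ + 1) / (-a.im) * ‖z - a‖ := by
    rw [div_mul_eq_mul_div, le_div_iff₀ h0]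
    gcongr
  nlinarith

lemma kern_zero (a b : ℂ) (ha : a.im < 0) (hb : b.im < 0) :
    Integrable (fun t : ℝ => ((t:ℂ) - a)⁻¹ * ((t:ℂ) - b)⁻¹) ∧
    ∫ t : ℝ, ((t:ℂ) - a)⁻¹ * ((t:ℂ) - b)⁻¹ = 0 := by
  refine hp_cauchy (fun z => (z - a)⁻¹ * (z - b)⁻¹) (min (-a.im) (-b.im)) (by simp [ha, hb]) ?_ 2
    (by norm_num) ((1 + (‖a‖ + 1) / (-a.im)) * (1 + (‖b‖ + 1) / (-b.im))) ?_
  · have hne : ∀ c : ℂ, min (-a.im) (-b.im) ≤ -c.im →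
        ∀ z ∈ {z : ℂ | -min (-a.im) (-b.im) < z.im}, z - c ≠ 0 := by
      intro c hc z hz h
      have hz : -min (-a.im) (-b.im) < z.im := hz
      rw [sub_eq_zero.1 h] at hz
      linarith
    have hd : ∀ c : ℂ, min (-a.im) (-b.im) ≤ -c.im →
        DifferentiableOn ℂ (fun z => (z - c)⁻¹) {z : ℂ | -min (-a.im) (-b.im) < z.im} :=
      fun c hc => (by fun_prop : DifferentiableOn ℂ (fun z => z - c) _).inv (hne c hc)
    exact (hd a (min_le_left _ _)).mul (hd b (min_le_right _ _))
  · intro z hz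
    rw [norm_mul]
    refine (mul_le_mul (inv_bound a z ha hz) (inv_bound b z hb hz) (norm_nonneg _) ?_).trans
      (le_of_eq ?_)
    · have : 0 < -a.im := by linarith
      positivity
    · rw [Real.rpow_neg (by positivity)]
      norm_num
      field_simp

lemma poisson_kern (x r s τ : ℝ) (hr : 0 < r) (hs : 0 < s) :
    ∫ t : ℝ, ((r / ((x - t) ^ 2 + r ^ 2) : ℝ) : ℂ) * ((t:ℂ) + s * Complex.I - τ)⁻¹
      = Real.pi * ((x:ℂ) + ((r + s : ℝ) : ℂ) * Complex.I - τ)⁻¹ := by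
  set w : ℂ := x + r * Complex.I
  set a : ℂ := τ - s * Complex.I with ha
  set b : ℂ := x - r * Complex.I with hb
  have haim : a.im < 0 := by simp [ha, hs]
  have hbim : b.im < 0 := by simp [hb, hr]
  obtain ⟨hi, h0⟩ := kern_zero a b haim hbim
  have hP := poisson_integral r hr
  have hP1 : Integrable (fun t : ℝ => r / ((x - t) ^ 2 + r ^ 2)) := by
    have := hP.1.comp_sub_left x
    simpa using this
  have hP2 : ∫ t : ℝ, r / ((x - t) ^ 2 + r ^ 2) = Real.pi := by
    rw [← hP.2]
    exact integral_sub_left_eq_self (fun t => r / (t ^ 2 + r ^ 2)) volume x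
  have hne : ∀ (c : ℂ), c.im < 0 → ∀ z : ℂ, 0 ≤ z.im → z - c ≠ 0 := by
    intro c hc z hz h
    rw [sub_eq_zero.1 h] at hz; linarith
  have hpt : ∀ t : ℝ, ((r / ((x - t) ^ 2 + r ^ 2) : ℝ) : ℂ) * ((t:ℂ) + s * Complex.I - τ)⁻¹
      = (w - a)⁻¹ * ((r / ((x - t) ^ 2 + r ^ 2) : ℝ) : ℂ)
        - (r * (w - a)⁻¹) * (((t:ℂ) - a)⁻¹ * ((t:ℂ) - b)⁻¹) := by
    intro t
    have h1 : (t:ℂ) - a ≠ 0 := hne a haim t (by simp)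
    have h2 : (t:ℂ) - b ≠ 0 := hne b hbim t (by simp)
    have h3 : w - a ≠ 0 := hne a haim w (by simp [w, hr.le])
    have h4 : (t:ℂ) - w ≠ 0 := by
      intro h
      have := congrArg Complex.im h
      simp [w] at this
      linarith
    have h5 : ((r / ((x - t) ^ 2 + r ^ 2) : ℝ) : ℂ) = r * (((t:ℂ) - w)⁻¹ * ((t:ℂ) - b)⁻¹) := by
      have : (((x - t) ^ 2 + r ^ 2 : ℝ) : ℂ) = ((t:ℂ) - w) * ((t:ℂ) - b) := by
        push_cast
        simp only [w, hb]
        linear_combination (r:ℂ) ^ 2 * Complex.I_sq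
      rw [Complex.ofReal_div, this, div_eq_mul_inv, mul_inv]
    have h6 : (t:ℂ) + s * Complex.I - τ = t - a := by rw [ha]; ring
    rw [h5, h6]
    field_simp
    ring
  have hP3 : Integrable (fun t : ℝ => ((r / ((x - t) ^ 2 + r ^ 2) : ℝ) : ℂ)) := hP1.ofReal
  simp_rw [hpt]
  rw [integral_sub (hP3.const_mul _) (hi.const_mul _), integral_const_mul, integral_const_mul,
    h0, mul_zero, sub_zero, integral_complex_ofReal, hP2, mul_comm]
  congr 2
  simp only [w, ha]; push_cast; ring

/-- Cauchy transform -/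
noncomputable def CT (f : ℝ → ℂ) (z : ℂ) : ℂ := ∫ t : ℝ, f t * (z - t)⁻¹

lemma inv_norm_le (z : ℂ) (t : ℝ) (hz : 0 < z.im) : ‖(z - t)⁻¹‖ ≤ z.im⁻¹ := by
  rw [norm_inv]
  apply inv_anti₀ hz
  have := (le_abs_self _).trans (Complex.abs_im_le_norm (z - t))
  simpa using this

lemma sub_ne (z : ℂ) (t : ℝ) (hz : 0 < z.im) : z - t ≠ 0 := by
  intro h
  have := congrArg Complex.im h
  simp at this; linarith

lemma inv_cont (z : ℂ) (hz : 0 < z.im) : Continuous fun t : ℝ => (z - t)⁻¹ :=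
  Continuous.inv₀ (by fun_prop) fun t => sub_ne z t hz

lemma CT_integrable (f : ℝ → ℂ) (hf : Integrable f) (z : ℂ) (hz : 0 < z.im) :
    Integrable fun t : ℝ => f t * (z - t)⁻¹ := by
  refine (hf.norm.mul_const (z.im⁻¹)).mono' (hf.1.mul (inv_cont z hz).aestronglyMeasurable) ?_
  refine Eventually.of_forall fun t => ?_
  rw [norm_mul]
  gcongr
  exact inv_norm_le z t hz

lemma CT_diff (f : ℝ → ℂ) (hf : Integrable f) :
    DifferentiableOn ℂ (CT f) {z | 0 < z.im} := by
  intro z₀ hz₀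
  have hz₀ : 0 < z₀.im := hz₀
  apply DifferentiableAt.differentiableWithinAt
  have hU : {z : ℂ | z₀.im / 2 < z.im} ∈ 𝓝 z₀ := by
    apply (isOpen_lt continuous_const Complex.continuous_im).mem_nhds
    show z₀.im / 2 < z₀.im
    linarith
  refine (hasDerivAt_integral_of_dominated_loc_of_deriv_le (μ := volume)
    (𝕜 := ℂ) (F := fun (z : ℂ) (t : ℝ) => f t * (z - t)⁻¹)
    (F' := fun (z : ℂ) (t : ℝ) => f t * (-1 / (z - t) ^ 2)) (bound := fun t => ‖f t‖ * ((z₀.im / 2)⁻¹) ^ 2)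
    hU ?_ (CT_integrable f hf z₀ hz₀) ?_ ?_ (hf.norm.mul_const _) ?_).2.differentiableAt
  · filter_upwards [hU] with z hz
    have hz : z₀.im / 2 < z.im := hz
    exact hf.1.mul (inv_cont z (by linarith)).aestronglyMeasurable
  · refine hf.1.mul (Continuous.aestronglyMeasurable ?_)
    exact Continuous.div₀ (by fun_prop) (by fun_prop) fun t => pow_ne_zero _ (sub_ne z₀ t hz₀)
  · refine Eventually.of_forall fun t z hz => ?_
    have hz : z₀.im / 2 < z.im := hz
    have h1 := inv_norm_le z t (by linarith)
    have h2 : z.im⁻¹ ≤ (z₀.im / 2)⁻¹ := inv_anti₀ (by linarith) hz.le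
    rw [norm_mul, neg_div, norm_neg, one_div, norm_inv, norm_pow, ← inv_pow, ← norm_inv]
    gcongr
    exact h1.trans h2
  · refine Eventually.of_forall fun t z hz => ?_
    have hz : z₀.im / 2 < z.im := hz
    have := (((hasDerivAt_id z).sub_const (t:ℂ)).inv (sub_ne z t (by linarith))).const_mul (f t)
    simpa using this

lemma CT_cont (f : ℝ → ℂ) (hf : Integrable f) (s : ℝ) (hs : 0 < s) :
    Continuous fun x : ℝ => CT f (x + s * Complex.I) := by
  rw [← continuousOn_univ]
  refine (CT_diff f hf).continuousOn.comp (by fun_prop) ?_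
  intro x _
  show 0 < ((x:ℂ) + s * Complex.I).im
  simpa using hs

lemma CT_bound (f : ℝ → ℂ) (hf : Integrable f) (N : ℝ) (hN : 0 ≤ N) (hsupp : ∀ t, N < |t| → f t = 0)
    (s : ℝ) (hs : 0 < s) : ∃ K : ℝ, 0 ≤ K ∧ ∀ z : ℂ, 0 ≤ z.im →
      ‖CT f (z + s * Complex.I)‖ ≤ K * (1 + ‖z‖)⁻¹ := by
  refine ⟨(∫ t, ‖f t‖) * (1 + (N + s + 1) / s), ?_, fun z hz => ?_⟩
  · have : 0 ≤ ∫ t, ‖f t‖ := integral_nonneg fun t => norm_nonneg _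
    positivity
  rw [mul_assoc, ← integral_mul_const]
  have him : 0 < (z + s * Complex.I).im := by simp; linarith
  refine norm_integral_le_of_norm_le (hf.norm.mul_const _) (Eventually.of_forall fun t => ?_)
  rw [norm_mul]
  by_cases ht : N < |t|
  · simp [hsupp t ht]
  gcongr
  have h1 := inv_bound ((t:ℂ) - s * Complex.I) z (by simpa using hs) hz
  have h2 : z - ((t:ℂ) - s * Complex.I) = z + s * Complex.I - t := by ring
  rw [h2] at h1
  refine h1.trans ?_
  have h3 : ‖(t:ℂ) - s * Complex.I‖ ≤ N + s := by
    refine (norm_sub_le _ _).trans ?_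
    simp [abs_of_pos hs]
    linarith
  simp only [Complex.sub_im, Complex.ofReal_im, Complex.mul_im, Complex.ofReal_re, Complex.I_im,
    mul_one, Complex.I_re, mul_zero, add_zero, zero_sub, neg_neg]
  gcongr

lemma trig_ineq (p : ℝ) (hp : 1 < p) (hp2 : p ≤ 2) : ∃ A B : ℝ, 0 < A ∧ 0 < B ∧
    ∀ θ : ℝ, |θ| ≤ Real.pi / 2 → 1 ≤ A * Real.cos θ ^ p - B * Real.cos (θ * p) := by
  have hpi := Real.pi_pos
  set θ₀ := Real.pi * (p + 1) / (4 * p) with hθ₀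
  have h1 : θ₀ * p = Real.pi * (p + 1) / 4 := by rw [hθ₀]; field_simp
  have hθ₀pos : 0 < θ₀ := by positivity
  have hθ₀lt : θ₀ < Real.pi / 2 := by
    rw [hθ₀, div_lt_div_iff₀ (by linarith) (by norm_num)]
    nlinarith
  have hc : 0 < -Real.cos (θ₀ * p) := by
    rw [h1]
    have := Real.cos_neg_of_pi_div_two_lt_of_lt (x := Real.pi * (p + 1) / 4) (by nlinarith) (by nlinarith)
    linarith
  have hc0 : 0 < Real.cos θ₀ := Real.cos_pos_of_mem_Ioo ⟨by linarith, hθ₀lt⟩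
  set c := -Real.cos (θ₀ * p) with hcdef
  refine ⟨(1 + c⁻¹) / Real.cos θ₀ ^ p, c⁻¹, by positivity, by positivity, ?_⟩
  have key : ∀ θ : ℝ, 0 ≤ θ → θ ≤ Real.pi / 2 →
      1 ≤ (1 + c⁻¹) / Real.cos θ₀ ^ p * Real.cos θ ^ p - c⁻¹ * Real.cos (θ * p) := by
    intro θ h0 hθ
    have hcos : 0 ≤ Real.cos θ := Real.cos_nonneg_of_mem_Icc ⟨by linarith, hθ⟩
    rcases le_total θ θ₀ with h | h
    · have h2 : Real.cos θ₀ ≤ Real.cos θ :=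
        Real.cos_le_cos_of_nonneg_of_le_pi h0 (by linarith) h
      have h3 : Real.cos θ₀ ^ p ≤ Real.cos θ ^ p := by gcongr
      have h4 : 1 + c⁻¹ ≤ (1 + c⁻¹) / Real.cos θ₀ ^ p * Real.cos θ ^ p := by
        rw [div_mul_eq_mul_div, le_div_iff₀ (by positivity)]
        gcongr
      have h5 : c⁻¹ * Real.cos (θ * p) ≤ c⁻¹ * 1 := by
        gcongr; exact Real.cos_le_one _
      linarith
    · have h2 : Real.cos (θ * p) ≤ Real.cos (θ₀ * p) := by
        apply Real.cos_le_cos_of_nonneg_of_le_pi (by positivity)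
        · nlinarith
        · gcongr
      have h3 : c⁻¹ * Real.cos (θ * p) ≤ c⁻¹ * (-c) := by
        gcongr; rw [hcdef]; linarith
      rw [mul_neg, inv_mul_cancel₀ hc.ne'] at h3
      have h4 : 0 ≤ (1 + c⁻¹) / Real.cos θ₀ ^ p * Real.cos θ ^ p := by positivity
      linarith
  intro θ hθ
  have := key |θ| (abs_nonneg _) hθ
  rw [Real.cos_abs] at this
  rcases abs_cases θ with ⟨h, _⟩ | ⟨h, _⟩
  · rwa [h] at this
  · rw [h, neg_mul, Real.cos_neg] at this; exact this

lemma riesz_pos (p : ℝ) (hp : 1 < p) (hp2 : p ≤ 2) : ∃ C : ℝ≥0∞, C ≠ ⊤ ∧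
    ∀ (φ : ℝ → ℝ), Measurable φ → (∀ t, 0 ≤ φ t) → Integrable φ →
    ∀ N : ℝ, 0 ≤ N → (∀ t, N < |t| → φ t = 0) → ∀ s : ℝ, 0 < s →
      ∫⁻ x : ℝ, ‖CT (fun t => (φ t : ℂ)) (x + s * Complex.I)‖ₑ ^ p
        ≤ C * ∫⁻ t, ENNReal.ofReal (φ t) ^ p := by
  obtain ⟨A, B, hA, hB, htrig⟩ := trig_ineq p hp hp2
  obtain ⟨CM, hCM, hM⟩ := MF_strong p hp
  have hp0 : 0 < p := by linarith
  refine ⟨ENNReal.ofReal A * (ENNReal.ofReal Real.pi ^ p * CM), ?_, ?_⟩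
  · refine ENNReal.mul_ne_top (by simp) (ENNReal.mul_ne_top ?_ hCM)
    exact ENNReal.rpow_ne_top_of_nonneg hp0.le (by simp)
  intro φ hφm hφ0 hφi N hN hsupp s hs
  by_cases hz : φ =ᵐ[volume] 0
  · have h1 : ∀ z, CT (fun t => (φ t : ℂ)) z = 0 := by
      intro z
      unfold CT
      apply integral_eq_zero_of_ae
      filter_upwards [hz] with t ht
      simp [ht]
    simp [h1, hp0]
  have hfi : Integrable (fun t => (φ t : ℂ)) := hφi.ofReal
  set F : ℂ → ℂ := fun z => Complex.I * CT (fun t => (φ t : ℂ)) (z + s * Complex.I) with hFdef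
  have hre : ∀ z : ℂ, -s < z.im → (F z).re =
      ∫ t, φ t * ((z.im + s) / ((z.re - t) ^ 2 + (z.im + s) ^ 2)) := by
    intro z hz
    have him : 0 < (z + s * Complex.I).im := by simp; linarith
    have h1 := (CT_integrable _ hfi (z + s * Complex.I) him).const_mul Complex.I
    have h2 := integral_re h1
    simp only [hFdef, CT]
    rw [← integral_const_mul]
    refine Eq.trans h2.symm ?_
    congr 1; ext t
    rw [← mul_assoc, mul_comm Complex.I, mul_assoc]
    rw [RCLike.re_to_complex, Complex.re_ofReal_mul]
    congr 1
    rw [Complex.mul_re, Complex.inv_re, Complex.inv_im, Complex.normSq_apply]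
    simp
    ring_nf
  have hpos : ∀ z : ℂ, -s < z.im → 0 < (F z).re := by
    intro z hz'
    rw [hre z hz']
    have hk : ∀ t : ℝ, 0 < (z.im + s) / ((z.re - t) ^ 2 + (z.im + s) ^ 2) := by
      intro t
      have : 0 < z.im + s := by linarith
      positivity
    rw [integral_pos_iff_support_of_nonneg]
    · have : (Function.support fun t => φ t * ((z.im + s) / ((z.re - t) ^ 2 + (z.im + s) ^ 2)))
          = Function.support φ := by
        ext t; simp only [Function.mem_support, ne_eq, mul_eq_zero, (hk t).ne', or_false]
      rw [this, pos_iff_ne_zero]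
      intro h
      exact hz (by rwa [Filter.EventuallyEq, ae_iff])
    · exact fun t => mul_nonneg (hφ0 t) (hk t).le
    · have h2 : 0 < z.im + s := by linarith
      refine (hφi.mul_const ((z.im + s) / (z.im + s) ^ 2)).mono' (by fun_prop) ?_
      refine Eventually.of_forall fun t => ?_
      rw [Real.norm_of_nonneg (mul_nonneg (hφ0 t) (hk t).le)]
      gcongr
      · exact hφ0 t
      · nlinarith [sq_nonneg (z.re - t)]
  have hFd : DifferentiableOn ℂ F {z | -s < z.im} := by
    refine DifferentiableOn.const_mul ?_ _
    refine (CT_diff _ hfi).comp (by fun_prop) ?_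
    intro z hz'
    have hz' : -s < z.im := hz'
    show 0 < (z + s * Complex.I).im
    simp; linarith
  obtain ⟨K, hK0, hK⟩ := CT_bound _ hfi N hN (fun t ht => by simp [hsupp t ht]) s hs
  have hFb : ∀ z : ℂ, 0 ≤ z.im → ‖F z‖ ≤ K * (1 + ‖z‖)⁻¹ := by
    intro z hz'
    simp only [hFdef, norm_mul, Complex.norm_I, one_mul]
    exact hK z hz'
  obtain ⟨hGi, hG0⟩ := hp_cauchy (fun z => F z ^ (p : ℂ)) s hs
    (hFd.cpow (differentiableOn_const _) (fun z hz' => Or.inl (hpos z hz'))) p hp (K ^ p) (by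
      intro z hz'
      rw [Complex.norm_cpow_real]
      refine (Real.rpow_le_rpow (norm_nonneg _) (hFb z hz') hp0.le).trans (le_of_eq ?_)
      rw [Real.mul_rpow hK0 (by positivity), Real.inv_rpow (by positivity), Real.rpow_neg (by positivity)])
  have hre0 : ∫ x : ℝ, (F x ^ (p:ℂ)).re = 0 := by
    have := integral_re hGi
    simp only [RCLike.re_to_complex] at this
    rw [this, hG0, Complex.zero_re]
  have hineq : ∀ x : ℝ, ‖F x‖ ^ p ≤ A * (F x).re ^ p - B * (F x ^ (p:ℂ)).re := by
    intro x
    have hx := hpos x (by simpa using hs)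
    have harg : |(F x).arg| ≤ Real.pi / 2 := Complex.abs_arg_le_pi_div_two_iff.2 hx.le
    have h1 := htrig _ harg
    rw [Complex.cpow_ofReal_re]
    have h2 : (F x).re = ‖F x‖ * Real.cos (F x).arg := (Complex.norm_mul_cos_arg _).symm
    have h3 : (F x).re ^ p = ‖F x‖ ^ p * Real.cos (F x).arg ^ p := by
      rw [h2, Real.mul_rpow (norm_nonneg _)
        (Real.cos_nonneg_of_mem_Icc ⟨by linarith [(abs_le.1 harg).1], (abs_le.1 harg).2⟩)]
    rw [h3]
    have h4 : 0 ≤ ‖F x‖ ^ p := by positivity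
    nlinarith
  have hFc : Continuous fun x : ℝ => F x := continuous_const.mul (CT_cont _ hfi s hs)
  have hni : Integrable fun x : ℝ => ‖F x‖ ^ p := by
    have := hGi.norm
    simpa only [Complex.norm_cpow_real] using this
  have hri : Integrable fun x : ℝ => (F x).re ^ p := by
    refine hni.mono' ?_ (Eventually.of_forall fun x => ?_)
    · exact (Continuous.rpow_const (Complex.continuous_re.comp hFc)
        (fun x => Or.inr hp0.le)).aestronglyMeasurable
    · have hx := hpos x (by simpa using hs)
      rw [Real.norm_of_nonneg (by positivity)]
      gcongr
      exact Complex.re_le_norm _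
  have hmain : ∫ x : ℝ, ‖F x‖ ^ p ≤ A * ∫ x : ℝ, (F x).re ^ p := by
    have h1 := integral_mono hni ((hri.const_mul A).sub (hGi.re.const_mul B)) hineq
    simp only [RCLike.re_to_complex] at h1
    have h2 : Integrable fun x : ℝ => B * (F x ^ (p:ℂ)).re := hGi.re.const_mul B
    have h3 : ∫ x : ℝ, (A * (F x).re ^ p - B * (F x ^ (p:ℂ)).re) = A * ∫ x : ℝ, (F x).re ^ p := by
      rw [integral_sub (hri.const_mul A) h2, integral_const_mul, integral_const_mul, hre0]
      ring
    exact h1.trans (le_of_eq h3)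
  have hL : ∫⁻ x : ℝ, ‖CT (fun t => (φ t : ℂ)) (x + s * Complex.I)‖ₑ ^ p
      = ENNReal.ofReal (∫ x : ℝ, ‖F x‖ ^ p) := by
    rw [ofReal_integral_eq_lintegral_ofReal hni (Eventually.of_forall fun x => by positivity)]
    refine lintegral_congr fun x => ?_
    rw [← ENNReal.ofReal_rpow_of_nonneg (norm_nonneg _) hp0.le]
    have : ‖F x‖ = ‖CT (fun t => (φ t : ℂ)) (x + s * Complex.I)‖ := by simp [hFdef]
    rw [this, ofReal_norm]
  rw [hL]
  refine (ENNReal.ofReal_le_ofReal hmain).trans ?_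
  rw [ENNReal.ofReal_mul hA.le, mul_assoc]
  gcongr
  rw [ofReal_integral_eq_lintegral_ofReal hri (Eventually.of_forall fun x => by
    have hx := hpos x (by simpa using hs)
    positivity)]
  rw [mul_assoc]
  refine le_trans ?_ (mul_le_mul_right (hM (fun t => ENNReal.ofReal (φ t)) (by fun_prop)) _)
  rw [← lintegral_const_mul' _ _ (ENNReal.rpow_ne_top_of_nonneg hp0.le (by simp))]
  refine lintegral_mono fun x => ?_
  have hx := hpos x (by simpa using hs)
  rw [← ENNReal.mul_rpow_of_nonneg _ _ hp0.le, ← ENNReal.ofReal_rpow_of_nonneg hx.le hp0.le]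
  gcongr
  refine le_trans (le_of_eq ?_) (poisson_le s hs _ (by fun_prop) x)
  rw [hre x (by simpa using hs)]
  simp only [Complex.ofReal_im, Complex.ofReal_re, zero_add]
  rw [ofReal_integral_eq_lintegral_ofReal]
  · refine lintegral_congr fun t => ?_
    rw [mul_comm, ENNReal.ofReal_mul (by positivity)]
  · refine (hφi.mul_const (s / s ^ 2)).mono' (by fun_prop) ?_
    refine Eventually.of_forall fun t => ?_
    rw [Real.norm_of_nonneg (mul_nonneg (hφ0 t) (by positivity))]
    gcongr
    · exact hφ0 t
    · nlinarith [sq_nonneg (x - t)]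
  · exact Eventually.of_forall fun t => mul_nonneg (hφ0 t) (by positivity)

lemma CT_add (f g : ℝ → ℂ) (hf : Integrable f) (hg : Integrable g) (z : ℂ) (hz : 0 < z.im) :
    CT (fun t => f t + g t) z = CT f z + CT g z := by
  unfold CT
  rw [← integral_add (CT_integrable f hf z hz) (CT_integrable g hg z hz)]
  congr 1; ext t; ring

lemma CT_smul (c : ℂ) (f : ℝ → ℂ) (z : ℂ) : CT (fun t => c * f t) z = c * CT f z := by
  unfold CT
  rw [← integral_const_mul]
  congr 1; ext t; ring

lemma im_pos_aux (x s : ℝ) (hs : 0 < s) : 0 < ((x:ℂ) + s * Complex.I).im := by simpa using hs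

lemma four_rpow (p : ℝ) (hp : 0 ≤ p) (a b c d : ℝ≥0∞) :
    (a + b + c + d) ^ p ≤ 4 ^ p * (a ^ p + b ^ p + c ^ p + d ^ p) := by
  set m := max (max a b) (max c d) with hm
  have ha : a ≤ m := by simp [hm]
  have hb : b ≤ m := by simp [hm]
  have hc : c ≤ m := by simp [hm]
  have hd : d ≤ m := by simp [hm]
  have h1 : a + b + c + d ≤ 4 * m := by
    calc a + b + c + d ≤ m + m + m + m := by gcongr
      _ = 4 * m := by ring
  refine (ENNReal.rpow_le_rpow h1 hp).trans ?_
  rw [ENNReal.mul_rpow_of_nonneg _ _ hp]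
  gcongr
  have hmm : m = a ∨ m = b ∨ m = c ∨ m = d := by
    rcases max_choice (max a b) (max c d) with h | h
    · rcases max_choice a b with h' | h' <;> (rw [hm, h, h']; simp)
    · rcases max_choice c d with h' | h' <;> (rw [hm, h, h']; simp)
  rcases hmm with h | h | h | h <;> rw [h]
  · rw [add_assoc, add_assoc]; exact le_self_add
  · calc b ^ p ≤ b ^ p + (a ^ p + c ^ p + d ^ p) := le_self_add
      _ = _ := by ring
  · calc c ^ p ≤ c ^ p + (a ^ p + b ^ p + d ^ p) := le_self_add
      _ = _ := by ring
  · exact le_add_self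

lemma riesz_low (p : ℝ) (hp : 1 < p) (hp2 : p ≤ 2) : ∃ C : ℝ≥0∞, C ≠ ⊤ ∧
    ∀ (f : ℝ → ℂ), Measurable f → Integrable f →
    ∀ N : ℝ, 0 ≤ N → (∀ t, N < |t| → f t = 0) → ∀ s : ℝ, 0 < s →
      ∫⁻ x : ℝ, ‖CT f (x + s * Complex.I)‖ₑ ^ p ≤ C * ∫⁻ t, ‖f t‖ₑ ^ p := by
  obtain ⟨C, hC, H⟩ := riesz_pos p hp hp2
  have hp0 : 0 < p := by linarith
  have h4 : (4:ℝ≥0∞) ^ p ≠ ⊤ := ENNReal.rpow_ne_top_of_nonneg hp0.le (by norm_num)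
  refine ⟨4 ^ p * (4 * C), ENNReal.mul_ne_top h4 (ENNReal.mul_ne_top (by norm_num) hC), ?_⟩
  intro f hfm hfi N hN hsupp s hs
  have key : ∀ φ : ℝ → ℝ, Measurable φ → (∀ t, 0 ≤ φ t) → (∀ t, φ t ≤ ‖f t‖) →
      Integrable (fun t => (φ t : ℂ)) ∧ ∫⁻ x : ℝ, ‖CT (fun t => (φ t : ℂ)) (x + s * Complex.I)‖ₑ ^ p
        ≤ C * ∫⁻ t, ‖f t‖ₑ ^ p := by
    intro φ hφ h0 hle
    have hi : Integrable φ := hfi.norm.mono' hφ.aestronglyMeasurable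
      (Eventually.of_forall fun t => by rw [Real.norm_of_nonneg (h0 t)]; exact hle t)
    refine ⟨hi.ofReal, (H φ hφ h0 hi N hN (fun t ht => ?_) s hs).trans ?_⟩
    · have := hle t
      rw [hsupp t ht, norm_zero] at this
      exact le_antisymm this (h0 t)
    · gcongr with t
      rw [← ofReal_norm]
      exact ENNReal.ofReal_le_ofReal (hle t)
  have hre : Measurable fun t => (f t).re := Complex.measurable_re.comp hfm
  have him : Measurable fun t => (f t).im := Complex.measurable_im.comp hfm
  obtain ⟨i1, k1⟩ := key (fun t => max (f t).re 0) (by fun_prop) (fun t => le_max_right _ _)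
    (fun t => max_le (Complex.re_le_norm _) (norm_nonneg _))
  obtain ⟨i2, k2⟩ := key (fun t => max (-(f t).re) 0) (by fun_prop) (fun t => le_max_right _ _)
    (fun t => max_le ((neg_le_abs _).trans (Complex.abs_re_le_norm _)) (norm_nonneg _))
  obtain ⟨i3, k3⟩ := key (fun t => max (f t).im 0) (by fun_prop) (fun t => le_max_right _ _)
    (fun t => max_le ((le_abs_self _).trans (Complex.abs_im_le_norm _)) (norm_nonneg _))
  obtain ⟨i4, k4⟩ := key (fun t => max (-(f t).im) 0) (by fun_prop) (fun t => le_max_right _ _)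
    (fun t => max_le ((neg_le_abs _).trans (Complex.abs_im_le_norm _)) (norm_nonneg _))
  have hdec : f = fun t => (((max (f t).re 0 : ℝ) : ℂ) + (-1) * ((max (-(f t).re) 0 : ℝ) : ℂ)
      + Complex.I * ((max (f t).im 0 : ℝ) : ℂ) + (-Complex.I) * ((max (-(f t).im) 0 : ℝ) : ℂ)) := by
    ext t
    have e : ∀ x : ℝ, max x 0 - max (-x) 0 = x := by
      intro x; rcases le_total x 0 with h | h
      · rw [max_eq_right h, max_eq_left (by linarith)]; ring
      · rw [max_eq_left h, max_eq_right (by linarith)]; ring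
    apply Complex.ext
    · simp; linarith [e (f t).re]
    · simp; linarith [e (f t).im]
  set u1 := fun t : ℝ => ((max (f t).re 0 : ℝ) : ℂ) with hu1
  set u2 := fun t : ℝ => ((max (-(f t).re) 0 : ℝ) : ℂ) with hu2
  set u3 := fun t : ℝ => ((max (f t).im 0 : ℝ) : ℂ) with hu3
  set u4 := fun t : ℝ => ((max (-(f t).im) 0 : ℝ) : ℂ) with hu4
  have hpt : ∀ x : ℝ, ‖CT f (x + s * Complex.I)‖ₑ ≤ ‖CT u1 (x + s * Complex.I)‖ₑ +
      ‖CT u2 (x + s * Complex.I)‖ₑ + ‖CT u3 (x + s * Complex.I)‖ₑ + ‖CT u4 (x + s * Complex.I)‖ₑ := by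
    intro x
    have hz := im_pos_aux x s hs
    have hd : CT f (x + s * Complex.I) = CT u1 (x + s * Complex.I) + (-1) * CT u2 (x + s * Complex.I)
      + Complex.I * CT u3 (x + s * Complex.I) + (-Complex.I) * CT u4 (x + s * Complex.I) := by
      conv_lhs => rw [hdec]
      have := CT_add (fun t => u1 t + (-1) * u2 t + Complex.I * u3 t) (fun t => (-Complex.I) * u4 t)
        ((i1.add (i2.const_mul _)).add (i3.const_mul _)) (i4.const_mul _) _ hz
      rw [CT_smul, CT_add (fun t => u1 t + (-1) * u2 t) (fun t => Complex.I * u3 t)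
        (i1.add (i2.const_mul _)) (i3.const_mul _) _ hz, CT_smul,
        CT_add u1 (fun t => (-1) * u2 t) i1 (i2.const_mul _) _ hz, CT_smul] at this
      exact this
    rw [hd]
    refine (enorm_add_le _ _).trans (add_le_add ((enorm_add_le _ _).trans
      (add_le_add ((enorm_add_le _ _).trans (add_le_add le_rfl ?_)) ?_)) ?_)
    all_goals rw [enorm_mul]; simp [← ofReal_norm]
  have hm : ∀ u : ℝ → ℂ, Integrable u → Measurable fun x : ℝ => ‖CT u (x + s * Complex.I)‖ₑ ^ p := by
    intro u hu
    exact ((CT_cont u hu s hs).measurable.enorm).pow_const p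
  calc ∫⁻ x : ℝ, ‖CT f (x + s * Complex.I)‖ₑ ^ p
      ≤ ∫⁻ x : ℝ, 4 ^ p * (‖CT u1 (x + s * Complex.I)‖ₑ ^ p +
      ‖CT u2 (x + s * Complex.I)‖ₑ ^ p + ‖CT u3 (x + s * Complex.I)‖ₑ ^ p +
      ‖CT u4 (x + s * Complex.I)‖ₑ ^ p) := by
        refine lintegral_mono fun x => ?_
        exact (ENNReal.rpow_le_rpow (hpt x) hp0.le).trans (four_rpow p hp0.le _ _ _ _)
    _ ≤ _ := by
        rw [lintegral_const_mul' _ _ h4, lintegral_add_right _ (hm _ i4), lintegral_add_right _ (hm _ i3),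
          lintegral_add_right _ (hm _ i2), mul_assoc]
        gcongr
        refine (add_le_add (add_le_add (add_le_add k1 k2) k3) k4).trans (le_of_eq ?_)
        ring

lemma CT_dual (f g : ℝ → ℂ) (hf : Integrable f) (hg : Integrable g) (s : ℝ) (hs : 0 < s) :
    ∫ x : ℝ, g x * CT f (x + s * Complex.I) =
      - ∫ t : ℝ, f t * (starRingEnd ℂ) (CT (fun x => (starRingEnd ℂ) (g x)) (t + s * Complex.I)) := by
  have hL : ∀ x : ℝ, g x * CT f (x + s * Complex.I) =
      ∫ t : ℝ, g x * f t * ((x:ℂ) + s * Complex.I - t)⁻¹ := by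
    intro x
    unfold CT
    rw [← integral_const_mul]
    congr 1; ext t; ring
  have hR : ∀ t : ℝ, f t * (starRingEnd ℂ) (CT (fun x => (starRingEnd ℂ) (g x)) (t + s * Complex.I))
      = - ∫ x : ℝ, g x * f t * ((x:ℂ) + s * Complex.I - t)⁻¹ := by
    intro t
    unfold CT
    rw [← integral_conj, ← integral_const_mul, ← integral_neg]
    congr 1; ext x
    simp only [map_mul, map_inv₀, map_sub, map_add, Complex.conj_ofReal, Complex.conj_I,
      Complex.conj_conj]
    have : (t:ℂ) + s * -Complex.I - x = -((x:ℂ) + s * Complex.I - t) := by ring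
    rw [this, inv_neg]; ring
  simp_rw [hL, hR]
  rw [integral_neg, neg_neg]
  apply integral_integral_swap
  have h1 := hg.mul_prod hf
  refine (h1.norm.mul_const (s⁻¹)).mono' ?_ ?_
  · refine h1.1.mul (Continuous.aestronglyMeasurable ?_)
    refine Continuous.inv₀ (by fun_prop) fun z => ?_
    exact sub_ne _ _ (im_pos_aux z.1 s hs)
  · refine Eventually.of_forall fun z => ?_
    simp only [Function.uncurry]
    rw [norm_mul]
    gcongr
    simpa using inv_norm_le ((z.1:ℂ) + s * Complex.I) z.2 (im_pos_aux z.1 s hs)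

lemma riesz_high (q : ℝ) (hq : 2 < q) : ∃ C : ℝ≥0∞, C ≠ ⊤ ∧
    ∀ (f : ℝ → ℂ), Measurable f → Integrable f →
    ∀ s : ℝ, 0 < s →
      ∫⁻ x : ℝ, ‖CT f (x + s * Complex.I)‖ₑ ^ q ≤ C * ∫⁻ t, ‖f t‖ₑ ^ q := by
  set p := q / (q - 1) with hp
  have hq1 : 0 < q - 1 := by linarith
  have hp1 : 1 < p := by rw [hp, lt_div_iff₀ hq1]; linarith
  have hp2 : p ≤ 2 := by rw [hp, div_le_iff₀ hq1]; linarith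
  have hpq : q.HolderConjugate p := by
    rw [Real.holderConjugate_iff]
    refine ⟨by linarith, ?_⟩
    rw [hp]; field_simp; ring
  have hp0 : 0 < p := by linarith
  have hq0 : 0 < q := by linarith
  obtain ⟨C, hC, H⟩ := riesz_low p hp1 hp2
  refine ⟨(C ^ (1 / p)) ^ q, ENNReal.rpow_ne_top_of_nonneg hq0.le
    (ENNReal.rpow_ne_top_of_nonneg (by positivity) hC), ?_⟩
  intro f hfm hfi s hs
  set u : ℝ → ℂ := fun x => CT f (x + s * Complex.I) with hu
  have huc : Continuous u := CT_cont f hfi s hs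
  have key : ∀ M : ℕ, ∫⁻ x in Icc (-(M:ℝ)) M, ‖u x‖ₑ ^ q ≤ (C ^ (1 / p)) ^ q * ∫⁻ t, ‖f t‖ₑ ^ q := by
    intro M
    set X := ∫⁻ x in Icc (-(M:ℝ)) M, ‖u x‖ₑ ^ q with hX
    set v : ℝ → ℂ := fun x => ((‖u x‖ ^ (q - 2) : ℝ) : ℂ) * (starRingEnd ℂ) (u x) with hv
    have hvc : Continuous v := by
      refine (Complex.continuous_ofReal.comp (huc.norm.rpow_const fun x => Or.inr (by linarith))).mul ?_
      exact Complex.continuous_conj.comp huc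
    set g : ℝ → ℂ := (Icc (-(M:ℝ)) M).indicator v with hg
    have hgi : Integrable g :=
      (integrable_indicator_iff measurableSet_Icc).2 (hvc.continuousOn.integrableOn_compact isCompact_Icc)
    have hgm : Measurable g := hvc.measurable.indicator measurableSet_Icc
    have huv : ∀ x, v x * u x = ((‖u x‖ ^ q : ℝ) : ℂ) := by
      intro x
      rw [hv]
      simp only
      rw [mul_assoc, mul_comm _ (u x), Complex.mul_conj, Complex.normSq_eq_norm_sq, ← Complex.ofReal_mul,
        ← Real.rpow_natCast, ← Real.rpow_add_of_nonneg (norm_nonneg _) (by linarith) (by norm_num)]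
      norm_num
    have hvn : ∀ x, ‖v x‖ = ‖u x‖ ^ (q - 1) := by
      intro x
      rw [hv]
      simp only [norm_mul, RCLike.norm_conj, Complex.norm_real]
      rw [Real.norm_of_nonneg (by positivity)]
      conv_lhs => rw [← Real.rpow_one ‖u x‖, ← Real.rpow_mul (norm_nonneg _)]
      rw [one_mul, ← Real.rpow_add_of_nonneg (norm_nonneg _) (by linarith) (by norm_num)]
      congr 1; ring
    have hdual := CT_dual f g hfi hgi s hs
    have hX1 : ∫ x : ℝ, g x * CT f (x + s * Complex.I) =
        ((∫ x in Icc (-(M:ℝ)) M, ‖u x‖ ^ q : ℝ) : ℂ) := by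
      rw [← integral_complex_ofReal, ← integral_indicator measurableSet_Icc]
      congr 1; ext x
      by_cases hx : x ∈ Icc (-(M:ℝ)) M
      · simp only [hg, indicator_of_mem hx]
        exact huv x
      · simp only [hg, indicator_of_notMem hx, zero_mul]
    have hui : IntegrableOn (fun x => ‖u x‖ ^ q) (Icc (-(M:ℝ)) M) :=
      (huc.norm.rpow_const fun x => Or.inr hq0.le).continuousOn.integrableOn_compact isCompact_Icc
    have hX2 : X = ENNReal.ofReal (∫ x in Icc (-(M:ℝ)) M, ‖u x‖ ^ q) := by
      rw [ofReal_integral_eq_lintegral_ofReal hui (Eventually.of_forall fun x => by positivity)]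
      refine lintegral_congr fun x => ?_
      rw [← ENNReal.ofReal_rpow_of_nonneg (norm_nonneg _) hq0.le, ofReal_norm]
    have hXtop : X ≠ ⊤ := by rw [hX2]; simp
    set W : ℝ → ℂ := fun t => CT (fun x => (starRingEnd ℂ) (g x)) (t + s * Complex.I) with hW
    have hcgi : Integrable (fun x => (starRingEnd ℂ) (g x)) := by
      refine hgi.norm.mono' (Complex.continuous_conj.measurable.comp hgm).aestronglyMeasurable ?_
      exact Eventually.of_forall fun x => by simp
    have hXW : X ≤ ∫⁻ t, ‖f t‖ₑ * ‖W t‖ₑ := by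
      have h1 : X = ‖∫ t : ℝ, f t * (starRingEnd ℂ) (W t)‖ₑ := by
        rw [← enorm_neg, ← hdual, hX1, hX2, ← ofReal_norm, Complex.norm_real, Real.norm_of_nonneg]
        exact integral_nonneg fun x => by positivity
      rw [h1]
      refine (enorm_integral_le_lintegral_enorm _).trans (lintegral_mono fun t => ?_)
      simp [enorm_mul, ← ofReal_norm]
    have hWm : Measurable fun t => ‖W t‖ₑ := (CT_cont _ hcgi s hs).measurable.enorm
    have hHol := ENNReal.lintegral_mul_le_Lp_mul_Lq volume hpq hfm.enorm.aemeasurable hWm.aemeasurable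
    have hWp := H (fun x => (starRingEnd ℂ) (g x)) (Complex.continuous_conj.measurable.comp hgm) hcgi M
      (by positivity) (fun t ht => by
        have : t ∉ Icc (-(M:ℝ)) M := fun h => by
          rw [mem_Icc, ← abs_le] at h; linarith
        simp [hg, indicator_of_notMem this]) s hs
    have hgp : ∫⁻ t, ‖(starRingEnd ℂ) (g t)‖ₑ ^ p = X := by
      rw [hX, ← lintegral_indicator measurableSet_Icc]
      refine lintegral_congr fun x => ?_
      by_cases hx : x ∈ Icc (-(M:ℝ)) M
      · simp only [hg, indicator_of_mem hx]
        rw [← ofReal_norm, RCLike.norm_conj, hvn, ENNReal.ofReal_rpow_of_nonneg (by positivity) hp0.le,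
          ← Real.rpow_mul (norm_nonneg _), ← ofReal_norm, ENNReal.ofReal_rpow_of_nonneg (norm_nonneg _) hq0.le]
        congr 2
        rw [hp]; field_simp
      · simp [hg, indicator_of_notMem hx, hp0]
    rw [hgp] at hWp
    have hfin : X ≤ (∫⁻ t, ‖f t‖ₑ ^ q) ^ (1 / q) * (C * X) ^ (1 / p) := by
      refine hXW.trans (hHol.trans ?_)
      gcongr
    by_cases hX0 : X = 0
    · rw [hX0]; exact zero_le
    rw [ENNReal.mul_rpow_of_nonneg _ _ (by positivity : (0:ℝ) ≤ 1 / p)] at hfin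
    have hXp : X ^ (1 / p) ≠ 0 := by
      simp [ENNReal.rpow_eq_zero_iff, hX0, hXtop]
    have hXp' : X ^ (1 / p) ≠ ⊤ := ENNReal.rpow_ne_top_of_nonneg (by positivity) hXtop
    have hsum : 1 / q + 1 / p = 1 := by have := hpq.inv_add_inv_eq_one; simpa using this
    have hXsplit : X = X ^ (1 / q) * X ^ (1 / p) := by
      rw [← ENNReal.rpow_add _ _ hX0 hXtop, hsum, ENNReal.rpow_one]
    have h3 : X ^ (1 / q) * X ^ (1 / p) ≤ ((∫⁻ t, ‖f t‖ₑ ^ q) ^ (1 / q) * C ^ (1 / p)) * X ^ (1 / p) := by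
      rw [← hXsplit, mul_assoc]; exact hfin
    have h4 := (ENNReal.mul_le_mul_iff_left hXp hXp').1 h3
    have h5 := ENNReal.rpow_le_rpow h4 hq0.le
    rw [ENNReal.mul_rpow_of_nonneg _ _ hq0.le, ← ENNReal.rpow_mul, ← ENNReal.rpow_mul,
      one_div_mul_cancel hq0.ne', ENNReal.rpow_one, ENNReal.rpow_one, mul_comm] at h5
    exact h5
  have hun : (univ : Set ℝ) = ⋃ M : ℕ, Icc (-(M:ℝ)) M := by
    symm; rw [eq_univ_iff_forall]; intro x
    obtain ⟨n, hn⟩ := exists_nat_ge |x|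
    exact mem_iUnion.2 ⟨n, abs_le.1 hn⟩
  rw [← setLIntegral_univ, hun, setLIntegral_iUnion_of_directed]
  · exact iSup_le key
  · refine Monotone.directed_le fun a b hab => Icc_subset_Icc ?_ ?_
    · simpa using hab
    · simpa using hab

lemma riesz_all (p : ℝ) (hp : 1 < p) : ∃ C : ℝ≥0∞, C ≠ ⊤ ∧
    ∀ (f : ℝ → ℂ), Measurable f → Integrable f → ∀ s : ℝ, 0 < s →
      ∫⁻ x : ℝ, ‖CT f (x + s * Complex.I)‖ₑ ^ p ≤ C * ∫⁻ t, ‖f t‖ₑ ^ p := by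
  rcases lt_or_ge 2 p with h | h
  · exact riesz_high p h
  have hp0 : 0 < p := by linarith
  obtain ⟨C, hC, H⟩ := riesz_low p hp h
  refine ⟨C, hC, fun f hfm hfi s hs => ?_⟩
  set fn : ℕ → ℝ → ℂ := fun n => (Icc (-(n:ℝ)) n).indicator f with hfn
  have hfnle : ∀ n t, ‖fn n t‖ ≤ ‖f t‖ := fun n t => norm_indicator_le_norm_self _ _
  have hfnm : ∀ n, Measurable (fn n) := fun n => hfm.indicator measurableSet_Icc
  have hfni : ∀ n, Integrable (fn n) := fun n => hfi.indicator measurableSet_Icc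
  have hlim : ∀ x : ℝ, Tendsto (fun n => ‖CT (fn n) (x + s * Complex.I)‖ₑ ^ p) atTop
      (𝓝 (‖CT f (x + s * Complex.I)‖ₑ ^ p)) := by
    intro x
    refine Tendsto.ennrpow_const p ?_
    refine (continuous_enorm.tendsto _).comp ?_
    have hz := im_pos_aux x s hs
    refine tendsto_integral_of_dominated_convergence _ (fun n => (CT_integrable _ (hfni n) _ hz).1)
      (CT_integrable f hfi _ hz).norm (fun n => Eventually.of_forall fun t => ?_)
      (Eventually.of_forall fun t => ?_)
    · rw [norm_mul, norm_mul]; gcongr; exact hfnle n t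
    · refine tendsto_const_nhds.congr' ?_
      obtain ⟨N, hN⟩ := exists_nat_ge |t|
      filter_upwards [eventually_ge_atTop N] with n hn
      have : t ∈ Icc (-(n:ℝ)) n := abs_le.1 (hN.trans (by exact_mod_cast hn))
      simp only [hfn, indicator_of_mem this]
  calc ∫⁻ x : ℝ, ‖CT f (x + s * Complex.I)‖ₑ ^ p
      = ∫⁻ x : ℝ, liminf (fun n => ‖CT (fn n) (x + s * Complex.I)‖ₑ ^ p) atTop := by
        refine lintegral_congr fun x => (hlim x).liminf_eq.symm
    _ ≤ liminf (fun n => ∫⁻ x : ℝ, ‖CT (fn n) (x + s * Complex.I)‖ₑ ^ p) atTop :=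
        lintegral_liminf_le fun n => ((CT_cont _ (hfni n) s hs).measurable.enorm).pow_const p
    _ ≤ C * ∫⁻ t, ‖f t‖ₑ ^ p := by
        refine liminf_le_of_le (by isBoundedDefault) fun b hb => ?_
        obtain ⟨n, hn⟩ := hb.exists
        refine hn.trans ((H (fn n) (hfnm n) (hfni n) n (by positivity) (fun t ht => ?_) s hs).trans ?_)
        · have : t ∉ Icc (-(n:ℝ)) n := fun h => by
            rw [mem_Icc, ← abs_le] at h; linarith
          simp only [hfn, indicator_of_notMem this]
        · gcongr with t
          rw [← ofReal_norm, ← ofReal_norm]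
          exact ENNReal.ofReal_le_ofReal (hfnle n t)

lemma CT_semigroup (f : ℝ → ℂ) (hfi : Integrable f) (x r s : ℝ) (hr : 0 < r) (hs : 0 < s) :
    ∫ t : ℝ, ((r / ((x - t) ^ 2 + r ^ 2) : ℝ) : ℂ) * CT f (t + s * Complex.I) =
      Real.pi * CT f (x + ((r + s : ℝ) : ℂ) * Complex.I) := by
  have hL : ∀ t : ℝ, ((r / ((x - t) ^ 2 + r ^ 2) : ℝ) : ℂ) * CT f (t + s * Complex.I) =
      ∫ τ : ℝ, ((r / ((x - t) ^ 2 + r ^ 2) : ℝ) : ℂ) * f τ * ((t:ℂ) + s * Complex.I - τ)⁻¹ := by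
    intro t
    unfold CT
    rw [← integral_const_mul]
    congr 1; ext τ; ring
  have hP : Integrable fun t : ℝ => ((r / ((x - t) ^ 2 + r ^ 2) : ℝ) : ℂ) := by
    have := ((poisson_integral r hr).1.comp_sub_left x).ofReal (𝕜 := ℂ)
    exact this
  simp_rw [hL]
  rw [integral_integral_swap]
  · unfold CT
    rw [← integral_const_mul]
    congr 1; ext τ
    have := poisson_kern x r s τ hr hs
    calc _ = ∫ t : ℝ, f τ * (((r / ((x - t) ^ 2 + r ^ 2) : ℝ) : ℂ) * ((t:ℂ) + s * Complex.I - τ)⁻¹) := by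
            congr 1; ext t; ring
      _ = _ := by rw [integral_const_mul, this]; ring
  · have h1 := hP.mul_prod hfi
    refine (h1.norm.mul_const (s⁻¹)).mono' ?_ ?_
    · refine h1.1.mul (Continuous.aestronglyMeasurable ?_)
      refine Continuous.inv₀ (by fun_prop) fun z => ?_
      exact sub_ne _ _ (im_pos_aux z.1 s hs)
    · refine Eventually.of_forall fun z => ?_
      simp only [Function.uncurry]
      rw [norm_mul]
      gcongr
      simpa using inv_norm_le ((z.1:ℂ) + s * Complex.I) z.2 (im_pos_aux z.1 s hs)

lemma CT_le_MF (f : ℝ → ℂ) (hfi : Integrable f) (x r s : ℝ) (hs : 0 < s) (hrs : s < r) :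
    ‖CT f (x + r * Complex.I)‖ₑ ≤ MF (fun t => ‖CT f (t + s * Complex.I)‖ₑ) x := by
  have hr : 0 < r - s := by linarith
  have h := CT_semigroup f hfi x (r - s) s hr hs
  rw [sub_add_cancel] at h
  have hpi : ENNReal.ofReal Real.pi ≠ 0 := by simp [Real.pi_pos]
  have h2 : ENNReal.ofReal Real.pi * ‖CT f (x + r * Complex.I)‖ₑ ≤
      ENNReal.ofReal Real.pi * MF (fun t => ‖CT f (t + s * Complex.I)‖ₑ) x := by
    have h3 : ENNReal.ofReal Real.pi * ‖CT f (x + r * Complex.I)‖ₑ =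
        ‖(Real.pi:ℂ) * CT f (x + r * Complex.I)‖ₑ := by
      rw [enorm_mul, ← ofReal_norm (Real.pi:ℂ), Complex.norm_real, Real.norm_of_nonneg Real.pi_pos.le]
    rw [h3, ← h]
    refine (enorm_integral_le_lintegral_enorm _).trans
      (le_trans (le_of_eq ?_) (poisson_le (r - s) hr _ (CT_cont f hfi s hs).measurable.enorm x))
    refine lintegral_congr fun t => ?_
    rw [enorm_mul, ← ofReal_norm (((r - s) / ((x - t) ^ 2 + (r - s) ^ 2) : ℝ) : ℂ), Complex.norm_real,
      Real.norm_of_nonneg (by positivity)]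
  exact (ENNReal.mul_le_mul_iff_right hpi ENNReal.ofReal_ne_top).1 h2

noncomputable def NF (f : ℝ → ℂ) (x : ℝ) : ℝ≥0∞ :=
  ⨆ s : {s : ℝ // 0 < s}, ‖CT f (x + (s:ℝ) * Complex.I)‖ₑ

lemma NF_strong (p : ℝ) (hp : 1 < p) : ∃ C : ℝ≥0∞, C ≠ ⊤ ∧
    ∀ (f : ℝ → ℂ), Measurable f → Integrable f →
      ∫⁻ x : ℝ, NF f x ^ p ≤ C * ∫⁻ t, ‖f t‖ₑ ^ p := by
  have hp0 : 0 < p := by linarith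
  obtain ⟨C1, hC1, H1⟩ := MF_strong p hp
  obtain ⟨C2, hC2, H2⟩ := riesz_all p hp
  refine ⟨C1 * C2, ENNReal.mul_ne_top hC1 hC2, fun f hfm hfi => ?_⟩
  set a : ℕ → ℝ → ℝ≥0∞ := fun n x => MF (fun t => ‖CT f (t + ((1 / ((n:ℝ) + 1) : ℝ):ℂ) * Complex.I)‖ₑ) x ^ p with ha
  have hpos : ∀ n : ℕ, 0 < 1 / ((n:ℝ) + 1) := fun n => by positivity
  have hpt : ∀ x, NF f x ^ p ≤ liminf (fun n => a n x) atTop := by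
    intro x
    rw [← ENNReal.le_rpow_inv_iff hp0]
    refine iSup_le fun s => ?_
    rw [ENNReal.le_rpow_inv_iff hp0]
    refine le_liminf_of_le (by isBoundedDefault) ?_
    have : ∀ᶠ n : ℕ in atTop, 1 / ((n:ℝ) + 1) < s.1 :=
      tendsto_one_div_add_atTop_nhds_zero_nat.eventually (gt_mem_nhds s.2)
    filter_upwards [this] with n hn
    exact ENNReal.rpow_le_rpow (CT_le_MF f hfi x s.1 _ (hpos n) hn) hp0.le
  calc ∫⁻ x : ℝ, NF f x ^ p ≤ ∫⁻ x, liminf (fun n => a n x) atTop := lintegral_mono hpt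
    _ ≤ liminf (fun n => ∫⁻ x, a n x) atTop :=
        lintegral_liminf_le fun n => (MF_measurable _).pow_const p
    _ ≤ _ := by
        refine liminf_le_of_le (by isBoundedDefault) fun b hb => ?_
        obtain ⟨n, hn⟩ := hb.exists
        refine hn.trans ((H1 _ (CT_cont f hfi _ (hpos n)).measurable.enorm).trans ?_)
        rw [mul_assoc]
        gcongr
        exact H2 f hfm hfi _ (hpos n)

lemma arctan_int (α β : ℝ) (hαβ : α ≤ β) (u u' : ℝ → ℝ) (η : ℝ) (hη : 0 < η)
    (hu : ∀ y ∈ Icc α β, HasDerivAt u (u' y) y) (hu'c : ContinuousOn u' (Icc α β))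
    (hmono : (∀ y ∈ Icc α β, 0 ≤ u' y) ∨ (∀ y ∈ Icc α β, u' y ≤ 0)) :
    ∫ y in α..β, |u' y| / (u y ^ 2 + η ^ 2) ≤ Real.pi / η := by
  have huc : ContinuousOn u (Icc α β) := fun y hy => (hu y hy).continuousAt.continuousWithinAt
  have hd : ∀ y ∈ Icc α β, HasDerivAt (fun y => Real.arctan (u y / η) / η)
      (u' y / (u y ^ 2 + η ^ 2)) y := by
    intro y hy
    have h1 := (((hu y hy).div_const η).arctan).div_const η
    have e : u' y / (u y ^ 2 + η ^ 2) = (1 / (1 + (u y / η) ^ 2) * (u' y / η)) / η := by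
      have : 0 < u y ^ 2 + η ^ 2 := by positivity
      have h2 : 1 + (u y / η) ^ 2 = (u y ^ 2 + η ^ 2) / η ^ 2 := by field_simp; ring
      rw [h2]; field_simp
    rw [e]; exact h1
  have hi : IntervalIntegrable (fun y => u' y / (u y ^ 2 + η ^ 2)) volume α β := by
    apply ContinuousOn.intervalIntegrable
    rw [uIcc_of_le hαβ]
    exact hu'c.div ((huc.pow 2).add continuousOn_const) fun y _ => by positivity
  have hI := intervalIntegral.integral_eq_sub_of_hasDerivAt (by rwa [uIcc_of_le hαβ]) hi
  have b1 := Real.arctan_lt_pi_div_two (u β / η)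
  have b2 := Real.neg_pi_div_two_lt_arctan (u β / η)
  have b3 := Real.arctan_lt_pi_div_two (u α / η)
  have b4 := Real.neg_pi_div_two_lt_arctan (u α / η)
  rw [← sub_div] at hI
  rcases hmono with h | h
  · have : ∫ y in α..β, |u' y| / (u y ^ 2 + η ^ 2) = ∫ y in α..β, u' y / (u y ^ 2 + η ^ 2) := by
      apply intervalIntegral.integral_congr
      intro y hy; rw [uIcc_of_le hαβ] at hy
      simp only [abs_of_nonneg (h y hy)]
    rw [this, hI]
    gcongr; linarith
  · have : ∫ y in α..β, |u' y| / (u y ^ 2 + η ^ 2) = - ∫ y in α..β, u' y / (u y ^ 2 + η ^ 2) := by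
      rw [← intervalIntegral.integral_neg]
      apply intervalIntegral.integral_congr
      intro y hy; rw [uIcc_of_le hαβ] at hy
      simp only [abs_of_nonpos (h y hy), neg_div]
    rw [this, hI, ← neg_div]
    gcongr; linarith

lemma osc_abs (α β : ℝ) (hαβ : α ≤ β) (Φ u u' G G' P : ℝ → ℝ) (lam η G0 D S : ℝ) (hη : 0 < η)
    (hlam : lam ≠ 0)
    (hΦ : ∀ y ∈ Icc α β, HasDerivAt Φ (P y * u y) y)
    (hu : ∀ y ∈ Icc α β, HasDerivAt u (u' y) y)
    (hG : ∀ y ∈ Icc α β, HasDerivAt G (G' y) y)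
    (hPc : ContinuousOn P (Icc α β)) (hu'c : ContinuousOn u' (Icc α β))
    (hG'c : ContinuousOn G' (Icc α β))
    (hmono : (∀ y ∈ Icc α β, 0 ≤ u' y) ∨ (∀ y ∈ Icc α β, u' y ≤ 0))
    (hG0 : ∀ y ∈ Icc α β, |G y| ≤ G0) (hD : ∀ y ∈ Icc α β, |G' y| ≤ D)
    (hS0 : 0 ≤ S)
    (hS : ∀ y ∈ Icc α β, |G y * P y| ≤ S * |u' y|) :
    ‖∫ y in α..β, Complex.exp (Complex.I * ((lam * Φ y : ℝ) : ℂ)) * ((G y * P y : ℝ) : ℂ)‖ ≤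
      Real.pi * η * S + (1 / (|lam| * η)) * ((1 + Real.pi) * G0 + (β - α) * D / 2) := by
  have hle : α ∈ Icc α β := left_mem_Icc.2 hαβ
  have hre : β ∈ Icc α β := right_mem_Icc.2 hαβ
  have hG00 : 0 ≤ G0 := (abs_nonneg _).trans (hG0 α hle)
  have huc : ContinuousOn u (Icc α β) := fun y hy => (hu y hy).continuousAt.continuousWithinAt
  have hGc : ContinuousOn G (Icc α β) := fun y hy => (hG y hy).continuousAt.continuousWithinAt
  have hΦc : ContinuousOn Φ (Icc α β) := fun y hy => (hΦ y hy).continuousAt.continuousWithinAt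
  have hden : ∀ y, 0 < u y ^ 2 + η ^ 2 := fun y => by positivity
  have hdc : ContinuousOn (fun y => u y ^ 2 + η ^ 2) (Icc α β) := (huc.pow 2).add continuousOn_const
  set E : ℝ → ℂ := fun y => Complex.exp (Complex.I * ((lam * Φ y : ℝ) : ℂ)) with hE
  have hEn : ∀ y, ‖E y‖ = 1 := fun y => by rw [hE]; simp only; rw [mul_comm, Complex.norm_exp_ofReal_mul_I]
  have hEc : ContinuousOn E (Icc α β) := by
    refine Complex.continuous_exp.comp_continuousOn (continuousOn_const.mul ?_)
    exact Complex.continuous_ofReal.comp_continuousOn (continuousOn_const.mul hΦc)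
  set V : ℝ → ℝ := fun y => u y / (u y ^ 2 + η ^ 2) with hV
  set H' : ℝ → ℝ := fun y => G' y * V y + G y * (u' y * (η ^ 2 - u y ^ 2) / (u y ^ 2 + η ^ 2) ^ 2) with hH'
  have hVb : ∀ y, |V y| ≤ 1 / (2 * η) := by
    intro y
    rw [hV]; simp only
    rw [abs_div, abs_of_pos (hden y), div_le_div_iff₀ (hden y) (by positivity)]
    nlinarith [sq_nonneg (|u y| - η), sq_abs (u y)]
  have hVc : ContinuousOn V (Icc α β) := huc.div hdc fun y _ => (hden y).ne'
  have hH'c : ContinuousOn H' (Icc α β) := by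
    refine (hG'c.mul hVc).add (hGc.mul ?_)
    exact (hu'c.mul (continuousOn_const.sub (huc.pow 2))).div (hdc.pow 2)
      fun y _ => pow_ne_zero _ (hden y).ne'
  have hVd : ∀ y ∈ Icc α β, HasDerivAt V (u' y * (η ^ 2 - u y ^ 2) / (u y ^ 2 + η ^ 2) ^ 2) y := by
    intro y hy
    have := (hu y hy).div (((hu y hy).pow 2).add_const (η ^ 2)) (hden y).ne'
    have e : u' y * (η ^ 2 - u y ^ 2) / (u y ^ 2 + η ^ 2) ^ 2 = (u' y * (u y ^ 2 + η ^ 2) -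
        u y * (((2:ℕ):ℝ) * u y ^ (2 - 1) * u' y)) / (u y ^ 2 + η ^ 2) ^ 2 := by
      congr 1; push_cast; ring
    rw [e]; exact this
  have hHd : ∀ y ∈ Icc α β, HasDerivAt (fun y => ((G y * V y : ℝ) : ℂ)) ((H' y : ℝ) : ℂ) y := by
    intro y hy
    exact ((hG y hy).mul (hVd y hy)).ofReal_comp
  have hEd : ∀ y ∈ Icc α β, HasDerivAt E (E y * (Complex.I * ((lam * (P y * u y) : ℝ) : ℂ))) y := by
    intro y hy
    exact ((((hΦ y hy).const_mul lam).ofReal_comp).const_mul Complex.I).cexp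
  have hE'c : ContinuousOn (fun y => E y * (Complex.I * ((lam * (P y * u y) : ℝ) : ℂ))) (Icc α β) := by
    refine hEc.mul (continuousOn_const.mul ?_)
    exact Complex.continuous_ofReal.comp_continuousOn (continuousOn_const.mul (hPc.mul huc))
  have hH'cc : ContinuousOn (fun y => ((H' y : ℝ) : ℂ)) (Icc α β) :=
    Complex.continuous_ofReal.comp_continuousOn hH'c
  have hparts := intervalIntegral.integral_mul_deriv_eq_deriv_mul (a := α) (b := β)
    (u := fun y => ((G y * V y : ℝ) : ℂ)) (u' := fun y => ((H' y : ℝ) : ℂ))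
    (v := E) (v' := fun y => E y * (Complex.I * ((lam * (P y * u y) : ℝ) : ℂ)))
    (by rwa [uIcc_of_le hαβ]) (by rwa [uIcc_of_le hαβ])
    (by apply ContinuousOn.intervalIntegrable; rwa [uIcc_of_le hαβ])
    (by apply ContinuousOn.intervalIntegrable; rwa [uIcc_of_le hαβ])
  have hatan := arctan_int α β hαβ u u' η hη hu hu'c hmono
  have hatani : IntervalIntegrable (fun y => |u' y| / (u y ^ 2 + η ^ 2)) volume α β := by
    apply ContinuousOn.intervalIntegrable
    rw [uIcc_of_le hαβ]
    exact hu'c.abs.div hdc fun y _ => (hden y).ne'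
  -- bound of H'
  have hH'b : ∀ y ∈ Icc α β, ‖((H' y : ℝ) : ℂ) * E y‖ ≤ D * (1 / (2 * η)) + G0 * (|u' y| / (u y ^ 2 + η ^ 2)) := by
    intro y hy
    rw [norm_mul, hEn, mul_one, Complex.norm_real, Real.norm_eq_abs]
    refine (abs_add_le _ _).trans ?_
    rw [abs_mul, abs_mul]
    have hD0 : 0 ≤ D := (abs_nonneg _).trans (hD y hy)
    gcongr
    · exact hD y hy
    · exact hVb y
    · exact hG0 y hy
    · rw [abs_div, abs_mul, abs_of_pos (by positivity : 0 < (u y ^ 2 + η ^ 2) ^ 2),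
        div_le_div_iff₀ (by positivity) (hden y), mul_assoc]
      gcongr
      rw [sq (u y ^ 2 + η ^ 2)]
      gcongr
      rw [abs_le]
      constructor <;> nlinarith [sq_nonneg (u y), sq_nonneg η]
  have hI1 : ‖∫ y in α..β, ((H' y : ℝ) : ℂ) * E y‖ ≤ (β - α) * (D * (1 / (2 * η))) + G0 * (Real.pi / η) := by
    refine (intervalIntegral.norm_integral_le_of_norm_le hαβ
      ((Eventually.of_forall fun y hy => hH'b y (Ioc_subset_Icc_self hy)))
      (IntervalIntegrable.add (by simp) (hatani.const_mul G0))).trans ?_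
    rw [intervalIntegral.integral_add (by simp) (hatani.const_mul G0), intervalIntegral.integral_const,
      intervalIntegral.integral_const_mul, smul_eq_mul]
    gcongr
  have hGV : ∀ y ∈ Icc α β, ‖((G y * V y : ℝ) : ℂ) * E y‖ ≤ G0 * (1 / (2 * η)) := by
    intro y hy
    rw [norm_mul, hEn, mul_one, Complex.norm_real, Real.norm_eq_abs, abs_mul]
    gcongr
    · exact hG0 y hy
    · exact hVb y
  set I1 := ∫ y in α..β, E y * ((G y * P y * (u y ^ 2 / (u y ^ 2 + η ^ 2)) : ℝ) : ℂ) with hI1d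
  have hI1eq : Complex.I * lam * I1 = ∫ y in α..β, ((G y * V y : ℝ) : ℂ) *
      (E y * (Complex.I * ((lam * (P y * u y) : ℝ) : ℂ))) := by
    rw [hI1d, ← intervalIntegral.integral_const_mul]
    congr 1; ext y
    rw [hV]; push_cast; ring
  have hI1b : |lam| * ‖I1‖ ≤ G0 / η + ((β - α) * (D * (1 / (2 * η))) + G0 * (Real.pi / η)) := by
    have : |lam| * ‖I1‖ = ‖Complex.I * lam * I1‖ := by simp
    rw [this, hI1eq, hparts]
    refine (norm_sub_le _ _).trans (add_le_add ?_ hI1)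
    refine (norm_sub_le _ _).trans ((add_le_add (hGV β hre) (hGV α hle)).trans (le_of_eq ?_))
    field_simp; ring
  set I2 := ∫ y in α..β, E y * ((G y * P y * (η ^ 2 / (u y ^ 2 + η ^ 2)) : ℝ) : ℂ) with hI2d
  have hI2b : ‖I2‖ ≤ Real.pi * η * S := by
    refine (intervalIntegral.norm_integral_le_of_norm_le hαβ
      ((Eventually.of_forall fun y hy => ?_)) (hatani.const_mul (S * η ^ 2))).trans ?_
    · rw [norm_mul, hEn, one_mul, Complex.norm_real, Real.norm_eq_abs, abs_mul, abs_of_pos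
        (by positivity : 0 < η ^ 2 / (u y ^ 2 + η ^ 2))]
      calc |G y * P y| * (η ^ 2 / (u y ^ 2 + η ^ 2)) ≤ (S * |u' y|) * (η ^ 2 / (u y ^ 2 + η ^ 2)) := by
            gcongr; exact hS y (Ioc_subset_Icc_self hy)
        _ = _ := by ring
    · rw [intervalIntegral.integral_const_mul]
      calc S * η ^ 2 * _ ≤ S * η ^ 2 * (Real.pi / η) := by gcongr
        _ = _ := by field_simp
  have hsum : ∫ y in α..β, E y * ((G y * P y : ℝ) : ℂ) = I1 + I2 := by
    rw [hI1d, hI2d, ← intervalIntegral.integral_add]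
    · congr 1; ext y
      rw [← mul_add, ← Complex.ofReal_add, ← mul_add, ← add_div, div_self (hden y).ne', mul_one]
    · apply ContinuousOn.intervalIntegrable
      rw [uIcc_of_le hαβ]
      exact hEc.mul (Complex.continuous_ofReal.comp_continuousOn
        ((hGc.mul hPc).mul ((huc.pow 2).div hdc fun y _ => (hden y).ne')))
    · apply ContinuousOn.intervalIntegrable
      rw [uIcc_of_le hαβ]
      exact hEc.mul (Complex.continuous_ofReal.comp_continuousOn
        ((hGc.mul hPc).mul (continuousOn_const.div hdc fun y _ => (hden y).ne')))
  rw [hsum]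
  refine (norm_add_le _ _).trans ?_
  rw [add_comm]
  gcongr
  have hl : 0 < |lam| := abs_pos.2 hlam
  have : ‖I1‖ = (1 / |lam|) * (|lam| * ‖I1‖) := by field_simp
  rw [this]
  calc _ ≤ (1 / |lam|) * (G0 / η + ((β - α) * (D * (1 / (2 * η))) + G0 * (Real.pi / η))) := by gcongr
    _ = _ := by field_simp; ring

lemma pow_bd (a b : ℝ) (ha : 0 < a) (s : ℝ) :
    ∃ M : ℝ, 0 < M ∧ ∀ t ∈ Icc a b, t ^ s ≤ M ∧ M⁻¹ ≤ t ^ s := by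
  refine ⟨max (max (a ^ s) (b ^ s)) (max (a ^ (-s)) (b ^ (-s))), ?_, ?_⟩
  · exact lt_max_of_lt_left (lt_max_of_lt_left (by positivity))
  have key : ∀ s : ℝ, ∀ t ∈ Icc a b, t ^ s ≤ max (a ^ s) (b ^ s) := by
    intro s t ht
    have ht0 : 0 < t := lt_of_lt_of_le ha ht.1
    rcases le_total 0 s with h | h
    · exact le_max_of_le_right (Real.rpow_le_rpow ht0.le ht.2 h)
    · exact le_max_of_le_left (Real.rpow_le_rpow_of_nonpos ha ht.1 h)
  intro t ht
  have ht0 : 0 < t := lt_of_lt_of_le ha ht.1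
  refine ⟨le_max_of_le_left (key s t ht), ?_⟩
  rw [← inv_inv (t ^ s), ← Real.rpow_neg ht0.le]
  exact inv_anti₀ (by positivity) (le_max_of_le_right (key (-s) t ht))

noncomputable def KK (ε a b lam R y : ℝ) : ℂ :=
  if y ∈ Icc (a * R) (b * R) then
    Complex.exp (Complex.I * ((lam * (y / R) ^ ε : ℝ) : ℂ)) * ((y⁻¹ : ℝ) : ℂ) else 0

lemma kern_est (ε a b : ℝ) (hε0 : ε ≠ 0) (hε1 : ε ≠ 1) (ha : 0 < a) (hab : a ≤ b) :
    ∃ C : ℝ, 0 < C ∧ ∀ lam R R' h : ℝ, lam ≠ 0 → 0 < R → 0 < R' → h ≠ 0 →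
      ‖∫ y, KK ε a b lam R y * (starRingEnd ℂ) (KK ε a b lam R' (y - h))‖
        ≤ C / Real.sqrt (|lam| * R * |h|) := by
  have hb : 0 < b := lt_of_lt_of_le ha hab
  obtain ⟨M1, hM1, H1⟩ := pow_bd a b ha (-ε)
  obtain ⟨M2, hM2, H2⟩ := pow_bd a b ha (-ε - 1)
  obtain ⟨M3, hM3, H3⟩ := pow_bd (a / b) (b / a) (by positivity) (ε - 2)
  have he1 : 0 < |ε - 1| := abs_pos.2 (sub_ne_zero.2 hε1)
  have he0 : 0 < |ε| := abs_pos.2 hε0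
  have hpi := Real.pi_pos
  have hba : 0 ≤ b - a := by linarith
  set C0 := 1 / |ε| * M1 * a⁻¹ with hC0
  set C1 := M2 * a⁻¹ + 1 / |ε| * M1 * (a⁻¹) ^ 2 with hC1
  set CS := (a⁻¹) ^ 2 * b ^ 2 * M3 / |ε - 1| with hCS
  refine ⟨Real.pi * CS + (1 + Real.pi) * C0 + (b - a) * C1, by positivity, ?_⟩
  intro lam R R' h hlam hR hR' hh
  have hl : 0 < |lam| := abs_pos.2 hlam
  have hh' : 0 < |h| := abs_pos.2 hh
  set T := Real.sqrt (|lam| * R * |h|) with hT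
  have hTpos : 0 < T := Real.sqrt_pos.2 (by positivity)
  have hTsq : T ^ 2 = |lam| * R * |h| := Real.sq_sqrt (by positivity)
  set α := max (a * R) (h + a * R') with hα
  set β := min (b * R) (h + b * R') with hβ
  set Φ : ℝ → ℝ := fun y => (y / R) ^ ε - ((y - h) / R') ^ ε with hΦ
  have hYW : ∀ y ∈ Icc α β, y / R ∈ Icc a b ∧ (y - h) / R' ∈ Icc a b := by
    intro y hy
    have h1 := (le_max_left _ _).trans hy.1
    have h2 := (le_max_right _ _).trans hy.1
    have h3 := hy.2.trans (min_le_left _ _)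
    have h4 := hy.2.trans (min_le_right _ _)
    refine ⟨⟨?_, ?_⟩, ⟨?_, ?_⟩⟩
    · rw [le_div_iff₀ hR]; exact h1
    · rw [div_le_iff₀ hR]; exact h3
    · rw [le_div_iff₀ hR']; linarith
    · rw [div_le_iff₀ hR']; linarith
  have hint : (fun y => KK ε a b lam R y * (starRingEnd ℂ) (KK ε a b lam R' (y - h))) =
      (Icc α β).indicator fun y => Complex.exp (Complex.I * ((lam * Φ y : ℝ) : ℂ)) *
        ((y⁻¹ * (y - h)⁻¹ : ℝ) : ℂ) := by
    ext y
    by_cases hy : y ∈ Icc α β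
    · obtain ⟨⟨h1, h2⟩, h3, h4⟩ := hYW y hy
      rw [le_div_iff₀ hR] at h1
      rw [div_le_iff₀ hR] at h2
      rw [le_div_iff₀ hR'] at h3
      rw [div_le_iff₀ hR'] at h4
      rw [indicator_of_mem hy, KK, KK, if_pos ⟨h1, h2⟩, if_pos ⟨h3, h4⟩, map_mul, ← Complex.exp_conj]
      rw [mul_mul_mul_comm, ← Complex.exp_add]
      simp only [map_mul, Complex.conj_I, Complex.conj_ofReal, hΦ]
      push_cast
      congr 2; ring
    · rw [indicator_of_notMem hy]
      by_cases h1 : y ∈ Icc (a * R) (b * R)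
      · have h2 : y - h ∉ Icc (a * R') (b * R') := by
          intro h2
          exact hy ⟨max_le h1.1 (by linarith [h2.1]), le_min h1.2 (by linarith [h2.2])⟩
        simp [KK, h2]
      · simp [KK, h1]
  rw [hint, integral_indicator measurableSet_Icc]
  rcases lt_or_ge β α with hlt | hle
  · rw [Icc_eq_empty (not_le.2 hlt)]; simp; positivity
  rw [integral_Icc_eq_integral_Ioc, ← intervalIntegral.integral_of_le hle]
  set P : ℝ → ℝ := fun y => ε / R' * (y / R) ^ (ε - 1) with hP
  set u : ℝ → ℝ := fun y => R' / R - (((y - h) / R') / (y / R)) ^ (ε - 1) with hu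
  set u' : ℝ → ℝ := fun y => -((h / (R * R')) / (y / R) ^ 2 * (ε - 1) *
    (((y - h) / R') / (y / R)) ^ (ε - 2)) with hu'
  set G : ℝ → ℝ := fun y => 1 / (ε * R) * ((y / R) ^ (-ε) * ((y - h) / R')⁻¹) with hG
  set G' : ℝ → ℝ := fun y => 1 / (ε * R) * (1 / R * (-ε) * (y / R) ^ (-ε - 1) * ((y - h) / R')⁻¹ +
    (y / R) ^ (-ε) * (-(1 / R') / ((y - h) / R') ^ 2)) with hG'
  have hYp : ∀ y ∈ Icc α β, 0 < y / R := fun y hy => lt_of_lt_of_le ha (hYW y hy).1.1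
  have hWp : ∀ y ∈ Icc α β, 0 < (y - h) / R' := fun y hy => lt_of_lt_of_le ha (hYW y hy).2.1
  have hYd : ∀ y : ℝ, HasDerivAt (fun y => y / R) (1 / R) y := fun y => (hasDerivAt_id y).div_const R
  have hWd : ∀ y : ℝ, HasDerivAt (fun y => (y - h) / R') (1 / R') y :=
    fun y => ((hasDerivAt_id y).sub_const h).div_const R'
  have hYc : Continuous fun y : ℝ => y / R := by fun_prop
  have hWc : Continuous fun y : ℝ => (y - h) / R' := by fun_prop
  have hZd : ∀ y ∈ Icc α β, HasDerivAt (fun y => ((y - h) / R') / (y / R))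
      ((h / (R * R')) / (y / R) ^ 2) y := by
    intro y hy
    have := (hWd y).div (hYd y) (hYp y hy).ne'
    have e : (h / (R * R')) / (y / R) ^ 2 = (1 / R' * (y / R) - (y - h) / R' * (1 / R)) / (y / R) ^ 2 := by
      congr 1; field_simp; ring
    rw [e]; exact this
  have hZp : ∀ y ∈ Icc α β, 0 < ((y - h) / R') / (y / R) := fun y hy => div_pos (hWp y hy) (hYp y hy)
  have hZ : ∀ y ∈ Icc α β, ((y - h) / R') / (y / R) ∈ Icc (a / b) (b / a) := by
    intro y hy
    obtain ⟨⟨h1, h2⟩, h3, h4⟩ := hYW y hy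
    have := hYp y hy
    have := hWp y hy
    constructor <;> gcongr
  have hGP : ∀ y ∈ Icc α β, G y * P y = y⁻¹ * (y - h)⁻¹ := by
    intro y hy
    have hy1 := hYp y hy
    have hw1 := hWp y hy
    have e1 : (y / R) ^ (-ε) * (y / R) ^ (ε - 1) = (y / R)⁻¹ := by
      rw [← Real.rpow_add hy1, ← Real.rpow_neg_one]; congr 1; ring
    have : G y * P y = 1 / (R * R') * ((y / R) ^ (-ε) * (y / R) ^ (ε - 1)) * ((y - h) / R')⁻¹ := by
      simp only [hG, hP]; field_simp
    rw [this, e1]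
    have hy0 : y ≠ 0 := fun h0 => by rw [h0] at hy1; simp at hy1
    have hw0 : y - h ≠ 0 := fun h0 => by rw [h0] at hw1; simp at hw1
    field_simp
  have hcong : ∫ y in α..β, Complex.exp (Complex.I * ((lam * Φ y : ℝ) : ℂ)) *
        ((y⁻¹ * (y - h)⁻¹ : ℝ) : ℂ) = ∫ y in α..β, Complex.exp (Complex.I * ((lam * Φ y : ℝ) : ℂ)) *
        ((G y * P y : ℝ) : ℂ) := by
    apply intervalIntegral.integral_congr
    intro y hy; rw [uIcc_of_le hle] at hy
    simp only [hGP y hy]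
  rw [hcong]
  have hpc : ∀ s : ℝ, ContinuousOn (fun y : ℝ => (y / R) ^ s) (Icc α β) := fun s =>
    hYc.continuousOn.rpow_const fun y hy => Or.inl (hYp y hy).ne'
  have hwc : ContinuousOn (fun y : ℝ => ((y - h) / R')⁻¹) (Icc α β) :=
    hWc.continuousOn.inv₀ fun y hy => (hWp y hy).ne'
  have hlen1 : β - α ≤ (b - a) * R := by
    have := le_max_left (a * R) (h + a * R')
    have := min_le_left (b * R) (h + b * R')
    simp only [hα, hβ]; linarith
  have hlen2 : β - α ≤ (b - a) * R' := by
    have := le_max_right (a * R) (h + a * R')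
    have := min_le_right (b * R) (h + b * R')
    simp only [hα, hβ]; linarith
  have hmain := osc_abs α β hle Φ u u' G G' P lam (|h| / T) (C0 / R) (C1 / R * (1 / R + 1 / R'))
    (CS / |h|) (by positivity) hlam ?_ ?_ ?_ ?_ ?_ ?_ ?_ ?_ ?_ ?_ ?_
  · refine hmain.trans ?_
    have e1 : (β - α) * (C1 / R * (1 / R + 1 / R')) / 2 ≤ (b - a) * C1 / R := by
      have t1 : (β - α) * (1 / R) ≤ b - a := by
        rw [mul_one_div, div_le_iff₀ hR]; exact hlen1
      have t2 : (β - α) * (1 / R') ≤ b - a := by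
        rw [mul_one_div, div_le_iff₀ hR']; exact hlen2
      calc _ = C1 / R * ((β - α) * (1 / R) + (β - α) * (1 / R')) / 2 := by ring
        _ ≤ C1 / R * ((b - a) + (b - a)) / 2 := by gcongr
        _ = _ := by ring
    calc _ ≤ Real.pi * (|h| / T) * (CS / |h|) + 1 / (|lam| * (|h| / T)) * ((1 + Real.pi) * (C0 / R) + (b - a) * C1 / R) := by
          gcongr
      _ = Real.pi * CS / T + T / (|lam| * R * |h|) * ((1 + Real.pi) * C0 + (b - a) * C1) := by
          field_simp
      _ = _ := by rw [← hTsq]; field_simp; ring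
  · intro y hy
    have hy1 := hYp y hy
    have hw1 := hWp y hy
    have h1 := ((hYd y).rpow_const (p := ε) (Or.inl hy1.ne')).sub
      ((hWd y).rpow_const (p := ε) (Or.inl hw1.ne'))
    have e : P y * u y = 1 / R * ε * (y / R) ^ (ε - 1) - 1 / R' * ε * ((y - h) / R') ^ (ε - 1) := by
      simp only [hP, hu]
      rw [Real.div_rpow hw1.le hy1.le]
      have : (y / R) ^ (ε - 1) ≠ 0 := by positivity
      field_simp
    rw [e]; exact h1
  · intro y hy
    have h1 := ((hZd y hy).rpow_const (p := ε - 1) (Or.inl (hZp y hy).ne')).const_sub (R' / R)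
    have e : ε - 1 - 1 = ε - 2 := by ring
    rw [e] at h1
    exact h1
  · intro y hy
    exact (((hYd y).rpow_const (p := -ε) (Or.inl (hYp y hy).ne')).mul
      ((hWd y).inv (hWp y hy).ne')).const_mul _
  · exact continuousOn_const.mul (hpc _)
  · refine ContinuousOn.neg (ContinuousOn.mul (ContinuousOn.mul ?_ continuousOn_const) ?_)
    · exact continuousOn_const.div (hYc.continuousOn.pow 2) fun y hy => pow_ne_zero _ (hYp y hy).ne'
    · refine ContinuousOn.rpow_const (hWc.continuousOn.div hYc.continuousOn fun y hy => (hYp y hy).ne') ?_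
      exact fun y hy => Or.inl (hZp y hy).ne'
  · refine continuousOn_const.mul (((continuousOn_const.mul (hpc _)).mul hwc).add ((hpc _).mul ?_))
    exact continuousOn_const.div (hWc.continuousOn.pow 2) fun y hy => pow_ne_zero _ (hWp y hy).ne'
  · have hk : ∀ y ∈ Icc α β, 0 < (((y - h) / R') / (y / R)) ^ (ε - 2) / (R * R') / (y / R) ^ 2 := by
      intro y hy
      have := hZp y hy
      have := hYp y hy
      positivity
    have e : ∀ y, u' y = -(h * (ε - 1)) * ((((y - h) / R') / (y / R)) ^ (ε - 2) / (R * R') / (y / R) ^ 2) := by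
      intro y; simp only [hu']; ring
    rcases le_total (h * (ε - 1)) 0 with hs | hs
    · left; intro y hy; rw [e]
      exact mul_nonneg (by linarith) (hk y hy).le
    · right; intro y hy; rw [e]
      exact mul_nonpos_of_nonpos_of_nonneg (by linarith) (hk y hy).le
  · intro y hy
    have hy1 := hYp y hy
    have hw1 := hWp y hy
    simp only [hG]
    rw [abs_mul, abs_div, abs_one, abs_mul ε, abs_of_pos hR, abs_of_pos (by positivity : 0 < (y / R) ^ (-ε) * ((y - h) / R')⁻¹)]
    have t1 := (H1 _ (hYW y hy).1).1
    have t2 : ((y - h) / R')⁻¹ ≤ a⁻¹ := inv_anti₀ ha (hYW y hy).2.1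
    calc 1 / (|ε| * R) * ((y / R) ^ (-ε) * ((y - h) / R')⁻¹) ≤ 1 / (|ε| * R) * (M1 * a⁻¹) := by gcongr
      _ = _ := by rw [hC0]; field_simp
  · intro y hy
    have hy1 := hYp y hy
    have hw1 := hWp y hy
    have t1 := (H1 _ (hYW y hy).1).1
    have t3 := (H2 _ (hYW y hy).1).1
    have t2 : ((y - h) / R')⁻¹ ≤ a⁻¹ := inv_anti₀ ha (hYW y hy).2.1
    have hC1' : C1 = 1 / |ε| * (|ε| * M2 * a⁻¹ + M1 * (a⁻¹) ^ 2) := by rw [hC1]; field_simp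
    simp only [hG']
    rw [abs_mul, abs_div, abs_one, abs_mul ε, abs_of_pos hR]
    calc _ ≤ 1 / (|ε| * R) * (1 / R * |ε| * M2 * a⁻¹ + M1 * (1 / R' * (a⁻¹) ^ 2)) := by
          gcongr
          refine (abs_add_le _ _).trans (add_le_add ?_ ?_)
          · rw [abs_mul, abs_mul, abs_mul, abs_neg, abs_of_pos (by positivity : 0 < 1 / R),
              abs_of_pos (by positivity : 0 < (y / R) ^ (-ε - 1)), abs_of_pos (by positivity : 0 < ((y - h) / R')⁻¹)]
            gcongr
          · rw [abs_mul, abs_div, abs_neg, abs_of_pos (by positivity : 0 < 1 / R'),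
              abs_of_pos (by positivity : 0 < (y / R) ^ (-ε)), abs_of_pos (by positivity : 0 < ((y - h) / R') ^ 2),
              div_eq_mul_inv (1 / R'), ← inv_pow]
            gcongr
      _ ≤ 1 / (|ε| * R) * ((|ε| * M2 * a⁻¹ + M1 * (a⁻¹) ^ 2) * (1 / R + 1 / R')) := by
          gcongr
          have : 0 ≤ |ε| * M2 * a⁻¹ * (1 / R') := by positivity
          have : 0 ≤ M1 * (a⁻¹) ^ 2 * (1 / R) := by positivity
          nlinarith
      _ = _ := by rw [hC1']; field_simp
  · positivity
  · intro y hy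
    have hy1 := hYp y hy
    have hw1 := hWp y hy
    have hz1 := hZp y hy
    have hgp : G y * P y = 1 / (R * R') * ((y / R)⁻¹ * ((y - h) / R')⁻¹) := by
      rw [hGP y hy]; field_simp
    have t2 : ((y - h) / R')⁻¹ ≤ a⁻¹ := inv_anti₀ ha (hYW y hy).2.1
    have t1 : (y / R)⁻¹ ≤ a⁻¹ := inv_anti₀ ha (hYW y hy).1.1
    have t3 := (H3 _ (hZ y hy)).2
    have t4 : y / R ≤ b := (hYW y hy).1.2
    rw [hgp, abs_of_pos (by positivity)]
    have hu'a : |u' y| = |h| / (R * R') / (y / R) ^ 2 * |ε - 1| * (((y - h) / R') / (y / R)) ^ (ε - 2) := by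
      simp only [hu']
      rw [abs_neg, abs_mul, abs_mul, abs_div, abs_div, abs_of_pos (by positivity : 0 < R * R'),
        abs_of_pos (by positivity : 0 < (y / R) ^ 2),
        abs_of_pos (by positivity : 0 < (((y - h) / R') / (y / R)) ^ (ε - 2))]
    rw [hu'a]
    calc 1 / (R * R') * ((y / R)⁻¹ * ((y - h) / R')⁻¹) ≤ 1 / (R * R') * (a⁻¹ * a⁻¹) := by gcongr
      _ = CS / |h| * (|h| / (R * R') / b ^ 2 * |ε - 1| * M3⁻¹) := by rw [hCS]; field_simp
      _ ≤ _ := by gcongr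

lemma kd_int (k : ℝ → ℝ → ℂ) (c ρ : ℝ) (hk : Measurable (Function.uncurry k))
    (hb : ∀ x z, ‖k x z‖ ≤ if |x - z| ≤ ρ then c else 0) (F : ℝ → ℂ) (hF : Integrable F) :
    Integrable (fun p : ℝ × ℝ => k p.1 p.2 * F p.2) (volume.prod volume) := by
  set φ : ℝ → ℝ := (Icc (-ρ) ρ).indicator fun _ => c with hφ
  have hφi : Integrable φ :=
    (integrable_indicator_iff measurableSet_Icc).2 (continuous_const.continuousOn.integrableOn_compact isCompact_Icc)
  have h1 := hF.norm.convolution_integrand (ContinuousLinearMap.mul ℝ ℝ) hφi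
  refine h1.mono' ?_ (Eventually.of_forall fun p => ?_)
  · exact hk.aestronglyMeasurable.mul hF.1.comp_snd
  · rw [norm_mul, mul_comm]
    simp only [ContinuousLinearMap.mul_apply']
    gcongr
    refine (hb p.1 p.2).trans (le_of_eq ?_)
    simp only [hφ, indicator, mem_Icc, ← abs_le]

lemma kd_meas (k : ℝ → ℝ → ℂ) (hk : Measurable (Function.uncurry k)) (F : ℝ → ℂ) (hF : Measurable F) :
    Measurable fun x => ∫ z, k x z * F z := by
  have : StronglyMeasurable (Function.uncurry fun x z => k x z * F z) :=
    (hk.mul (hF.comp measurable_snd)).stronglyMeasurable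
  exact this.integral_prod_right.measurable

lemma kd_integrable (k : ℝ → ℝ → ℂ) (c ρ : ℝ) (hk : Measurable (Function.uncurry k))
    (hb : ∀ x z, ‖k x z‖ ≤ if |x - z| ≤ ρ then c else 0) (F : ℝ → ℂ) (hF : Integrable F) :
    Integrable fun x => ∫ z, k x z * F z :=
  (kd_int k c ρ hk hb F hF).integral_prod_left

lemma kd_bdd (k : ℝ → ℝ → ℂ) (c ρ : ℝ) (hc : 0 ≤ c)
    (hb : ∀ x z, ‖k x z‖ ≤ if |x - z| ≤ ρ then c else 0) (F : ℝ → ℂ) (hF : Integrable F) (x : ℝ) :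
    ‖∫ z, k x z * F z‖ ≤ c * ∫ z, ‖F z‖ := by
  rw [← integral_const_mul]
  refine norm_integral_le_of_norm_le (hF.norm.const_mul c) (Eventually.of_forall fun z => ?_)
  rw [norm_mul]
  gcongr
  refine (hb x z).trans ?_
  split_ifs
  · exact le_rfl
  · exact hc

lemma kd_swap (k : ℝ → ℝ → ℂ) (c ρ : ℝ) (hk : Measurable (Function.uncurry k))
    (hb : ∀ x z, ‖k x z‖ ≤ if |x - z| ≤ ρ then c else 0) (F G : ℝ → ℂ) (hF : Integrable F)
    (hG : Measurable G) (B : ℝ) (hB : ∀ x, ‖G x‖ ≤ B) :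
    ∫ x, G x * ∫ z, k x z * F z = ∫ z, F z * ∫ x, k x z * G x := by
  simp_rw [← integral_const_mul]
  rw [integral_integral_swap]
  · congr 1; ext z; congr 1; ext x; ring
  · refine (kd_int k c ρ hk hb F hF).bdd_mul (f := fun p : ℝ × ℝ => G p.1) (c := B)
      (hG.comp measurable_fst).aestronglyMeasurable (Eventually.of_forall fun p => hB p.1)

lemma KK_meas (ε a b lam : ℝ) : Measurable fun p : ℝ × ℝ => KK ε a b lam p.1 p.2 := by
  unfold KK
  refine Measurable.ite ?_ ?_ measurable_const
  · have h1 : MeasurableSet {p : ℝ × ℝ | a * p.1 ≤ p.2} := measurableSet_le (by fun_prop) (by fun_prop)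
    have h2 : MeasurableSet {p : ℝ × ℝ | p.2 ≤ b * p.1} := measurableSet_le (by fun_prop) (by fun_prop)
    exact h1.inter h2
  · refine Measurable.mul (Complex.measurable_exp.comp (measurable_const.mul ?_)) ?_
    · exact Complex.measurable_ofReal.comp (measurable_const.mul
        (Measurable.pow_const (by fun_prop) ε))
    · exact Complex.measurable_ofReal.comp (by fun_prop)

lemma KK_norm (ε a b lam R y : ℝ) (ha : 0 < a) (hR : 0 < R) :
    ‖KK ε a b lam R y‖ ≤ if |y| ≤ b * R then 1 / (a * R) else 0 := by
  unfold KK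
  by_cases h : y ∈ Icc (a * R) (b * R)
  · have hy : 0 < y := lt_of_lt_of_le (by positivity) h.1
    rw [if_pos h, if_pos (by rw [abs_of_pos hy]; exact h.2), norm_mul, mul_comm Complex.I,
      Complex.norm_exp_ofReal_mul_I, one_mul, Complex.norm_real, Real.norm_of_nonneg (by positivity),
      one_div]
    exact inv_anti₀ (by positivity) h.1
  · rw [if_neg h, norm_zero]
    split_ifs <;> positivity

noncomputable def Th (b R t : ℝ) : ℝ≥0∞ := if t ≤ b * R then ENNReal.ofReal (R * t) ^ (-(1/2:ℝ)) else 0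

lemma Th_meas (b : ℝ) : Measurable fun p : ℝ × ℝ => Th b p.1 p.2 := by
  unfold Th
  refine Measurable.ite (measurableSet_le (by fun_prop) (by fun_prop)) ?_ measurable_const
  exact Measurable.pow_const (by fun_prop) _

lemma Th_anti (b R : ℝ) (hR : 0 < R) (s t : ℝ) (hst : s ≤ t) : Th b R t ≤ Th b R s := by
  unfold Th
  by_cases h : t ≤ b * R
  · rw [if_pos h, if_pos (hst.trans h), ENNReal.rpow_neg, ENNReal.rpow_neg]
    gcongr
  · rw [if_neg h]; exact zero_le

lemma Th_int (b R : ℝ) (hb : 0 < b) (hR : 0 < R) :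
    ∫⁻ y, Th b R |y| ≤ ENNReal.ofReal (4 * b ^ (1/2:ℝ)) := by
  have h1 : ∫⁻ y in Ioi (0:ℝ), Th b R |y| ≤ ENNReal.ofReal (2 * b ^ (1/2:ℝ)) := by
    have e : ∫⁻ y in Ioi (0:ℝ), Th b R |y| = ∫⁻ y in Ioc 0 (b * R), ENNReal.ofReal ((R * y) ^ (-(1/2:ℝ))) := by
      rw [← lintegral_indicator measurableSet_Ioi, ← lintegral_indicator measurableSet_Ioc]
      refine lintegral_congr fun y => ?_
      by_cases hy : y ∈ Ioi (0:ℝ)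
      · have hy' : 0 < y := hy
        rw [indicator_of_mem hy, abs_of_pos hy', Th]
        by_cases h2 : y ≤ b * R
        · have : y ∈ Ioc 0 (b * R) := ⟨hy', h2⟩
          rw [if_pos h2, indicator_of_mem this, ENNReal.ofReal_rpow_of_pos (by positivity)]
        · have : y ∉ Ioc 0 (b * R) := fun h => h2 h.2
          rw [if_neg h2, indicator_of_notMem this]
      · have : y ∉ Ioc 0 (b * R) := fun h => hy h.1
        rw [indicator_of_notMem hy, indicator_of_notMem this]
    have hbR : 0 ≤ b * R := by positivity
    have hi : IntervalIntegrable (fun y : ℝ => y ^ (-(1/2:ℝ))) volume 0 (b * R) :=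
      intervalIntegral.intervalIntegrable_rpow' (by norm_num)
    have hi2 : IntegrableOn (fun y : ℝ => (R * y) ^ (-(1/2:ℝ))) (Ioc 0 (b * R)) := by
      have h3 : IntegrableOn (fun y : ℝ => R ^ (-(1/2:ℝ)) * y ^ (-(1/2:ℝ))) (Ioc 0 (b * R)) :=
        ((intervalIntegrable_iff_integrableOn_Ioc_of_le hbR).1 hi).const_mul (R ^ (-(1/2:ℝ)))
      refine h3.congr_fun ?_ measurableSet_Ioc
      intro y hy
      show R ^ (-(1/2:ℝ)) * y ^ (-(1/2:ℝ)) = (R * y) ^ (-(1/2:ℝ))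
      rw [Real.mul_rpow hR.le hy.1.le]
    rw [e, ← ofReal_integral_eq_lintegral_ofReal hi2]
    · apply ENNReal.ofReal_le_ofReal
      have h4 : ∫ y in Ioc 0 (b * R), (R * y) ^ (-(1/2:ℝ)) = R ^ (-(1/2:ℝ)) * ∫ y in (0:ℝ)..(b * R), y ^ (-(1/2:ℝ)) := by
        rw [intervalIntegral.integral_of_le hbR, ← integral_const_mul]
        refine setIntegral_congr_fun measurableSet_Ioc fun y hy => ?_
        show (R * y) ^ (-(1/2:ℝ)) = R ^ (-(1/2:ℝ)) * y ^ (-(1/2:ℝ))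
        rw [Real.mul_rpow hR.le hy.1.le]
      rw [h4, integral_rpow (Or.inl (by norm_num)), Real.mul_rpow hb.le hR.le]
      have : (-(1/2:ℝ) + 1) = 1/2 := by norm_num
      rw [this, Real.zero_rpow (by norm_num), Real.rpow_neg hR.le]
      have : R ^ (1/2:ℝ) ≠ 0 := by positivity
      apply le_of_eq
      field_simp
      ring
    · filter_upwards [ae_restrict_mem measurableSet_Ioc] with y hy
      have := hy.1
      positivity
  have h2 : ∫⁻ y in Iio (0:ℝ), Th b R |y| = ∫⁻ y in Ioi (0:ℝ), Th b R |y| := by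
    have := (Measure.measurePreserving_neg (volume : Measure ℝ)).setLIntegral_comp_preimage
      (s := Ioi (0:ℝ)) measurableSet_Ioi (f := fun y => Th b R |y|)
      ((Th_meas b).comp (by fun_prop : Measurable fun y : ℝ => (R, |y|)))
    simpa using this
  have h3 : ∫⁻ y, Th b R |y| = (∫⁻ y in Iio (0:ℝ), Th b R |y|) + ∫⁻ y in Ioi (0:ℝ), Th b R |y| := by
    rw [← lintegral_add_compl _ (measurableSet_Iio (a := (0:ℝ)))]
    congr 1
    rw [compl_Iio]
    exact setLIntegral_congr Ioi_ae_eq_Ici.symm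
  rw [h3, h2]
  refine (add_le_add h1 h1).trans ?_
  rw [← ENNReal.ofReal_add (by positivity) (by positivity)]
  apply ENNReal.ofReal_le_ofReal
  linarith

lemma kap_half (C lam R h b : ℝ) (hC : 0 < C) (hlam : lam ≠ 0) (hR : 0 < R) (hh : h ≠ 0) (hb : |h| ≤ b * R) :
    ENNReal.ofReal (C / Real.sqrt (|lam| * R * |h|)) = ENNReal.ofReal (C / Real.sqrt |lam|) * Th b R |h| := by
  have hl : 0 < |lam| := abs_pos.2 hlam
  have hh' : 0 < |h| := abs_pos.2 hh
  rw [Th, if_pos hb, ENNReal.ofReal_rpow_of_pos (by positivity), ← ENNReal.ofReal_mul (by positivity),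
    mul_assoc, Real.sqrt_mul hl.le, Real.rpow_neg (by positivity), ← Real.sqrt_eq_rpow]
  congr 1
  field_simp

lemma kap_bound (ε a b C : ℝ) (ha : 0 < a) (hab : a ≤ b) (hC : 0 < C)
    (H : ∀ lam R R' h : ℝ, lam ≠ 0 → 0 < R → 0 < R' → h ≠ 0 →
      ‖∫ y, KK ε a b lam R y * (starRingEnd ℂ) (KK ε a b lam R' (y - h))‖
        ≤ C / Real.sqrt (|lam| * R * |h|)) (lam R R' x x' : ℝ) (hlam : lam ≠ 0) (hR : 0 < R) (hR' : 0 < R') :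
    ‖∫ z, KK ε a b lam R (x' - z) * (starRingEnd ℂ) (KK ε a b lam R' (x - z))‖ₑ ≤
      ENNReal.ofReal (C / Real.sqrt |lam|) * (Th b R |x' - x| + Th b R' |x' - x|) := by
  have hl : 0 < |lam| := abs_pos.2 hlam
  have hb : 0 < b := lt_of_lt_of_le ha hab
  have hcpos : 0 < C / Real.sqrt |lam| := by positivity
  set h := x' - x with hh
  have hsub : ∫ z, KK ε a b lam R (x' - z) * (starRingEnd ℂ) (KK ε a b lam R' (x - z)) =
      ∫ y, KK ε a b lam R y * (starRingEnd ℂ) (KK ε a b lam R' (y - h)) := by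
    rw [← integral_sub_left_eq_self (fun y => KK ε a b lam R y * (starRingEnd ℂ) (KK ε a b lam R' (y - h))) volume x']
    congr 1; ext z
    rw [hh]; congr 3; ring
  rw [hsub]
  by_cases h0 : h = 0
  · have : Th b R |h| = ⊤ := by
      rw [Th, h0, abs_zero, if_pos (by positivity), mul_zero, ENNReal.ofReal_zero,
        ENNReal.zero_rpow_of_neg (by norm_num)]
    rw [this, top_add, ENNReal.mul_top (by simpa using hcpos)]
    exact le_top
  by_cases h1 : |h| ≤ b * R
  · have := H lam R R' h hlam hR hR' h0
    rw [← ofReal_norm]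
    refine (ENNReal.ofReal_le_ofReal this).trans ?_
    rw [kap_half C lam R h b hC hlam hR h0 h1]
    gcongr
    exact le_self_add
  by_cases h2 : |h| ≤ b * R'
  · have h3 := H lam R' R (-h) hlam hR' hR (neg_ne_zero.2 h0)
    have e : ‖∫ y, KK ε a b lam R y * (starRingEnd ℂ) (KK ε a b lam R' (y - h))‖ =
        ‖∫ y, KK ε a b lam R' y * (starRingEnd ℂ) (KK ε a b lam R (y - -h))‖ := by
      rw [← RCLike.norm_conj, ← integral_conj,
        ← integral_sub_right_eq_self (fun y => KK ε a b lam R' y * (starRingEnd ℂ) (KK ε a b lam R (y - -h))) h]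
      congr 2; ext y
      simp only [map_mul, Complex.conj_conj]
      rw [mul_comm]
      congr 3; ring
    rw [← ofReal_norm, e]
    refine (ENNReal.ofReal_le_ofReal h3).trans ?_
    rw [abs_neg, kap_half C lam R' h b hC hlam hR' h0 h2]
    gcongr
    exact le_add_self
  · have : (fun y => KK ε a b lam R y * (starRingEnd ℂ) (KK ε a b lam R' (y - h))) = fun _ => 0 := by
      ext y
      by_cases h3 : y ∈ Icc (a * R) (b * R)
      · by_cases h4 : y - h ∈ Icc (a * R') (b * R')
        · exfalso
          have := mul_pos ha hR
          have := mul_pos ha hR'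
          rcases abs_cases h with ⟨e, _⟩ | ⟨e, _⟩
          · rw [e] at h1; linarith [h3.1, h3.2, h4.1, h4.2]
          · rw [e] at h2; linarith [h3.1, h3.2, h4.1, h4.2]
        · simp [KK, h4]
      · simp [KK, h3]
    rw [this]; simp

lemma kd_enorm (F G : ℝ → ℂ) : ‖∫ x, F x * G x‖ₑ ≤ ∫⁻ x, ‖F x‖ₑ * ‖G x‖ₑ := by
  refine (enorm_integral_le_lintegral_enorm _).trans (le_of_eq ?_)
  simp_rw [enorm_mul]

lemma sq_enorm (g : ℝ → ℂ) (hg : Measurable g) (hgi : Integrable g) (B : ℝ) (hB : ∀ x, ‖g x‖ ≤ B) :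
    ∫⁻ x, ‖g x‖ₑ ^ (2:ℝ) = ‖∫ x, (starRingEnd ℂ) (g x) * g x‖ₑ ∧ ∫⁻ x, ‖g x‖ₑ ^ (2:ℝ) ≠ ⊤ := by
  have hi : Integrable fun x => ‖g x‖ ^ 2 := by
    refine (hgi.norm.const_mul B).mono' (by fun_prop) (Eventually.of_forall fun x => ?_)
    rw [Real.norm_of_nonneg (by positivity), sq]
    gcongr; exact hB x
  have e : ∫⁻ x, ‖g x‖ₑ ^ (2:ℝ) = ENNReal.ofReal (∫ x, ‖g x‖ ^ 2) := by
    rw [ofReal_integral_eq_lintegral_ofReal hi (Eventually.of_forall fun x => by positivity)]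
    refine lintegral_congr fun x => ?_
    rw [← ofReal_norm, ENNReal.ofReal_rpow_of_nonneg (norm_nonneg _) (by norm_num), Real.rpow_two]
  refine ⟨?_, by rw [e]; simp⟩
  have e2 : ∫ x, (starRingEnd ℂ) (g x) * g x = ((∫ x, ‖g x‖ ^ 2 : ℝ) : ℂ) := by
    rw [← integral_complex_ofReal]
    congr 1; ext x
    rw [Complex.conj_mul']; push_cast; rfl
  rw [e, e2, ← ofReal_norm, Complex.norm_real, Real.norm_of_nonneg (integral_nonneg fun x => by positivity)]

lemma L2_fin (ε a b : ℝ) (hε0 : ε ≠ 0) (hε1 : ε ≠ 1) (ha : 0 < a) (hab : a ≤ b) :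
    ∃ C : ℝ, 0 < C ∧ ∀ lam : ℝ, lam ≠ 0 → ∀ (r : ℝ → ℝ) (r0 r1 : ℝ), Measurable r → 0 < r0 →
      (∀ x, r0 ≤ r x) → (∀ x, r x ≤ r1) → ∀ (f : ℝ → ℂ), Measurable f → Integrable f →
      ∫⁻ x, ‖∫ z, KK ε a b lam (r x) (x - z) * f z‖ₑ ^ (2:ℝ) ≤
        ENNReal.ofReal (C / Real.sqrt |lam|) * ∫⁻ x, ‖f x‖ₑ ^ (2:ℝ) := by
  obtain ⟨C, hC, H⟩ := kern_est ε a b hε0 hε1 ha hab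
  obtain ⟨CM', hCM', HM⟩ := MF_strong 2 one_lt_two
  obtain ⟨CM, hCM0, HM⟩ : ∃ CM : ℝ, 0 < CM ∧ ∀ g : ℝ → ℝ≥0∞, Measurable g →
      ∫⁻ x, MF g x ^ (2:ℝ) ≤ ENNReal.ofReal CM * ∫⁻ x, g x ^ (2:ℝ) := by
    refine ⟨CM'.toReal + 1, by positivity, fun g hg => (HM g hg).trans ?_⟩
    gcongr
    rw [ENNReal.ofReal_add (by positivity) (by norm_num), ENNReal.ofReal_toReal hCM']
    exact le_self_add
  have hb : 0 < b := lt_of_lt_of_le ha hab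
  have hpi : 0 < 4 * b ^ (1/2:ℝ) := by positivity
  refine ⟨C * (2 * (4 * b ^ (1/2:ℝ)) * CM ^ (1/2:ℝ)), by positivity, ?_⟩
  intro lam hlam r r0 r1 hr hr0 hrl hru f hf hfi
  have hrp : ∀ x, 0 < r x := fun x => lt_of_lt_of_le hr0 (hrl x)
  have hr1 : 0 < r1 := lt_of_lt_of_le (hrp 0) (hru 0)
  set k : ℝ → ℝ → ℂ := fun x z => KK ε a b lam (r x) (x - z) with hk
  have hkm : Measurable (Function.uncurry k) :=
    (KK_meas ε a b lam).comp (by fun_prop : Measurable fun p : ℝ × ℝ => (r p.1, p.1 - p.2))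
  set c := 1 / (a * r0) with hc
  have hc0 : 0 ≤ c := by positivity
  set ρ := b * r1 with hρ
  have hkb : ∀ x z, ‖k x z‖ ≤ if |x - z| ≤ ρ then c else 0 := by
    intro x z
    refine (KK_norm ε a b lam (r x) (x - z) ha (hrp x)).trans ?_
    by_cases h : |x - z| ≤ b * r x
    · rw [if_pos h, if_pos (h.trans (by rw [hρ]; gcongr; exact hru x))]
      rw [hc]; gcongr; exact hrl x
    · rw [if_neg h]; split_ifs <;> positivity
  set kt : ℝ → ℝ → ℂ := fun z x => k x z with hkt
  have hktm : Measurable (Function.uncurry kt) := hkm.comp measurable_swap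
  have hktb : ∀ z x, ‖kt z x‖ ≤ if |z - x| ≤ ρ then c else 0 := by
    intro z x; rw [abs_sub_comm]; exact hkb x z
  set kc : ℝ → ℝ → ℂ := fun z x => (starRingEnd ℂ) (k x z) with hkc
  have hkcm : Measurable (Function.uncurry kc) := Complex.continuous_conj.measurable.comp hktm
  have hkcb : ∀ z x, ‖kc z x‖ ≤ if |z - x| ≤ ρ then c else 0 := by
    intro z x; rw [hkc]; simp only [RCLike.norm_conj]; exact hktb z x
  set g : ℝ → ℂ := fun x => ∫ z, k x z * f z with hg
  have hgm : Measurable g := kd_meas k hkm f hf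
  have hgi : Integrable g := kd_integrable k c ρ hkm hkb f hfi
  have hgb := kd_bdd k c ρ hc0 hkb f hfi
  have hgb : ∀ x, ‖g x‖ ≤ c * ∫ z, ‖f z‖ := hgb
  set gc : ℝ → ℂ := fun x => (starRingEnd ℂ) (g x) with hgc
  have hgcm : Measurable gc := Complex.continuous_conj.measurable.comp hgm
  have hgci : Integrable gc := hgi.norm.mono' hgcm.aestronglyMeasurable
    (Eventually.of_forall fun x => by simp [hgc])
  set h : ℝ → ℂ := fun z => ∫ x, kt z x * gc x with hh
  have hhm : Measurable h := kd_meas kt hktm gc hgcm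
  have hhi : Integrable h := kd_integrable kt c ρ hktm hktb gc hgci
  have hhb : ∀ z, ‖h z‖ ≤ c * ∫ x, ‖gc x‖ := kd_bdd kt c ρ hc0 hktb gc hgci
  obtain ⟨hX1, hXtop⟩ := sq_enorm g hgm hgi _ hgb
  obtain ⟨hY1, hYtop⟩ := sq_enorm h hhm hhi _ hhb
  set X := ∫⁻ x, ‖g x‖ₑ ^ (2:ℝ) with hX
  set Y := ∫⁻ x, ‖h x‖ₑ ^ (2:ℝ) with hY
  -- step A
  have hA : X ≤ ∫⁻ z, ‖f z‖ₑ * ‖h z‖ₑ := by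
    have e : ∫ x, (starRingEnd ℂ) (g x) * g x = ∫ z, f z * h z :=
      kd_swap k c ρ hkm hkb f gc hfi hgcm _ (fun x => by simpa [hgc] using hgb x)
    rw [hX1, e]
    exact kd_enorm _ _
  have hconj : ∀ z, (starRingEnd ℂ) (h z) = ∫ x, kc z x * g x := by
    intro z
    simp only [hh, ← integral_conj, map_mul, hkc, hkt, hgc, Complex.conj_conj]
  have hB : Y ≤ ∫⁻ x, ‖g x‖ₑ * ∫⁻ x', ‖g x'‖ₑ *
      (ENNReal.ofReal (C / Real.sqrt |lam|) * (Th b (r x') |x' - x| + Th b (r x) |x' - x|)) := by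
    have e : ∫ z, (starRingEnd ℂ) (h z) * h z = ∫ x, g x * ∫ z, kc z x * h z := by
      have := kd_swap kc c ρ hkcm hkcb g h hgi hhm _ hhb
      rw [← this]
      congr 1; ext z
      rw [hconj z, mul_comm]
    rw [hY1, e]
    refine (kd_enorm _ _).trans (lintegral_mono fun x => ?_)
    dsimp only
    gcongr
    have e2 : ∫ z, kc z x * h z = ∫ x', gc x' * ∫ z, kt z x' * kc z x := by
      refine kd_swap kt c ρ hktm hktb gc (fun z => kc z x) hgci ?_ c ?_
      · exact hkcm.comp (by fun_prop : Measurable fun z : ℝ => (z, x))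
      · intro z
        refine (hkcb z x).trans ?_
        split_ifs
        · exact le_rfl
        · exact hc0
    rw [e2]
    refine (kd_enorm _ _).trans (lintegral_mono fun x' => ?_)
    dsimp only
    have e3 : ‖gc x'‖ₑ = ‖g x'‖ₑ := by rw [← ofReal_norm, ← ofReal_norm]; simp [hgc]
    rw [e3]
    gcongr
    exact kap_bound ε a b C ha hab hC H lam (r x') (r x) x x' hlam (hrp x') (hrp x)
  -- Schur test
  set D := ENNReal.ofReal (C / Real.sqrt |lam|) with hD
  set K := ENNReal.ofReal (4 * b ^ (1/2:ℝ)) with hK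
  set G : ℝ → ℝ≥0∞ := fun x => ‖g x‖ₑ with hG
  have hGm : Measurable G := hgm.enorm
  have hrad : ∀ x, ∫⁻ x', Th b (r x) |x - x'| * G x' ≤ K * MF G x := by
    intro x
    refine (radial_le (Th b (r x)) ((Th_meas b).comp (by fun_prop : Measurable fun t : ℝ => (r x, t)))
      (fun s t _ hst => Th_anti b (r x) (hrp x) s t hst) ?_ G hGm x).trans ?_
    · exact ((Th_int b (r x) hb (hrp x)).trans_lt ENNReal.ofReal_lt_top).ne
    · gcongr; exact Th_int b (r x) hb (hrp x)
  have hThm1 : Measurable fun p : ℝ × ℝ => Th b (r p.1) |p.2 - p.1| :=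
    (Th_meas b).comp (by fun_prop : Measurable fun p : ℝ × ℝ => (r p.1, |p.2 - p.1|))
  have hThm2 : Measurable fun p : ℝ × ℝ => Th b (r p.2) |p.2 - p.1| :=
    (Th_meas b).comp (by fun_prop : Measurable fun p : ℝ × ℝ => (r p.2, |p.2 - p.1|))
  have hS1 : ∫⁻ x, G x * ∫⁻ x', G x' * Th b (r x) |x' - x| ≤ K * ∫⁻ x, G x * MF G x := by
    rw [← lintegral_const_mul' _ _ ENNReal.ofReal_ne_top]
    refine lintegral_mono fun x => ?_
    calc G x * ∫⁻ x', G x' * Th b (r x) |x' - x| = G x * ∫⁻ x', Th b (r x) |x - x'| * G x' := by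
          congr 1; refine lintegral_congr fun x' => ?_
          rw [abs_sub_comm, mul_comm]
      _ ≤ G x * (K * MF G x) := by gcongr; exact hrad x
      _ = _ := by ring
  have hS2 : ∫⁻ x, G x * ∫⁻ x', G x' * Th b (r x') |x' - x| ≤ K * ∫⁻ x, G x * MF G x := by
    have : ∫⁻ x, G x * ∫⁻ x', G x' * Th b (r x') |x' - x| = ∫⁻ x', ∫⁻ x, G x * (G x' * Th b (r x') |x' - x|) := by
      rw [← lintegral_lintegral_swap]
      · refine lintegral_congr fun x => ?_
        rw [lintegral_const_mul]
        exact hGm.mul (hThm2.comp (by fun_prop : Measurable fun x' : ℝ => (x, x')))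
      · exact ((hGm.comp measurable_fst).mul ((hGm.comp measurable_snd).mul hThm2)).aemeasurable
    rw [this, ← lintegral_const_mul' _ _ ENNReal.ofReal_ne_top]
    refine lintegral_mono fun x' => ?_
    calc ∫⁻ x, G x * (G x' * Th b (r x') |x' - x|) = G x' * ∫⁻ x, Th b (r x') |x' - x| * G x := by
          rw [← lintegral_const_mul]
          · refine lintegral_congr fun x => ?_
            ring
          · exact ((Th_meas b).comp (by fun_prop : Measurable fun x : ℝ => (r x', |x' - x|))).mul hGm
      _ ≤ G x' * (K * MF G x') := by gcongr; exact hrad x'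
      _ = _ := by ring
  have hGM : ∫⁻ x, G x * MF G x ≤ ENNReal.ofReal (CM ^ (1/2:ℝ)) * X := by
    have h1 := ENNReal.lintegral_mul_le_Lp_mul_Lq volume (p := 2) (q := 2)
      (by rw [Real.holderConjugate_iff]; norm_num) hGm.aemeasurable (MF_measurable G).aemeasurable
    refine h1.trans ?_
    calc (∫⁻ x, G x ^ (2:ℝ)) ^ (1/2:ℝ) * (∫⁻ x, MF G x ^ (2:ℝ)) ^ (1/2:ℝ)
        ≤ X ^ (1/2:ℝ) * (ENNReal.ofReal CM * X) ^ (1/2:ℝ) := by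
          gcongr
          exact HM G hGm
      _ = _ := by
          rw [ENNReal.mul_rpow_of_nonneg _ _ (by norm_num), ENNReal.ofReal_rpow_of_pos hCM0, mul_left_comm,
            ← ENNReal.rpow_add_of_nonneg _ _ (by norm_num) (by norm_num)]
          norm_num
  have hYX : Y ≤ ENNReal.ofReal (C / Real.sqrt |lam| * (2 * (4 * b ^ (1/2:ℝ)) * CM ^ (1/2:ℝ))) * X := by
    have hm1 : ∀ x, Measurable fun x' => G x' * Th b (r x') |x' - x| := fun x =>
      hGm.mul (hThm2.comp (by fun_prop : Measurable fun x' : ℝ => (x, x')))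
    have hm2 : Measurable fun x => G x * ∫⁻ x', G x' * Th b (r x') |x' - x| := by
      refine hGm.mul ?_
      have : Measurable (Function.uncurry fun x x' => G x' * Th b (r x') |x' - x|) :=
        (hGm.comp measurable_snd).mul hThm2
      exact this.lintegral_prod_right
    have e : ∫⁻ x, ‖g x‖ₑ * ∫⁻ x', ‖g x'‖ₑ * (D * (Th b (r x') |x' - x| + Th b (r x) |x' - x|)) =
        D * ((∫⁻ x, G x * ∫⁻ x', G x' * Th b (r x') |x' - x|) +
          ∫⁻ x, G x * ∫⁻ x', G x' * Th b (r x) |x' - x|) := by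
      rw [← lintegral_add_left hm2, ← lintegral_const_mul' _ _ ENNReal.ofReal_ne_top]
      refine lintegral_congr fun x => ?_
      have e1 : ∫⁻ x', ‖g x'‖ₑ * (D * (Th b (r x') |x' - x| + Th b (r x) |x' - x|)) =
          D * ∫⁻ x', (G x' * Th b (r x') |x' - x| + G x' * Th b (r x) |x' - x|) := by
        rw [← lintegral_const_mul' _ _ ENNReal.ofReal_ne_top]
        refine lintegral_congr fun x' => ?_
        simp only [hG]; ring
      rw [e1, lintegral_add_left (hm1 x)]
      simp only [hG]; ring
    rw [e] at hB
    refine hB.trans ((mul_le_mul_right (add_le_add hS2 hS1) D).trans ?_)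
    calc D * (K * (∫⁻ x, G x * MF G x) + K * (∫⁻ x, G x * MF G x))
        = D * (2 * K * ∫⁻ x, G x * MF G x) := by ring
      _ ≤ D * (2 * K * (ENNReal.ofReal (CM ^ (1/2:ℝ)) * X)) := by gcongr
      _ = _ := by
        rw [ENNReal.ofReal_mul (by positivity), ENNReal.ofReal_mul (by positivity), ENNReal.ofReal_mul (by norm_num)]
        rw [hD, hK]; norm_num; ring
  set Q := C / Real.sqrt |lam| * (2 * (4 * b ^ (1/2:ℝ)) * CM ^ (1/2:ℝ)) with hQ
  have hl : 0 < |lam| := abs_pos.2 hlam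
  have hQ0 : 0 < Q := by positivity
  have hgoal : C * (2 * (4 * b ^ (1/2:ℝ)) * CM ^ (1/2:ℝ)) / Real.sqrt |lam| = Q := by rw [hQ]; ring
  rw [hgoal]
  show X ≤ _
  have hHol := ENNReal.lintegral_mul_le_Lp_mul_Lq volume (p := 2) (q := 2)
      (by rw [Real.holderConjugate_iff]; norm_num) hf.enorm.aemeasurable hhm.enorm.aemeasurable
  have h3 : X ≤ (∫⁻ z, ‖f z‖ₑ ^ (2:ℝ)) ^ (1/2:ℝ) * (ENNReal.ofReal Q * X) ^ (1/2:ℝ) := by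
    refine hA.trans (hHol.trans ?_)
    gcongr
  have h4 := ENNReal.rpow_le_rpow h3 (by norm_num : (0:ℝ) ≤ 2)
  rw [ENNReal.mul_rpow_of_nonneg _ _ (by norm_num), ← ENNReal.rpow_mul, ← ENNReal.rpow_mul] at h4
  norm_num at h4
  by_cases hX0 : X = 0
  · rw [hX0]; exact zero_le
  have h5 : X * X ≤ (ENNReal.ofReal Q * ∫⁻ z, ‖f z‖ₑ ^ 2) * X := by
    calc X * X = X ^ 2 := by ring
      _ ≤ _ := h4
      _ = _ := by ring
  have h6 := (ENNReal.mul_le_mul_iff_left hX0 hXtop).1 h5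
  simpa using h6

noncomputable def TT (ε a b lam : ℝ) (R : ℕ → ℝ) (f : ℝ → ℂ) (x : ℝ) : ℝ≥0∞ :=
  ⨆ n, ‖∫ z, KK ε a b lam (R n) (x - z) * f z‖ₑ

lemma KR_meas (ε a b lam R : ℝ) :
    Measurable (Function.uncurry fun x z : ℝ => KK ε a b lam R (x - z)) :=
  (KK_meas ε a b lam).comp (by fun_prop : Measurable fun p : ℝ × ℝ => (R, p.1 - p.2))

lemma TTv_meas (ε a b lam R : ℝ) (f : ℝ → ℂ) (hf : Measurable f) :
    Measurable fun x => ‖∫ z, KK ε a b lam R (x - z) * f z‖ₑ :=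
  (kd_meas _ (KR_meas ε a b lam R) f hf).enorm

lemma TT_meas (ε a b lam : ℝ) (R : ℕ → ℝ) (f : ℝ → ℂ) (hf : Measurable f) :
    Measurable (TT ε a b lam R f) :=
  Measurable.iSup fun n => TTv_meas ε a b lam (R n) f hf

lemma KR_integrable (ε a b lam R : ℝ) (ha : 0 < a) (hR : 0 < R) (f : ℝ → ℂ) (hfi : Integrable f) (x : ℝ) :
    Integrable fun z => KK ε a b lam R (x - z) * f z := by
  refine hfi.bdd_mul (c := 1 / (a * R)) ?_ ?_
  · exact ((KR_meas ε a b lam R).comp (by fun_prop : Measurable fun z : ℝ => (x, z))).aestronglyMeasurable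
  · refine Eventually.of_forall fun z => (KK_norm ε a b lam R (x - z) ha hR).trans ?_
    split_ifs
    · exact le_rfl
    · positivity

lemma TT_add (ε a b lam : ℝ) (ha : 0 < a) (R : ℕ → ℝ) (hR : ∀ n, 0 < R n) (f g : ℝ → ℂ)
    (hf : Integrable f) (hg : Integrable g) (x : ℝ) :
    TT ε a b lam R (fun y => f y + g y) x ≤ TT ε a b lam R f x + TT ε a b lam R g x := by
  unfold TT
  refine iSup_le fun n => ?_
  simp only [mul_add]
  rw [integral_add (KR_integrable ε a b lam _ ha (hR n) f hf x) (KR_integrable ε a b lam _ ha (hR n) g hg x)]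
  refine (enorm_add_le _ _).trans (add_le_add ?_ ?_)
  · exact le_iSup (fun n => ‖∫ z, KK ε a b lam (R n) (x - z) * f z‖ₑ) n
  · exact le_iSup (fun n => ‖∫ z, KK ε a b lam (R n) (x - z) * g z‖ₑ) n

lemma TT_le_MF (ε a b lam : ℝ) (ha : 0 < a) (hb : 0 < b) (R : ℕ → ℝ) (hR : ∀ n, 0 < R n) (f : ℝ → ℂ)
    (x : ℝ) :
    TT ε a b lam R f x ≤ ENNReal.ofReal (2 * b / a) * MF (fun y => ‖f y‖ₑ) x := by
  refine iSup_le fun n => ?_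
  have hn := hR n
  refine (enorm_integral_le_lintegral_enorm _).trans ?_
  calc ∫⁻ z, ‖KK ε a b lam (R n) (x - z) * f z‖ₑ
      ≤ ∫⁻ z, (Metric.closedBall x (b * R n)).indicator (fun z => ENNReal.ofReal (1 / (a * R n)) * ‖f z‖ₑ) z := by
        refine lintegral_mono fun z => ?_
        have h1 := KK_norm ε a b lam (R n) (x - z) ha hn
        show ‖KK ε a b lam (R n) (x - z) * f z‖ₑ ≤ _
        rw [enorm_mul]
        by_cases hz : z ∈ Metric.closedBall x (b * R n)
        · rw [indicator_of_mem hz]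
          have : |x - z| ≤ b * R n := by rwa [Metric.mem_closedBall, Real.dist_eq, abs_sub_comm] at hz
          rw [if_pos this] at h1
          gcongr
          rw [← ofReal_norm]
          exact ENNReal.ofReal_le_ofReal h1
        · rw [indicator_of_notMem hz]
          have : ¬ |x - z| ≤ b * R n := by rwa [Metric.mem_closedBall, Real.dist_eq, abs_sub_comm] at hz
          rw [if_neg this] at h1
          have : KK ε a b lam (R n) (x - z) = 0 := norm_le_zero_iff.1 h1
          rw [this]; simp
    _ = ENNReal.ofReal (1 / (a * R n)) * ∫⁻ z in Metric.closedBall x (b * R n), ‖f z‖ₑ := by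
        rw [lintegral_indicator Metric.isClosed_closedBall.measurableSet, lintegral_const_mul' _ _ ENNReal.ofReal_ne_top]
    _ ≤ ENNReal.ofReal (1 / (a * R n)) * (ENNReal.ofReal (2 * (b * R n)) * MF (fun y => ‖f y‖ₑ) x) := by
        gcongr
        exact MF_ball_le _ x _ (by positivity)
    _ = _ := by
        rw [← mul_assoc, ← ENNReal.ofReal_mul (by positivity)]
        congr 2
        field_simp

lemma exists_argmax (v : ℕ → ℝ → ℝ≥0∞) (hv : ∀ n, Measurable (v n)) (N : ℕ) :
    ∃ idx : ℝ → ℕ, Measurable idx ∧ (∀ x, idx x ≤ N) ∧ (Measurable fun x => v (idx x) x) ∧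
      ∀ n ≤ N, ∀ x, v n x ≤ v (idx x) x := by
  induction N with
  | zero => exact ⟨fun _ => 0, measurable_const, fun _ => le_rfl, hv 0, fun n hn x => by
      rw [Nat.le_zero.1 hn]⟩
  | succ N ih =>
    obtain ⟨idx, h1, h2, h3, h4⟩ := ih
    have hs : MeasurableSet {x | v (idx x) x < v (N + 1) x} := measurableSet_lt h3 (hv _)
    refine ⟨fun x => if v (idx x) x < v (N + 1) x then N + 1 else idx x,
      Measurable.ite hs measurable_const h1, fun x => ?_, ?_, fun n hn x => ?_⟩
    · dsimp only
      split_ifs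
      · exact le_rfl
      · exact (h2 x).trans (Nat.le_succ N)
    · have : (fun x => v (if v (idx x) x < v (N + 1) x then N + 1 else idx x) x) =
          fun x => if v (idx x) x < v (N + 1) x then v (N + 1) x else v (idx x) x := by
        ext x; split_ifs <;> rfl
      rw [this]
      exact Measurable.ite hs (hv _) h3
    · dsimp only
      rcases Nat.lt_or_eq_of_le hn with h | h
      · have := h4 n (Nat.lt_succ_iff.1 h) x
        split_ifs with hc
        · exact this.trans hc.le
        · exact this
      · subst h
        split_ifs with hc
        · exact le_rfl
        · exact not_lt.1 hc

lemma TT_L2 (ε a b : ℝ) (hε0 : ε ≠ 0) (hε1 : ε ≠ 1) (ha : 0 < a) (hab : a ≤ b) :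
    ∃ C : ℝ, 0 < C ∧ ∀ lam : ℝ, lam ≠ 0 → ∀ R : ℕ → ℝ, (∀ n, 0 < R n) →
      ∀ f : ℝ → ℂ, Measurable f → Integrable f →
      ∫⁻ x, TT ε a b lam R f x ^ (2:ℝ) ≤ ENNReal.ofReal (C / Real.sqrt |lam|) * ∫⁻ x, ‖f x‖ₑ ^ (2:ℝ) := by
  obtain ⟨C, hC, H⟩ := L2_fin ε a b hε0 hε1 ha hab
  refine ⟨C, hC, fun lam hlam R hR f hf hfi => ?_⟩
  set v : ℕ → ℝ → ℝ≥0∞ := fun n x => ‖∫ z, KK ε a b lam (R n) (x - z) * f z‖ₑ with hv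
  have hvm : ∀ n, Measurable (v n) := fun n => TTv_meas ε a b lam (R n) f hf
  set w : ℕ → ℝ → ℝ≥0∞ := fun N x => partialSups (fun n => v n x) N with hw
  have hwm : ∀ n, Measurable (w n) := by
    intro n
    induction n with
    | zero => simpa [hw] using hvm 0
    | succ n ih =>
      have : w (n + 1) = fun x => w n x ⊔ v (n + 1) x := by
        ext x; simp only [hw]; rw [partialSups_add_one]
      rw [this]
      exact Measurable.sup ih (hvm _)
  have e : ∀ x, TT ε a b lam R f x ^ (2:ℝ) = ⨆ N, w N x ^ (2:ℝ) := by
    intro x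
    have e1 : TT ε a b lam R f x = ⨆ N, w N x := (iSup_partialSups_eq (fun n => v n x)).symm
    rw [e1]
    exact (ENNReal.orderIsoRpow 2 (by norm_num)).map_iSup _
  simp_rw [e]
  rw [lintegral_iSup (fun n => (hwm n).pow_const _)
    (fun m n hmn x => ENNReal.rpow_le_rpow ((partialSups _).monotone hmn) (by norm_num))]
  refine iSup_le fun N => ?_
  obtain ⟨idx, h1, h2, h3, h4⟩ := exists_argmax v hvm N
  have hne : (Finset.range (N + 1)).Nonempty := ⟨0, by simp⟩
  have hB := H lam hlam (fun x => R (idx x)) ((Finset.range (N + 1)).inf' hne R)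
    ((Finset.range (N + 1)).sup' hne R) ((measurable_of_countable R).comp h1)
    ((Finset.lt_inf'_iff _).2 fun n _ => hR n)
    (fun x => Finset.inf'_le _ (by simpa [Nat.lt_succ_iff] using h2 x))
    (fun x => Finset.le_sup' _ (by simpa [Nat.lt_succ_iff] using h2 x)) f hf hfi
  refine le_trans (lintegral_mono fun x => ?_) hB
  refine ENNReal.rpow_le_rpow ?_ (by norm_num)
  exact partialSups_le _ _ _ fun n hn => h4 n hn x

lemma TT_strong (ε a b : ℝ) (hε0 : ε ≠ 0) (hε1 : ε ≠ 1) (ha : 0 < a) (hab : a ≤ b) (p : ℝ) (hp : 1 < p) :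
    ∃ C δ : ℝ, 0 < C ∧ 0 < δ ∧ ∀ lam : ℝ, 1 ≤ |lam| → ∀ R : ℕ → ℝ, (∀ n, 0 < R n) →
      ∀ f : ℝ → ℂ, Measurable f → Integrable f →
      ∫⁻ x, TT ε a b lam R f x ^ p ≤ ENNReal.ofReal (C * |lam| ^ (-δ)) * ∫⁻ x, ‖f x‖ₑ ^ p := by
  have hb : 0 < b := lt_of_lt_of_le ha hab
  obtain ⟨C2, hC2, H2⟩ := TT_L2 ε a b hε0 hε1 ha hab
  obtain ⟨C, δ, hC, hδ, HI⟩ := interp p hp (2 * b / a) (by positivity)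
  set K := Real.sqrt (C2 + 1) with hK
  have hK1 : 1 ≤ K := Real.one_le_sqrt.2 (by linarith)
  have hK0 : 0 < K := by linarith
  set k := ENNReal.ofReal (1 / K) with hk
  have hk1 : k ≤ 1 := by
    rw [hk, ENNReal.ofReal_le_one]
    exact (div_le_one hK0).2 hK1
  have hk2 : k ^ (2:ℝ) = ENNReal.ofReal (1 / (C2 + 1)) := by
    rw [hk, ENNReal.ofReal_rpow_of_pos (by positivity)]
    congr 1
    rw [Real.rpow_two, div_pow, hK, Real.sq_sqrt (by linarith), one_pow]
  refine ⟨K ^ p * C, δ / 2, by positivity, by positivity, fun lam hlam R hR f hf hfi => ?_⟩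
  have hl0 : 0 < |lam| := by linarith
  have hlne : lam ≠ 0 := abs_pos.1 hl0
  set bb := 1 / Real.sqrt |lam| with hbb
  have hs1 : 1 ≤ Real.sqrt |lam| := Real.one_le_sqrt.2 hlam
  have hb0 : 0 < bb := by positivity
  have hb1 : bb ≤ 1 := (div_le_one (by linarith)).2 hs1
  set g : ℝ → ℝ≥0∞ := fun y => ‖f y‖ₑ with hg
  have hgm : Measurable g := hf.enorm
  set fh : ℝ≥0∞ → ℝ → ℂ := fun t y => if t < g y then f y else 0 with hfh
  set fl : ℝ≥0∞ → ℝ → ℂ := fun t y => if g y ≤ t then f y else 0 with hfl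
  have hfhm : ∀ t, Measurable (fh t) := fun t =>
    Measurable.ite (measurableSet_lt measurable_const hgm) hf measurable_const
  have hflm : ∀ t, Measurable (fl t) := fun t =>
    Measurable.ite (measurableSet_le hgm measurable_const) hf measurable_const
  have hfhi : ∀ t, Integrable (fh t) := fun t => hfi.mono (hfhm t).aestronglyMeasurable
    (Eventually.of_forall fun y => by simp only [hfh]; split_ifs <;> simp)
  have hfli : ∀ t, Integrable (fl t) := fun t => hfi.mono (hflm t).aestronglyMeasurable
    (Eventually.of_forall fun y => by simp only [hfl]; split_ifs <;> simp)
  have hsplit : ∀ t, f = fun y => fh t y + fl t y := by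
    intro t; ext y
    simp only [hfh, hfl]
    by_cases h : t < g y
    · rw [if_pos h, if_neg (not_le.2 h), add_zero]
    · rw [if_neg h, if_pos (not_lt.1 h), zero_add]
  have hL2 : ∀ u : ℝ → ℂ, Measurable u → Integrable u →
      ∫⁻ x, (k * TT ε a b lam R u x) ^ (2:ℝ) ≤ ENNReal.ofReal bb * ∫⁻ x, ‖u x‖ₑ ^ (2:ℝ) := by
    intro u hu hui
    have e : ∀ x, (k * TT ε a b lam R u x) ^ (2:ℝ) = k ^ (2:ℝ) * TT ε a b lam R u x ^ (2:ℝ) :=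
      fun x => ENNReal.mul_rpow_of_nonneg _ _ (by norm_num)
    simp_rw [e]
    rw [lintegral_const_mul' _ _ (by rw [hk2]; exact ENNReal.ofReal_ne_top)]
    refine (mul_le_mul_right (H2 lam hlne R hR u hu hui) _).trans ?_
    rw [← mul_assoc, hk2, ← ENNReal.ofReal_mul (by positivity)]
    gcongr
    rw [hbb]
    calc 1 / (C2 + 1) * (C2 / Real.sqrt |lam|) = (C2 / (C2 + 1)) * (1 / Real.sqrt |lam|) := by ring
      _ ≤ 1 * (1 / Real.sqrt |lam|) := by
        gcongr
        exact (div_le_one (by positivity)).2 (by linarith)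
      _ = _ := one_mul _
  have hpt : ∀ u : ℝ → ℂ, ∀ x, k * TT ε a b lam R u x ≤ ENNReal.ofReal (2 * b / a) * MF (fun y => ‖u y‖ₑ) x := by
    intro u x
    calc k * TT ε a b lam R u x ≤ 1 * TT ε a b lam R u x := by gcongr
      _ = TT ε a b lam R u x := one_mul _
      _ ≤ _ := TT_le_MF ε a b lam ha hb R hR u x
  have eh : ∀ t y, ‖fh t y‖ₑ = if t < g y then g y else 0 := by
    intro t y; simp only [hfh]; split_ifs <;> simp [hg]
  have el : ∀ t y, ‖fl t y‖ₑ = if g y ≤ t then g y else 0 := by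
    intro t y; simp only [hfl]; split_ifs <;> simp [hg]
  have eh2 : ∀ t y, ‖fh t y‖ₑ ^ (2:ℝ) = if t < g y then g y ^ (2:ℝ) else 0 := by
    intro t y; rw [eh]; split_ifs <;> simp
  have el2 : ∀ t y, ‖fl t y‖ₑ ^ (2:ℝ) = if g y ≤ t then g y ^ (2:ℝ) else 0 := by
    intro t y; rw [el]; split_ifs <;> simp
  have main := HI (fun x => k * TT ε a b lam R f x) g (fun t x => k * TT ε a b lam R (fh t) x)
    (fun t x => k * TT ε a b lam R (fl t) x) bb hb0 hb1
    ((TT_meas ε a b lam R f hf).const_mul _) hgm (fun x => by simp [hg])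
    (fun t => (TT_meas ε a b lam R _ (hfhm t)).const_mul _)
    (fun t => (TT_meas ε a b lam R _ (hflm t)).const_mul _)
    (fun t x => by
      rw [← mul_add]
      gcongr
      conv_lhs => rw [hsplit t]
      exact TT_add ε a b lam ha R hR _ _ (hfhi t) (hfli t) x)
    (fun t x => by
      have := hpt (fh t) x
      simp_rw [eh] at this
      exact this)
    (fun t x => by
      have := hpt (fl t) x
      simp_rw [el] at this
      exact this)
    (fun t => by
      have := hL2 (fh t) (hfhm t) (hfhi t)
      simp_rw [eh2] at this
      exact this)
    (fun t => by
      have := hL2 (fl t) (hflm t) (hfli t)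
      simp_rw [el2] at this
      exact this)
  have hp0 : 0 ≤ p := by linarith
  have e2 : ∀ x, TT ε a b lam R f x ^ p = ENNReal.ofReal (K ^ p) * (k * TT ε a b lam R f x) ^ p := by
    intro x
    rw [ENNReal.mul_rpow_of_nonneg _ _ hp0, ← mul_assoc, hk, ENNReal.ofReal_rpow_of_pos (by positivity),
      ← ENNReal.ofReal_mul (by positivity), ← Real.mul_rpow (by positivity) (by positivity)]
    rw [mul_one_div_cancel hK0.ne', Real.one_rpow, ENNReal.ofReal_one, one_mul]
  simp_rw [e2]
  rw [lintegral_const_mul' _ _ ENNReal.ofReal_ne_top]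
  refine (mul_le_mul_right main _).trans (le_of_eq ?_)
  rw [← mul_assoc, ← ENNReal.ofReal_mul (by positivity)]
  congr 2
  have : bb ^ δ = |lam| ^ (-(δ / 2)) := by
    rw [hbb, one_div, Real.sqrt_eq_rpow, ← Real.rpow_neg hl0.le, ← Real.rpow_mul hl0.le]
    congr 1; ring
  rw [this]; ring


noncomputable def DD (f : ℝ → ℂ) (x y : ℝ) : ℂ := (f (x - y) - f (x + y)) / (y : ℂ)

noncomputable def EE (ε A y : ℝ) : ℂ := Complex.exp (Complex.I * (A : ℂ) * ((|y| ^ ε : ℝ) : ℂ))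

noncomputable def GG (ε A : ℝ) (f : ℝ → ℂ) (x y : ℝ) : ℂ := EE ε A y * DD f x y

lemma EE_norm (ε A y : ℝ) : ‖EE ε A y‖ = 1 := by
  unfold EE
  have : Complex.I * (A : ℂ) * ((|y| ^ ε : ℝ) : ℂ) = ((A * |y| ^ ε : ℝ) : ℂ) * Complex.I := by
    push_cast; ring
  rw [this, Complex.norm_exp_ofReal_mul_I]

lemma EE_meas (ε A : ℝ) : Measurable (EE ε A) := by
  unfold EE
  refine Complex.measurable_exp.comp (measurable_const.mul (Complex.measurable_ofReal.comp ?_))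
  exact Measurable.pow_const (by fun_prop) ε

lemma DD_meas (f : ℝ → ℂ) (hc : Continuous f) (x : ℝ) : Measurable (DD f x) := by
  unfold DD
  exact Measurable.div (by fun_prop) Complex.measurable_ofReal

lemma GG_meas (ε A : ℝ) (f : ℝ → ℂ) (hc : Continuous f) (x : ℝ) : Measurable (GG ε A f x) :=
  (EE_meas ε A).mul (DD_meas f hc x)

lemma DD_int (f : ℝ → ℂ) (hc : Continuous f) (hi : Integrable f) (L : ℝ)
    (hL : ∀ u v, ‖f u - f v‖ ≤ L * |u - v|) (x : ℝ) : IntegrableOn (DD f x) (Ioi 0) := by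
  have hL0 : 0 ≤ L := by
    have := (norm_nonneg _).trans (hL 1 0); simpa using this
  have h1 : Integrable ((Icc (0:ℝ) 1).indicator fun _ => 2 * L) :=
    (integrable_indicator_iff measurableSet_Icc).2 (continuous_const.continuousOn.integrableOn_compact isCompact_Icc)
  have h2 : Integrable fun y => ‖f (x - y)‖ := (hi.comp_sub_left x).norm
  have h3 : Integrable fun y => ‖f (x + y)‖ := (hi.comp_add_left x).norm
  refine ((h1.add h2).add h3).integrableOn.mono' (DD_meas f hc x).aestronglyMeasurable ?_
  refine (ae_restrict_iff' measurableSet_Ioi).2 (Eventually.of_forall fun y hy => ?_)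
  have hy : 0 < y := hy
  have e : ‖DD f x y‖ = ‖f (x - y) - f (x + y)‖ / y := by
    rw [DD, norm_div, Complex.norm_real, Real.norm_of_nonneg hy.le]
  rw [e]
  simp only [Pi.add_apply]
  by_cases h : y ≤ 1
  · rw [indicator_of_mem (show y ∈ Icc (0:ℝ) 1 from ⟨hy.le, h⟩)]
    have h4 := hL (x - y) (x + y)
    have e2 : |x - y - (x + y)| = 2 * y := by
      rw [show x - y - (x + y) = -(2 * y) by ring, abs_neg, abs_of_pos (by linarith)]
    rw [e2] at h4
    have : ‖f (x - y) - f (x + y)‖ / y ≤ 2 * L := by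
      rw [div_le_iff₀ hy]; linarith
    have := norm_nonneg (f (x - y))
    have := norm_nonneg (f (x + y))
    linarith
  · rw [indicator_of_notMem (fun h' => h h'.2)]
    have : ‖f (x - y) - f (x + y)‖ / y ≤ ‖f (x - y) - f (x + y)‖ := div_le_self (norm_nonneg _) (by linarith)
    have := norm_sub_le (f (x - y)) (f (x + y))
    linarith

lemma GG_int (ε A : ℝ) (f : ℝ → ℂ) (hc : Continuous f) (hi : Integrable f) (L : ℝ)
    (hL : ∀ u v, ‖f u - f v‖ ≤ L * |u - v|) (x : ℝ) : IntegrableOn (GG ε A f x) (Ioi 0) := by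
  refine (DD_int f hc hi L hL x).bdd_mul (c := 1) (EE_meas ε A).aestronglyMeasurable
    (Eventually.of_forall fun y => (EE_norm ε A y).le)

lemma sym_int (h : ℝ → ℂ) (hi : Integrable h) : ∫ y, h y = ∫ y in Ioi 0, (h y + h (-y)) := by
  have h1 := integral_comp_neg_Ioi (0:ℝ) h
  rw [neg_zero] at h1
  rw [integral_add hi.integrableOn hi.comp_neg.integrableOn, h1, add_comm]
  exact (intervalIntegral.integral_Iic_add_Ioi hi.integrableOn hi.integrableOn).symm

lemma cover0 : AECover (volume.restrict (Ioi (0:ℝ))) ((𝓝[>] (0:ℝ)) ×ˢ atTop)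
    (fun p : ℝ × ℝ => Icc p.1 p.2) where
  ae_eventually_mem := by
    refine (ae_restrict_iff' measurableSet_Ioi).2 (Eventually.of_forall fun y hy => ?_)
    have h1 : ∀ᶠ s in 𝓝[>] (0:ℝ), s ≤ y := nhdsWithin_le_nhds (Iic_mem_nhds hy)
    exact h1.prod_mk (eventually_ge_atTop y)
  measurableSet := fun _ => measurableSet_Icc

lemma tend0 (G : ℝ → ℂ) (hG : IntegrableOn G (Ioi 0)) :
    Tendsto (fun p : ℝ × ℝ => ∫ y in Icc p.1 p.2, G y) ((𝓝[>] (0:ℝ)) ×ˢ atTop) (𝓝 (∫ y in Ioi 0, G y)) := by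
  refine (cover0.integral_tendsto_of_countably_generated hG).congr' ?_
  have h1 : ∀ᶠ s in 𝓝[>] (0:ℝ), 0 < s := self_mem_nhdsWithin
  filter_upwards [h1.prod_inl (atTop : Filter ℝ)] with p hp
  rw [Measure.restrict_restrict measurableSet_Icc, inter_eq_left.2]
  intro y hy
  exact lt_of_lt_of_le hp hy.1

lemma pv_eq (ε A : ℝ) (f : ℝ → ℂ) (hc : Continuous f) (hi : Integrable f) (L : ℝ)
    (hL : ∀ u v, ‖f u - f v‖ ≤ L * |u - v|) (x : ℝ) :
    pvIntegral (fun y => Complex.exp (Complex.I * (A : ℂ) * ((|y| ^ ε : ℝ) : ℂ)) * f (x - y) / (y : ℂ))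
      = ∫ y in Ioi 0, GG ε A f x y := by
  unfold pvIntegral
  refine Tendsto.limUnder_eq ((tend0 _ (GG_int ε A f hc hi L hL x)).congr' ?_)
  have h1 : ∀ᶠ s in 𝓝[>] (0:ℝ), 0 < s := self_mem_nhdsWithin
  filter_upwards [h1.prod_inl (atTop : Filter ℝ)] with p hp
  have hS : MeasurableSet {y : ℝ | p.1 ≤ |y| ∧ |y| ≤ p.2} :=
    (measurableSet_le (f := fun _ : ℝ => p.1) (g := fun y : ℝ => |y|) (by fun_prop) (by fun_prop)).inter
      (measurableSet_le (f := fun y : ℝ => |y|) (g := fun _ : ℝ => p.2) (by fun_prop) (by fun_prop))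
  set S := {y : ℝ | p.1 ≤ |y| ∧ |y| ≤ p.2} with hSd
  set g : ℝ → ℂ := fun y => EE ε A y * f (x - y) / (y : ℂ) with hg
  have hgm : Measurable g := ((EE_meas ε A).mul (by fun_prop)).div Complex.measurable_ofReal
  show _ = ∫ y in S, g y
  have hint : Integrable (S.indicator g) := by
    refine ((hi.comp_sub_left x).norm.const_mul p.1⁻¹).mono' (hgm.indicator hS).aestronglyMeasurable ?_
    refine Eventually.of_forall fun y => ?_
    by_cases hy : y ∈ S
    · rw [indicator_of_mem hy, hg]
      simp only [norm_div, norm_mul, EE_norm, one_mul, Complex.norm_real, Real.norm_eq_abs]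
      rw [div_eq_inv_mul]
      gcongr
      exact hy.1
    · rw [indicator_of_notMem hy, norm_zero]
      have : 0 < p.1 := hp
      positivity
  rw [← integral_indicator hS, sym_int _ hint, ← integral_indicator measurableSet_Icc,
    ← integral_indicator measurableSet_Ioi]
  congr 1; ext y
  by_cases hy : y ∈ Ioi (0:ℝ)
  · have hy0 : 0 < y := hy
    rw [indicator_of_mem hy]
    by_cases h2 : y ∈ Icc p.1 p.2
    · have m1 : y ∈ S := by rw [hSd, mem_ofPred_eq, abs_of_pos hy0]; exact h2
      have m2 : -y ∈ S := by rw [hSd, mem_ofPred_eq, abs_neg, abs_of_pos hy0]; exact h2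
      rw [indicator_of_mem h2, indicator_of_mem m1, indicator_of_mem m2]
      simp only [hg, GG, DD]
      have : EE ε A (-y) = EE ε A y := by unfold EE; rw [abs_neg]
      rw [this]
      push_cast
      rw [sub_neg_eq_add, div_neg]
      ring
    · have m1 : y ∉ S := fun h => h2 (by rwa [hSd, mem_ofPred_eq, abs_of_pos hy0] at h)
      have m2 : -y ∉ S := fun h => h2 (by rwa [hSd, mem_ofPred_eq, abs_neg, abs_of_pos hy0] at h)
      rw [indicator_of_notMem h2, indicator_of_notMem m1, indicator_of_notMem m2, add_zero]
  · rw [indicator_of_notMem hy, indicator_of_notMem]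
    intro h
    exact hy (lt_of_lt_of_le hp h.1)

lemma trunc_hilbert (f : ℝ → ℂ) (hc : Continuous f) (hi : Integrable f) (x s : ℝ) (hs : 0 < s) :
    ‖∫ y in Ioi s, DD f x y‖ₑ ≤ NF f x + ENNReal.ofReal (2 * Real.pi) * MF (fun y => ‖f y‖ₑ) x := by
  have hS : MeasurableSet {y : ℝ | s < |y|} := measurableSet_lt measurable_const (by fun_prop)
  set S := {y : ℝ | s < |y|} with hSd
  set g : ℝ → ℂ := fun y => f (x - y) * (y : ℂ)⁻¹ with hg
  have hgm : Measurable g := Measurable.mul (by fun_prop) Complex.measurable_ofReal.inv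
  have hint : Integrable (S.indicator g) := by
    refine ((hi.comp_sub_left x).norm.const_mul s⁻¹).mono' (hgm.indicator hS).aestronglyMeasurable ?_
    refine Eventually.of_forall fun y => ?_
    by_cases hy : y ∈ S
    · rw [indicator_of_mem hy, hg]
      have hy' : s < |y| := hy
      simp only [norm_mul, norm_inv, Complex.norm_real, Real.norm_eq_abs]
      rw [mul_comm]
      gcongr
    · rw [indicator_of_notMem hy, norm_zero]
      positivity
  have e1 : ∫ y in Ioi s, DD f x y = ∫ y, S.indicator g y := by
    rw [sym_int _ hint, ← integral_indicator measurableSet_Ioi, ← integral_indicator measurableSet_Ioi]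
    congr 1; ext y
    by_cases hy : y ∈ Ioi (0:ℝ)
    · have hy0 : 0 < y := hy
      rw [indicator_of_mem hy]
      by_cases h2 : y ∈ Ioi s
      · have m1 : y ∈ S := by rw [hSd, mem_ofPred_eq, abs_of_pos hy0]; exact h2
        have m2 : -y ∈ S := by rw [hSd, mem_ofPred_eq, abs_neg, abs_of_pos hy0]; exact h2
        rw [indicator_of_mem h2, indicator_of_mem m1, indicator_of_mem m2]
        simp only [hg, DD]
        push_cast
        rw [sub_neg_eq_add, inv_neg]
        ring
      · have m1 : y ∉ S := fun h => h2 (by rwa [hSd, mem_ofPred_eq, abs_of_pos hy0] at h)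
        have m2 : -y ∉ S := fun h => h2 (by rwa [hSd, mem_ofPred_eq, abs_neg, abs_of_pos hy0] at h)
        rw [indicator_of_notMem h2, indicator_of_notMem m1, indicator_of_notMem m2, add_zero]
    · rw [indicator_of_notMem hy, indicator_of_notMem]
      intro h
      exact hy (hs.trans h)
  have him : 0 < ((x:ℂ) + s * Complex.I).im := by simpa using hs
  have e2 : CT f (x + s * Complex.I) = ∫ y, f (x - y) * ((y:ℂ) + s * Complex.I)⁻¹ := by
    unfold CT
    rw [← integral_sub_left_eq_self _ volume x]
    congr 1; ext y
    congr 2; push_cast; ring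
  have hint2 : Integrable fun y : ℝ => f (x - y) * ((y:ℂ) + s * Complex.I)⁻¹ := by
    have := (CT_integrable f hi _ him).comp_sub_left x
    refine this.congr (Eventually.of_forall fun y => ?_)
    dsimp only
    congr 2; push_cast; ring
  have key : ∀ y : ℝ, ‖S.indicator g y - f (x - y) * ((y:ℂ) + s * Complex.I)⁻¹‖ ≤
      2 * (s / (y ^ 2 + s ^ 2)) * ‖f (x - y)‖ := by
    intro y
    have hq : 0 < y ^ 2 + s ^ 2 := by positivity
    have hz : ((y:ℂ) + s * Complex.I) ≠ 0 := by
      intro h; have := congrArg Complex.im h; simp at this; exact hs.ne' this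
    have hn : ‖(y:ℂ) + s * Complex.I‖ ^ 2 = y ^ 2 + s ^ 2 := by
      rw [← Complex.normSq_eq_norm_sq, Complex.normSq_apply]; simp; ring
    have hn0 : 0 < ‖(y:ℂ) + s * Complex.I‖ := norm_pos_iff.2 hz
    set n := ‖(y:ℂ) + s * Complex.I‖ with hnd
    by_cases hy : y ∈ S
    · have hy' : s < |y| := hy
      have hy0 : 0 < |y| := hs.trans hy'
      have hyne : (y:ℂ) ≠ 0 := by exact_mod_cast abs_pos.1 hy0
      rw [indicator_of_mem hy]
      have e : g y - f (x - y) * ((y:ℂ) + s * Complex.I)⁻¹ =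
          (s * Complex.I / ((y:ℂ) * ((y:ℂ) + s * Complex.I))) * f (x - y) := by
        simp only [hg]; field_simp; ring
      rw [e, norm_mul]
      gcongr
      rw [norm_div, norm_mul, norm_mul, Complex.norm_I, mul_one, Complex.norm_real, Complex.norm_real,
        Real.norm_of_nonneg hs.le, Real.norm_eq_abs, ← hnd, ← hn, ← mul_div_assoc, div_le_div_iff₀ (by positivity) (by positivity)]
      have : n ≤ 2 * |y| := by
        refine abs_le_of_sq_le_sq' ?_ (by positivity) |>.2
        rw [hn, mul_pow, sq_abs]
        have : s ^ 2 ≤ y ^ 2 := by rw [← sq_abs y]; gcongr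
        nlinarith
      have := mul_nonneg (mul_nonneg hs.le hn0.le) (sub_nonneg.2 this)
      nlinarith
    · have hy' : |y| ≤ s := not_lt.1 hy
      rw [indicator_of_notMem hy, zero_sub, norm_neg, norm_mul, norm_inv, ← hnd, mul_comm]
      gcongr
      rw [← hn, ← mul_div_assoc, ← one_div, div_le_div_iff₀ (by positivity) (by positivity)]
      have : n ≤ 2 * s := by
        refine abs_le_of_sq_le_sq' ?_ (by positivity) |>.2
        rw [hn, mul_pow]
        have : y ^ 2 ≤ s ^ 2 := by rw [← sq_abs y]; gcongr
        nlinarith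
      nlinarith
  have e3 : ∫ y in Ioi s, DD f x y = CT f (x + s * Complex.I) +
      ∫ y, (S.indicator g y - f (x - y) * ((y:ℂ) + s * Complex.I)⁻¹) := by
    rw [integral_sub hint hint2, ← e1, ← e2]; ring
  rw [e3]
  refine (enorm_add_le _ _).trans (add_le_add ?_ ?_)
  · exact le_iSup (fun s : {s : ℝ // 0 < s} => ‖CT f (x + (s:ℝ) * Complex.I)‖ₑ) ⟨s, hs⟩
  · refine (enorm_integral_le_lintegral_enorm _).trans ?_
    have h1 := poisson_le s hs (fun y => ‖f y‖ₑ) hc.measurable.enorm x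
    rw [← lintegral_sub_left_eq_self _ x] at h1
    have e4 : ENNReal.ofReal (2 * Real.pi) * MF (fun y => ‖f y‖ₑ) x =
        2 * (ENNReal.ofReal Real.pi * MF (fun y => ‖f y‖ₑ) x) := by
      rw [ENNReal.ofReal_mul (by norm_num)]; simp [mul_assoc]
    rw [e4]
    refine le_trans ?_ (mul_le_mul_right h1 2)
    rw [← lintegral_const_mul' _ _ (by norm_num)]
    refine lintegral_mono fun y => ?_
    dsimp only
    rw [sub_sub_cancel, ← ofReal_norm, ← ofReal_norm, ← ENNReal.ofReal_mul (by positivity),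
      show (2:ℝ≥0∞) = ENNReal.ofReal 2 by simp, ← ENNReal.ofReal_mul (by norm_num)]
    refine ENNReal.ofReal_le_ofReal ?_
    rw [← mul_assoc]
    exact key y

lemma seg_hilbert (f : ℝ → ℂ) (hc : Continuous f) (hi : Integrable f) (L : ℝ)
    (hL : ∀ u v, ‖f u - f v‖ ≤ L * |u - v|) (x s t : ℝ) (hs : 0 < s) (ht : 0 < t) :
    ‖∫ y in s..t, DD f x y‖ₑ ≤ 2 * (NF f x + ENNReal.ofReal (2 * Real.pi) * MF (fun y => ‖f y‖ₑ) x) := by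
  have hD := DD_int f hc hi L hL x
  have main : ∀ s t, 0 < s → s ≤ t → ‖∫ y in s..t, DD f x y‖ₑ ≤
      2 * (NF f x + ENNReal.ofReal (2 * Real.pi) * MF (fun y => ‖f y‖ₑ) x) := by
    intro s t hs hst
    rw [← intervalIntegral.integral_Ioi_sub_Ioi (hD.mono_set (Ioi_subset_Ioi hs.le)) hst, two_mul]
    exact (enorm_sub_le).trans (add_le_add (trunc_hilbert f hc hi x s hs)
      (trunc_hilbert f hc hi x t (hs.trans_le hst)))
  rcases le_total s t with h | h
  · exact main s t hs h
  · rw [intervalIntegral.integral_symm, enorm_neg]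
    exact main t s ht h

lemma norm_seg (c R : ℝ) (hc : 0 < c) (hR : 0 < R) (φ : ℝ → ℂ) :
    ‖∫ y in R..(R * c), φ y‖ₑ = ‖∫ y in Icc (min 1 c * R) (max 1 c * R), φ y‖ₑ := by
  rw [← ofReal_norm, intervalIntegral.norm_intervalIntegral_eq, ofReal_norm, integral_Icc_eq_integral_Ioc, uIoc]
  have e1 : min R (R * c) = min 1 c * R := by
    rw [min_mul_of_nonneg _ _ hR.le, one_mul, mul_comm]
  have e2 : max R (R * c) = max 1 c * R := by
    rw [max_mul_of_nonneg _ _ hR.le, one_mul, mul_comm]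
  rw [e1, e2]

lemma osc_piece (ε a b lam A R : ℝ) (ha : 0 < a) (hR : 0 < R)
    (hA : ∀ y, 0 < y → lam * (y / R) ^ ε = A * y ^ ε) (f : ℝ → ℂ) (hi : Integrable f) (x : ℝ) :
    ‖∫ y in Icc (a * R) (b * R), GG ε A f x y‖ₑ ≤ ‖∫ z, KK ε a b lam R (x - z) * f z‖ₑ
      + ‖∫ z, KK ε a b lam R (-x - z) * f (-z)‖ₑ := by
  have i1 := (KR_integrable ε a b lam R ha hR f hi x).comp_sub_left x
  have i2 := (KR_integrable ε a b lam R ha hR (fun z => f (-z)) hi.comp_neg (-x)).comp_sub_left (-x)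
  rw [← integral_sub_left_eq_self (fun z => KK ε a b lam R (x - z) * f z) volume x,
    ← integral_sub_left_eq_self (fun z => KK ε a b lam R (-x - z) * f (-z)) volume (-x)]
  have e : ∫ y in Icc (a * R) (b * R), GG ε A f x y =
      (∫ y, KK ε a b lam R (x - (x - y)) * f (x - y)) -
        ∫ y, KK ε a b lam R (-x - (-x - y)) * f (-(-x - y)) := by
    rw [← integral_sub i1 i2, ← integral_indicator measurableSet_Icc]
    congr 1; ext y
    rw [sub_sub_cancel, sub_sub_cancel]
    unfold KK
    by_cases hy : y ∈ Icc (a * R) (b * R)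
    · have hy0 : 0 < y := lt_of_lt_of_le (by positivity) hy.1
      rw [indicator_of_mem hy, if_pos hy, hA y hy0, GG, DD, EE, abs_of_pos hy0,
        show -(-x - y) = x + y by ring]
      push_cast
      rw [mul_assoc Complex.I]
      ring
    · rw [indicator_of_notMem hy, if_neg hy]; ring
  rw [e]
  exact enorm_sub_le

lemma piece_MF (f : ℝ → ℂ) (α β : ℝ) (hα : 0 < α) (hβ : 0 < β) (x : ℝ) :
    (∫⁻ y in Icc α β, ‖f (x - y)‖ₑ ≤ ENNReal.ofReal (2 * β) * MF (fun y => ‖f y‖ₑ) x) ∧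
    (∫⁻ y in Icc α β, ‖f (x + y)‖ₑ ≤ ENNReal.ofReal (2 * β) * MF (fun y => ‖f y‖ₑ) x) := by
  have h := MF_ball_le (fun y => ‖f y‖ₑ) x β hβ
  rw [← lintegral_indicator Metric.isClosed_closedBall.measurableSet] at h
  constructor
  · rw [← lintegral_sub_left_eq_self _ x] at h
    refine le_trans ?_ h
    rw [← lintegral_indicator measurableSet_Icc]
    refine lintegral_mono fun y => ?_
    by_cases hy : y ∈ Icc α β
    · rw [indicator_of_mem hy, indicator_of_mem]
      rw [Metric.mem_closedBall, Real.dist_eq, sub_sub_cancel_left, abs_neg, abs_of_pos (hα.trans_le hy.1)]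
      exact hy.2
    · rw [indicator_of_notMem hy]; exact zero_le
  · rw [← lintegral_add_left_eq_self _ x] at h
    refine le_trans ?_ h
    rw [← lintegral_indicator measurableSet_Icc]
    refine lintegral_mono fun y => ?_
    by_cases hy : y ∈ Icc α β
    · rw [indicator_of_mem hy, indicator_of_mem]
      rw [Metric.mem_closedBall, Real.dist_eq, add_sub_cancel_left, abs_of_pos (hα.trans_le hy.1)]
      exact hy.2
    · rw [indicator_of_notMem hy]; exact zero_le

lemma small_piece (ε A a b R m : ℝ) (ha : 0 < a) (hb : 0 < b) (hR : 0 < R) (hm0 : 0 ≤ m)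
    (hm : ∀ y ∈ Icc (a * R) (b * R), |A| * y ^ ε ≤ m) (f : ℝ → ℂ) (hc : Continuous f) (x : ℝ) :
    ‖∫ y in Icc (a * R) (b * R), (GG ε A f x y - DD f x y)‖ₑ ≤
      ENNReal.ofReal (m * (4 * b / a)) * MF (fun y => ‖f y‖ₑ) x := by
  refine (enorm_integral_le_lintegral_enorm _).trans ?_
  calc ∫⁻ y in Icc (a * R) (b * R), ‖GG ε A f x y - DD f x y‖ₑ
      ≤ ∫⁻ y in Icc (a * R) (b * R), ENNReal.ofReal (m / (a * R)) * (‖f (x - y)‖ₑ + ‖f (x + y)‖ₑ) := by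
        refine setLIntegral_mono' measurableSet_Icc fun y hy => ?_
        have hy0 : 0 < y := lt_of_lt_of_le (by positivity) hy.1
        have e : GG ε A f x y - DD f x y = (EE ε A y - 1) * (y:ℂ)⁻¹ * (f (x - y) - f (x + y)) := by
          rw [GG, DD]; ring
        rw [e, enorm_mul]
        refine mul_le_mul' ?_ enorm_sub_le
        rw [← ofReal_norm]
        refine ENNReal.ofReal_le_ofReal ?_
        rw [norm_mul, norm_inv, Complex.norm_real, Real.norm_of_nonneg hy0.le, div_eq_mul_inv]
        have h1 : ‖EE ε A y - 1‖ ≤ m := by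
          have h2 := Real.norm_exp_I_mul_ofReal_sub_one_le (x := A * y ^ ε)
          have e2 : EE ε A y = Complex.exp (Complex.I * ((A * y ^ ε : ℝ) : ℂ)) := by
            rw [EE, abs_of_pos hy0]; push_cast; rw [mul_assoc]
          rw [e2]
          refine h2.trans ?_
          rw [Real.norm_eq_abs, abs_mul, abs_of_pos (Real.rpow_pos_of_pos hy0 ε)]
          exact hm y hy
        gcongr
        exact hy.1
    _ = ENNReal.ofReal (m / (a * R)) * ((∫⁻ y in Icc (a * R) (b * R), ‖f (x - y)‖ₑ) +
          ∫⁻ y in Icc (a * R) (b * R), ‖f (x + y)‖ₑ) := by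
        rw [lintegral_const_mul' _ _ ENNReal.ofReal_ne_top, lintegral_add_left]
        exact (hc.measurable.comp (by fun_prop)).enorm
    _ ≤ ENNReal.ofReal (m / (a * R)) * (ENNReal.ofReal (2 * (b * R)) * MF (fun y => ‖f y‖ₑ) x +
          ENNReal.ofReal (2 * (b * R)) * MF (fun y => ‖f y‖ₑ) x) := by
        have := piece_MF f (a * R) (b * R) (by positivity) (by positivity) x
        gcongr
        · exact this.1
        · exact this.2
    _ = _ := by
        rw [← add_mul, ← mul_assoc, ← ENNReal.ofReal_add (by positivity) (by positivity),
          ← ENNReal.ofReal_mul (by positivity)]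
        congr 2
        field_simp; ring

lemma seg_tend1 (c r : ℝ) (hc : 1 < c) (hr : 0 < r) (G : ℝ → ℂ) (hG : IntegrableOn G (Ioi 0)) :
    Tendsto (fun N : ℕ => ‖∫ y in (r * c⁻¹ ^ N)..(r * c ^ N), G y‖ₑ) atTop (𝓝 ‖∫ y in Ioi 0, G y‖ₑ) := by
  have hc0 : 0 < c := by linarith
  have h1 : Tendsto (fun N : ℕ => r * c⁻¹ ^ N) atTop (𝓝[>] 0) := by
    refine tendsto_nhdsWithin_iff.2 ⟨?_, Eventually.of_forall fun N => by
      show 0 < r * c⁻¹ ^ N; positivity⟩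
    have := (tendsto_pow_atTop_nhds_zero_of_lt_one (by positivity) (inv_lt_one_of_one_lt₀ hc)).const_mul r
    simpa using this
  have h2 : Tendsto (fun N : ℕ => r * c ^ N) atTop atTop :=
    (tendsto_pow_atTop_atTop_of_one_lt hc).const_mul_atTop hr
  have h3 := (continuous_enorm.tendsto _).comp ((tend0 G hG).comp (h1.prodMk h2))
  refine h3.congr fun N => ?_
  simp only [Function.comp]
  rw [intervalIntegral.integral_of_le, integral_Icc_eq_integral_Ioc]
  gcongr
  exact ((inv_lt_one_of_one_lt₀ hc).le).trans hc.le

lemma seg_tend (c r : ℝ) (hc0 : 0 < c) (hc : c ≠ 1) (hr : 0 < r) (G : ℝ → ℂ) (hG : IntegrableOn G (Ioi 0)) :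
    Tendsto (fun N : ℕ => ‖∫ y in (r * c⁻¹ ^ N)..(r * c ^ N), G y‖ₑ) atTop (𝓝 ‖∫ y in Ioi 0, G y‖ₑ) := by
  rcases lt_or_gt_of_ne hc with h | h
  · have := seg_tend1 c⁻¹ r ((one_lt_inv₀ hc0).2 h) hr G hG
    rw [inv_inv] at this
    refine this.congr fun N => ?_
    rw [intervalIntegral.integral_symm, enorm_neg]
  · exact seg_tend1 c r h hr G hG

lemma hilbert_pt (f : ℝ → ℂ) (hc : Continuous f) (hi : Integrable f) (L : ℝ)
    (hL : ∀ u v, ‖f u - f v‖ ≤ L * |u - v|) (x : ℝ) :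
    ‖∫ y in Ioi 0, DD f x y‖ₑ ≤ 2 * (NF f x + ENNReal.ofReal (2 * Real.pi) * MF (fun y => ‖f y‖ₑ) x) :=
  le_of_tendsto' (seg_tend 2 1 (by norm_num) (by norm_num) one_pos _ (DD_int f hc hi L hL x))
    fun N => seg_hilbert f hc hi L hL x _ _ (by positivity) (by positivity)

lemma pow_le_aux (c R y ε : ℝ) (hε : ε ≠ 0) (hcd : c = 2 ^ (1 / ε)) (hR : 0 < R)
    (hy : y ∈ Icc (min 1 c * R) (max 1 c * R)) : y ^ ε ≤ 2 * R ^ ε := by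
  have hc : 0 < c := by rw [hcd]; positivity
  have hcε : c ^ ε = 2 := by
    rw [hcd, ← Real.rpow_mul (by norm_num), one_div_mul_cancel hε, Real.rpow_one]
  have hmin : 0 < min 1 c := lt_min one_pos hc
  have hy0 : 0 < y := lt_of_lt_of_le (by positivity) hy.1
  rw [← hcε, ← Real.mul_rpow hc.le hR.le]
  rcases lt_or_gt_of_ne hε with h | h
  · have : c ≤ 1 := by
      rw [hcd]
      exact Real.rpow_le_one_of_one_le_of_nonpos (by norm_num) (by
        rw [one_div]; exact (inv_lt_zero.2 h).le)
    rw [min_eq_right this] at hy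
    exact Real.rpow_le_rpow_of_nonpos (by positivity) hy.1 h.le
  · have : 1 ≤ c := by
      rw [hcd]; exact Real.one_le_rpow (by norm_num) (by positivity)
    rw [max_eq_right this] at hy
    exact Real.rpow_le_rpow hy0.le hy.2 h.le

lemma point_bound (ε A c r a b : ℝ) (hε : ε ≠ 0) (hA : A ≠ 0) (hcd : c = 2 ^ (1 / ε))
    (hrd : r = |A| ^ (-(1 / ε))) (had : a = min 1 c) (hbd : b = max 1 c) (f : ℝ → ℂ) (hc : Continuous f)
    (hi : Integrable f) (L : ℝ) (hL : ∀ u v, ‖f u - f v‖ ≤ L * |u - v|) (x : ℝ) :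
    ‖∫ y in Ioi 0, GG ε A f x y‖ₑ ≤
      (∑' j : ℕ, (‖∫ z, KK ε a b (SignType.sign A * 2 ^ j) (r * c ^ j) (x - z) * f z‖ₑ +
        ‖∫ z, KK ε a b (SignType.sign A * 2 ^ j) (r * c ^ j) (-x - z) * f (-z)‖ₑ)) +
      (ENNReal.ofReal (8 * b / a) * MF (fun y => ‖f y‖ₑ) x +
      2 * (NF f x + ENNReal.ofReal (2 * Real.pi) * MF (fun y => ‖f y‖ₑ) x)) := by
  have hA0 : 0 < |A| := abs_pos.2 hA
  have hc0 : 0 < c := by rw [hcd]; positivity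
  have hr : 0 < r := by rw [hrd]; positivity
  have ha : 0 < a := by rw [had]; exact lt_min one_pos hc0
  have hb : 0 < b := by rw [hbd]; exact lt_max_of_lt_left one_pos
  have hcε : c ^ ε = 2 := by
    rw [hcd, ← Real.rpow_mul (by norm_num), one_div_mul_cancel hε, Real.rpow_one]
  have hrε : r ^ ε = |A|⁻¹ := by
    rw [hrd, ← Real.rpow_mul hA0.le, neg_mul, one_div_mul_cancel hε, Real.rpow_neg_one]
  have hc1 : c ≠ 1 := by
    intro h; rw [h, Real.one_rpow] at hcε; norm_num at hcε
  have hG := GG_int ε A f hc hi L hL x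
  have hD := DD_int f hc hi L hL x
  have hsub : ∀ s t : ℝ, 0 < s → 0 < t → uIoc s t ⊆ Ioi 0 := by
    intro s t hs ht y hy
    exact lt_trans (lt_min hs ht) hy.1
  have hGI : ∀ s t : ℝ, 0 < s → 0 < t → IntervalIntegrable (GG ε A f x) volume s t := fun s t hs ht =>
    intervalIntegrable_iff.2 (hG.mono_set (hsub s t hs ht))
  have hDI : ∀ s t : ℝ, 0 < s → 0 < t → IntervalIntegrable (DD f x) volume s t := fun s t hs ht =>
    intervalIntegrable_iff.2 (hD.mono_set (hsub s t hs ht))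
  refine le_of_tendsto' (seg_tend c r hc0 hc1 hr _ hG) fun N => ?_
  have hsM : ∀ j : ℕ, 0 < r * c⁻¹ ^ j := fun j => by positivity
  have hsP : ∀ j : ℕ, 0 < r * c ^ j := fun j => by positivity
  have e1 : ∫ y in (r * c⁻¹ ^ N)..(r * c ^ N), GG ε A f x y =
      (∫ y in r..(r * c ^ N), GG ε A f x y) + (-(∫ y in r..(r * c⁻¹ ^ N), (GG ε A f x y - DD f x y)) +
        ∫ y in (r * c⁻¹ ^ N)..r, DD f x y) := by
    rw [intervalIntegral.integral_sub (hGI _ _ hr (hsM N)) (hDI _ _ hr (hsM N)),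
      intervalIntegral.integral_symm r, ← intervalIntegral.integral_add_adjacent_intervals (hGI _ r (hsM N) hr)
      (hGI r _ hr (hsP N)), intervalIntegral.integral_symm r (r * c⁻¹ ^ N)]
    ring
  rw [e1]
  refine (enorm_add_le _ _).trans (add_le_add ?_ ((enorm_add_le _ _).trans (add_le_add ?_ ?_)))
  · have := intervalIntegral.sum_integral_adjacent_intervals (f := GG ε A f x) (μ := volume)
      (a := fun j : ℕ => r * c ^ j) (n := N) (fun k _ => hGI _ _ (hsP k) (hsP (k + 1)))
    simp only [pow_zero, mul_one] at this
    rw [← this]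
    refine (enorm_sum_le _ _).trans (le_trans (Finset.sum_le_sum fun j _ => ?_) (ENNReal.sum_le_tsum (Finset.range N)))
    rw [pow_succ, ← mul_assoc, norm_seg c _ hc0 (hsP j), ← had, ← hbd]
    refine osc_piece ε a b _ A _ ha (hsP j) (fun y hy => ?_) f hi x
    have h1 : (r * c ^ j) ^ ε = |A|⁻¹ * 2 ^ j := by
      rw [Real.mul_rpow hr.le (by positivity), hrε, ← Real.rpow_natCast, ← Real.rpow_mul hc0.le, mul_comm (j:ℝ),
        Real.rpow_mul hc0.le, hcε, Real.rpow_natCast]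
    rw [Real.div_rpow hy.le (hsP j).le, h1]
    have h2 : ((SignType.sign A : SignType) : ℝ) * |A| = A := sign_mul_abs A
    calc _ = ((SignType.sign A : SignType) : ℝ) * |A| * y ^ ε := by field_simp
      _ = _ := by rw [h2]
  · rw [enorm_neg]
    have := intervalIntegral.sum_integral_adjacent_intervals (f := fun y => GG ε A f x y - DD f x y) (μ := volume)
      (a := fun j : ℕ => r * c⁻¹ ^ j) (n := N)
      (fun k _ => (hGI _ _ (hsM k) (hsM (k + 1))).sub (hDI _ _ (hsM k) (hsM (k + 1))))
    simp only [pow_zero, mul_one] at this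
    rw [← this]
    have hterm : ∀ j : ℕ, ‖∫ y in (r * c⁻¹ ^ j)..(r * c⁻¹ ^ (j + 1)), (GG ε A f x y - DD f x y)‖ₑ ≤
        ENNReal.ofReal ((1 / 2) ^ j * (4 * b / a)) * MF (fun y => ‖f y‖ₑ) x := by
      intro j
      have e2 : r * c⁻¹ ^ j = r * c⁻¹ ^ (j + 1) * c := by
        rw [pow_succ]; field_simp
      rw [intervalIntegral.integral_symm, enorm_neg]
      rw [e2, norm_seg c _ hc0 (hsM (j + 1)), ← had, ← hbd]
      refine small_piece ε A a b _ _ ha hb (hsM (j + 1)) (by positivity) (fun y hy => ?_) f hc x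
      rw [had, hbd] at hy
      have h1 := pow_le_aux c _ y ε hε hcd (hsM (j + 1)) hy
      have h2 : (r * c⁻¹ ^ (j + 1)) ^ ε = |A|⁻¹ * (1 / 2) ^ (j + 1) := by
        rw [Real.mul_rpow hr.le (by positivity), hrε, ← Real.rpow_natCast, ← Real.rpow_mul (by positivity),
          mul_comm ((j + 1 : ℕ):ℝ), Real.rpow_mul (by positivity), Real.inv_rpow hc0.le, hcε, Real.rpow_natCast, one_div]
      rw [h2] at h1
      calc |A| * y ^ ε ≤ |A| * (2 * (|A|⁻¹ * (1 / 2) ^ (j + 1))) := by gcongr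
        _ = (1 / 2) ^ j := by
          rw [pow_succ]; field_simp
    refine (enorm_sum_le _ _).trans (le_trans (Finset.sum_le_sum fun j _ => hterm j) ?_)
    rw [← Finset.sum_mul, ← ENNReal.ofReal_sum_of_nonneg (fun j _ => by positivity), ← Finset.sum_mul]
    gcongr
    have h3 : ∑ i ∈ Finset.range N, ((1:ℝ) / 2) ^ i ≤ 2 := by
      have := Summable.sum_le_tsum (f := fun n : ℕ => ((1:ℝ) / 2) ^ n) (Finset.range N)
        (fun i _ => by positivity) summable_geometric_two
      rwa [tsum_geometric_two] at this
    calc _ ≤ 2 * (4 * b / a) := by gcongr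
      _ = _ := by ring
  · exact seg_hilbert f hc hi L hL x _ _ (hsM N) hr

lemma GG_cont (ε : ℝ) (f : ℝ → ℂ) (hc : Continuous f) (hi : Integrable f) (L : ℝ)
    (hL : ∀ u v, ‖f u - f v‖ ≤ L * |u - v|) (x : ℝ) :
    Continuous fun A : ℝ => ∫ y in Ioi 0, GG ε A f x y := by
  refine continuous_of_dominated (bound := fun y => ‖DD f x y‖)
    (fun A => (GG_meas ε A f hc x).aestronglyMeasurable) (fun A => Eventually.of_forall fun y => ?_)
    (DD_int f hc hi L hL x).norm (Eventually.of_forall fun y => ?_)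
  · rw [GG, norm_mul, EE_norm, one_mul]
  · unfold GG EE
    fun_prop

lemma Lp_add (p : ℝ) (hp : 1 < p) (u v : ℝ → ℝ≥0∞) (hv : Measurable v) (F K1 K2 : ℝ≥0∞)
    (h1 : ∫⁻ x, u x ^ p ≤ K1 * F) (h2 : ∫⁻ x, v x ^ p ≤ K2 * F) :
    ∫⁻ x, (u x + v x) ^ p ≤ (2 ^ (p - 1) * (K1 + K2)) * F := by
  have ht : (2:ℝ≥0∞) ^ (p - 1) ≠ ⊤ := ENNReal.rpow_ne_top_of_nonneg (by linarith) (by norm_num)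
  calc ∫⁻ x, (u x + v x) ^ p ≤ ∫⁻ x, 2 ^ (p - 1) * (u x ^ p + v x ^ p) :=
        lintegral_mono fun x => ENNReal.rpow_add_le_mul_rpow_add_rpow _ _ hp.le
    _ = 2 ^ (p - 1) * ((∫⁻ x, u x ^ p) + ∫⁻ x, v x ^ p) := by
        rw [lintegral_const_mul' _ _ ht, lintegral_add_right _ (hv.pow_const p)]
    _ ≤ 2 ^ (p - 1) * (K1 * F + K2 * F) := by gcongr
    _ = _ := by ring

lemma Lp_tsum (p : ℝ) (hp : 1 < p) (e : ℝ≥0∞) (he0 : e ≠ 0) (he1 : e < 1) (w : ℕ → ℝ → ℝ≥0∞)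
    (hw : ∀ j, Measurable (w j)) (K F : ℝ≥0∞)
    (h : ∀ j, ∫⁻ x, w j x ^ p ≤ K * (e ^ p) ^ (2 * j) * F) :
    ∫⁻ x, (∑' j, w j x) ^ p ≤ (((1 - e)⁻¹) ^ p * (K * (1 - e ^ p)⁻¹)) * F := by
  have hp0 : 0 < p := by linarith
  have het : e ≠ ⊤ := (he1.trans ENNReal.one_lt_top).ne
  have hpt : ∀ x, (∑' j, w j x) ^ p ≤ ((1 - e)⁻¹) ^ p * ∑' j, ((e ^ p) ^ j)⁻¹ * w j x ^ p := by
    intro x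
    set S := ⨆ j, (e ^ j)⁻¹ * w j x with hS
    have h1 : ∑' j, w j x ≤ (1 - e)⁻¹ * S := by
      rw [← ENNReal.tsum_geometric, ← ENNReal.tsum_mul_right]
      refine ENNReal.tsum_le_tsum fun j => ?_
      calc w j x = e ^ j * ((e ^ j)⁻¹ * w j x) := by
            rw [← mul_assoc, ENNReal.mul_inv_cancel (pow_ne_zero _ he0) (ENNReal.pow_ne_top het), one_mul]
        _ ≤ _ := by gcongr; exact le_iSup (fun j => (e ^ j)⁻¹ * w j x) j
    have h2 : S ^ p ≤ ∑' j, ((e ^ p) ^ j)⁻¹ * w j x ^ p := by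
      have : S ^ p = ⨆ j, ((e ^ j)⁻¹ * w j x) ^ p := (ENNReal.orderIsoRpow p hp0).map_iSup _
      rw [this]
      refine iSup_le fun j => ?_
      have e3 : ((e ^ j)⁻¹ * w j x) ^ p = ((e ^ p) ^ j)⁻¹ * w j x ^ p := by
        rw [ENNReal.mul_rpow_of_nonneg _ _ hp0.le, ENNReal.inv_rpow, ← ENNReal.rpow_natCast, ← ENNReal.rpow_mul,
          ← ENNReal.rpow_natCast, ← ENNReal.rpow_mul, mul_comm p]
      rw [e3]
      exact ENNReal.le_tsum (f := fun j => ((e ^ p) ^ j)⁻¹ * w j x ^ p) j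
    calc _ ≤ ((1 - e)⁻¹ * S) ^ p := ENNReal.rpow_le_rpow h1 hp0.le
      _ = ((1 - e)⁻¹) ^ p * S ^ p := ENNReal.mul_rpow_of_nonneg _ _ hp0.le
      _ ≤ _ := by gcongr
  have hq0 : e ^ p ≠ 0 := (ENNReal.rpow_pos (pos_iff_ne_zero.2 he0) het).ne'
  have hqt : e ^ p ≠ ⊤ := ENNReal.rpow_ne_top_of_nonneg hp0.le het
  have hct : ((1 - e)⁻¹) ^ p ≠ ⊤ := ENNReal.rpow_ne_top_of_nonneg hp0.le
    (ENNReal.inv_ne_top.2 (tsub_pos_of_lt he1).ne')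
  calc _ ≤ ∫⁻ x, ((1 - e)⁻¹) ^ p * ∑' j, ((e ^ p) ^ j)⁻¹ * w j x ^ p := lintegral_mono hpt
    _ = ((1 - e)⁻¹) ^ p * ∑' j, ((e ^ p) ^ j)⁻¹ * ∫⁻ x, w j x ^ p := by
        rw [lintegral_const_mul' _ _ hct, lintegral_tsum fun j => (((hw j).pow_const p).const_mul _).aemeasurable]
        congr 2; ext j
        rw [lintegral_const_mul _ ((hw j).pow_const p)]
    _ ≤ ((1 - e)⁻¹) ^ p * ∑' j, (e ^ p) ^ j * (K * F) := by
        refine mul_le_mul_right (ENNReal.tsum_le_tsum fun j => ?_) _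
        refine (mul_le_mul_right (h j) _).trans (le_of_eq ?_)
        have : ((e ^ p) ^ j)⁻¹ * (e ^ p) ^ j = 1 :=
          ENNReal.inv_mul_cancel (pow_ne_zero _ hq0) (ENNReal.pow_ne_top hqt)
        calc _ = ((e ^ p) ^ j)⁻¹ * (e ^ p) ^ j * ((e ^ p) ^ j * (K * F)) := by ring
          _ = _ := by rw [this, one_mul]
    _ = _ := by
        rw [ENNReal.tsum_mul_right, ENNReal.tsum_geometric]; ring

lemma Lp_smul (p : ℝ) (hp : 1 < p) (u : ℝ → ℝ≥0∞) (c K F : ℝ≥0∞) (hc : c ≠ ⊤)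
    (h : ∫⁻ x, u x ^ p ≤ K * F) : ∫⁻ x, (c * u x) ^ p ≤ (c ^ p * K) * F := by
  have hp0 : 0 ≤ p := by linarith
  simp_rw [ENNReal.mul_rpow_of_nonneg _ _ hp0]
  rw [lintegral_const_mul' _ _ (ENNReal.rpow_ne_top_of_nonneg hp0 hc), mul_assoc]
  gcongr

lemma qseq : ∃ q : ℕ → ℝ, (∀ n, q n ≠ 0) ∧ DenseRange q := by
  have hd : Dense (range ((↑) : ℚ → ℝ) \ {0}) := Dense.sdiff_singleton Rat.denseRange_cast 0
  have hcn : (range ((↑) : ℚ → ℝ) \ {0}).Countable := (countable_range _).mono sdiff_subset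
  obtain ⟨q, hq⟩ := hcn.exists_eq_range hd.nonempty
  refine ⟨q, fun n => ?_, by rw [DenseRange, ← hq]; exact hd⟩
  have : q n ∈ range ((↑) : ℚ → ℝ) \ {0} := hq ▸ mem_range_self n
  exact this.2

/-- The part of the bound that only involves the maximal and Hilbert transforms. -/
noncomputable def HH (K : ℝ) (f : ℝ → ℂ) (x : ℝ) : ℝ≥0∞ :=
  ENNReal.ofReal K * MF (fun y => ‖f y‖ₑ) x +
      2 * (NF f x + ENNReal.ofReal (2 * Real.pi) * MF (fun y => ‖f y‖ₑ) x)

lemma HH_strong (p : ℝ) (hp : 1 < p) (K : ℝ) : ∃ C : ℝ≥0∞, C ≠ ⊤ ∧ ∀ f : ℝ → ℂ, Measurable f → Integrable f →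
    ∫⁻ x, HH K f x ^ p ≤ C * ∫⁻ x, ‖f x‖ₑ ^ p := by
  obtain ⟨C1, hC1, H1⟩ := MF_strong p hp
  obtain ⟨C2, hC2, H2⟩ := NF_strong p hp
  have hp0 : 0 ≤ p := by linarith
  have t2 : (2:ℝ≥0∞) ^ (p - 1) ≠ ⊤ := ENNReal.rpow_ne_top_of_nonneg (by linarith) (by norm_num)
  refine ⟨2 ^ (p - 1) * (2 ^ p * C2 + (ENNReal.ofReal (K) + 2 * ENNReal.ofReal (2 * Real.pi)) ^ p * C1), ?_, ?_⟩
  · refine ENNReal.mul_ne_top t2 (ENNReal.add_ne_top.2 ⟨ENNReal.mul_ne_top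
      (ENNReal.rpow_ne_top_of_nonneg hp0 (by norm_num)) hC2, ENNReal.mul_ne_top
      (ENNReal.rpow_ne_top_of_nonneg hp0 ?_) hC1⟩)
    exact ENNReal.add_ne_top.2 ⟨ENNReal.ofReal_ne_top, ENNReal.mul_ne_top (by norm_num) ENNReal.ofReal_ne_top⟩
  · intro f hf hfi
    have h1 := Lp_smul p hp _ (ENNReal.ofReal (K) + 2 * ENNReal.ofReal (2 * Real.pi)) C1 _
      (ENNReal.add_ne_top.2 ⟨ENNReal.ofReal_ne_top, ENNReal.mul_ne_top (by norm_num) ENNReal.ofReal_ne_top⟩)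
      (H1 (fun y => ‖f y‖ₑ) hf.enorm)
    have h2 := Lp_smul p hp _ 2 C2 _ (by norm_num) (H2 f hf hfi)
    refine le_trans (le_of_eq ?_) (Lp_add p hp _ _ ((MF_measurable _).const_mul _) _ _ _ h2 h1)
    refine lintegral_congr fun x => ?_
    unfold HH
    congr 1; ring

lemma neg_lint (g : ℝ → ℝ≥0∞) : ∫⁻ x, g (-x) = ∫⁻ x, g x := lintegral_neg_eq_self g

lemma sum_strong (ε : ℝ) (hε0 : ε ≠ 0) (hε1 : ε ≠ 1) (a b : ℝ) (ha : 0 < a) (hab : a ≤ b) (p : ℝ) (hp : 1 < p) :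
    ∃ C : ℝ≥0∞, C ≠ ⊤ ∧ ∀ (R : ℕ → ℕ → ℝ), (∀ j n, 0 < R j n) → ∀ f : ℝ → ℂ, Measurable f → Integrable f →
      (Measurable fun x => ∑' j : ℕ, ((TT ε a b (2 ^ j) (R j) f x + TT ε a b (2 ^ j) (R j) (fun z => f (-z)) (-x)) +
        (TT ε a b (-2 ^ j) (R j) f x + TT ε a b (-2 ^ j) (R j) (fun z => f (-z)) (-x)))) ∧
      ∫⁻ x, (∑' j : ℕ, ((TT ε a b (2 ^ j) (R j) f x + TT ε a b (2 ^ j) (R j) (fun z => f (-z)) (-x)) +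
        (TT ε a b (-2 ^ j) (R j) f x + TT ε a b (-2 ^ j) (R j) (fun z => f (-z)) (-x)))) ^ p ≤
        C * ∫⁻ x, ‖f x‖ₑ ^ p := by
  obtain ⟨C, δ, hC, hδ, H⟩ := TT_strong ε a b hε0 hε1 ha hab p hp
  have hp0 : 0 < p := by linarith
  set e := ENNReal.ofReal (2 ^ (-(δ / (2 * p)))) with he
  have he0 : e ≠ 0 := by rw [he]; simp only [ne_eq, ENNReal.ofReal_eq_zero, not_le]; positivity
  have he1 : e < 1 := by
    rw [he, ENNReal.ofReal_lt_one]
    exact Real.rpow_lt_one_of_one_lt_of_neg (by norm_num) (by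
      have : 0 < δ / (2 * p) := by positivity
      linarith)
  have het : e ≠ ⊤ := (he1.trans ENNReal.one_lt_top).ne
  have hej : ∀ j : ℕ, ENNReal.ofReal (C * (2 ^ j : ℝ) ^ (-δ)) = ENNReal.ofReal C * (e ^ p) ^ (2 * j) := by
    intro j
    rw [ENNReal.ofReal_mul hC.le, he, ENNReal.ofReal_rpow_of_pos (by positivity), ← ENNReal.ofReal_pow (by positivity)]
    congr 2
    rw [← Real.rpow_natCast, ← Real.rpow_natCast, ← Real.rpow_mul (by positivity), ← Real.rpow_mul (by positivity),
      ← Real.rpow_mul (by positivity)]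
    congr 1
    push_cast
    field_simp
  have t2 : (2:ℝ≥0∞) ^ (p - 1) ≠ ⊤ := ENNReal.rpow_ne_top_of_nonneg (by linarith) (by norm_num)
  set K : ℝ≥0∞ := 2 ^ (p - 1) * (2 ^ (p - 1) * (ENNReal.ofReal C + ENNReal.ofReal C) +
    2 ^ (p - 1) * (ENNReal.ofReal C + ENNReal.ofReal C)) with hK
  have hKt : K ≠ ⊤ := by
    have h0 : ENNReal.ofReal C + ENNReal.ofReal C ≠ ⊤ :=
      ENNReal.add_ne_top.2 ⟨ENNReal.ofReal_ne_top, ENNReal.ofReal_ne_top⟩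
    exact ENNReal.mul_ne_top t2 (ENNReal.add_ne_top.2 ⟨ENNReal.mul_ne_top t2 h0, ENNReal.mul_ne_top t2 h0⟩)
  have hq1 : e ^ p < 1 := ENNReal.rpow_lt_one he1 hp0
  refine ⟨((1 - e)⁻¹) ^ p * (K * (1 - e ^ p)⁻¹), ?_, ?_⟩
  · refine ENNReal.mul_ne_top (ENNReal.rpow_ne_top_of_nonneg hp0.le
      (ENNReal.inv_ne_top.2 (tsub_pos_of_lt he1).ne')) (ENNReal.mul_ne_top hKt
      (ENNReal.inv_ne_top.2 (tsub_pos_of_lt hq1).ne'))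
  intro R hR f hf hfi
  have hfn : Measurable fun z => f (-z) := hf.comp measurable_neg
  have hm1 : ∀ lam j, Measurable fun x => TT ε a b lam (R j) f x := fun lam j => TT_meas _ _ _ _ _ _ hf
  have hm2 : ∀ lam j, Measurable fun x => TT ε a b lam (R j) (fun z => f (-z)) (-x) := fun lam j =>
    (TT_meas ε a b lam (R j) _ hfn).comp measurable_neg
  have hm : ∀ j : ℕ, Measurable fun x =>
      ((TT ε a b (2 ^ j) (R j) f x + TT ε a b (2 ^ j) (R j) (fun z => f (-z)) (-x)) +
        (TT ε a b (-2 ^ j) (R j) f x + TT ε a b (-2 ^ j) (R j) (fun z => f (-z)) (-x))) := fun j =>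
    ((hm1 _ j).add (hm2 _ j)).add ((hm1 _ j).add (hm2 _ j))
  refine ⟨Measurable.tsum hm, ?_⟩
  refine Lp_tsum p hp e he0 he1 _ hm K _ fun j => ?_
  have hb : ∀ lam : ℝ, |lam| = 2 ^ j → (∫⁻ x, TT ε a b lam (R j) f x ^ p ≤
      ENNReal.ofReal C * ((e ^ p) ^ (2 * j) * ∫⁻ x, ‖f x‖ₑ ^ p)) ∧
      (∫⁻ x, TT ε a b lam (R j) (fun z => f (-z)) (-x) ^ p ≤
      ENNReal.ofReal C * ((e ^ p) ^ (2 * j) * ∫⁻ x, ‖f x‖ₑ ^ p)) := by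
    intro lam hlam
    have h1 : 1 ≤ |lam| := by rw [hlam]; exact one_le_pow₀ (by norm_num)
    rw [← mul_assoc, ← hej j, ← hlam]
    refine ⟨H lam h1 (R j) (hR j) f hf hfi, ?_⟩
    rw [neg_lint (fun x => TT ε a b lam (R j) (fun z => f (-z)) x ^ p), ← neg_lint (fun x => ‖f x‖ₑ ^ p)]
    exact H lam h1 (R j) (hR j) _ hfn hfi.comp_neg
  have hP := hb (2 ^ j) (abs_of_pos (by positivity))
  have hN := hb (-2 ^ j) (by rw [abs_neg]; exact abs_of_pos (by positivity))
  have h3 := Lp_add p hp _ _ (hm2 _ j) _ _ _ hP.1 hP.2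
  have h4 := Lp_add p hp _ _ (hm2 _ j) _ _ _ hN.1 hN.2
  have h5 := Lp_add p hp _ _ ((hm1 _ j).add (hm2 _ j)) _ _ _ h3 h4
  rw [mul_assoc]
  exact h5

lemma schwartz_lip (f : SchwartzMap ℝ ℂ) : ∃ L : ℝ, ∀ u v, ‖f u - f v‖ ≤ L * |u - v| := by
  refine ⟨‖(SchwartzMap.derivCLM ℝ ℂ f).toBoundedContinuousFunction‖, fun u v => ?_⟩
  have := Convex.norm_image_sub_le_of_norm_deriv_le (f := f) (s := univ) (x := v) (y := u)
    (C := ‖(SchwartzMap.derivCLM ℝ ℂ f).toBoundedContinuousFunction‖)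
    (fun x _ => f.differentiableAt) (fun x _ => by
      rw [← SchwartzMap.derivCLM_apply ℝ]
      exact (SchwartzMap.derivCLM ℝ ℂ f).toBoundedContinuousFunction.norm_coe_le_norm x)
    convex_univ (mem_univ _) (mem_univ _)
  simpa using this

lemma carl_eq (ε : ℝ) (f : SchwartzMap ℝ ℂ) (x : ℝ) :
    carlesonEven ε (fun y => f y) x = ⨆ A : ℝ, ‖∫ y in Ioi 0, GG ε A f x y‖ₑ := by
  obtain ⟨L, hL⟩ := schwartz_lip f
  unfold carlesonEven
  congr 1; ext A
  have := pv_eq ε A f f.continuous f.integrable L hL x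
  rw [this]; rfl

lemma carl_main (ε : ℝ) (hε1 : ε ≠ 1) (p : ℝ) (hp : 1 < p) : ∃ C : ℝ≥0∞, C ≠ ⊤ ∧ ∀ f : SchwartzMap ℝ ℂ,
    ∫⁻ x, carlesonEven ε (fun y => f y) x ^ p ≤ C * ∫⁻ x, ‖f x‖ₑ ^ p := by
  have hp0 : 0 ≤ p := by linarith
  by_cases hε0 : ε = 0
  · obtain ⟨C, hC, H⟩ := HH_strong p hp 0
    refine ⟨C, hC, fun f => le_trans (lintegral_mono fun x => ENNReal.rpow_le_rpow ?_ hp0)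
      (H f f.continuous.measurable f.integrable)⟩
    obtain ⟨L, hL⟩ := schwartz_lip f
    rw [carl_eq]
    refine iSup_le fun A => ?_
    have e : ∀ y, GG ε A f x y = Complex.exp (Complex.I * A) * DD f x y := by
      intro y; rw [GG, EE, hε0, Real.rpow_zero]; simp
    simp_rw [e]
    rw [integral_const_mul, enorm_mul]
    have : ‖Complex.exp (Complex.I * A)‖ₑ = 1 := by
      rw [← ofReal_norm, mul_comm, Complex.norm_exp_ofReal_mul_I, ENNReal.ofReal_one]
    rw [this, one_mul]
    refine (hilbert_pt f f.continuous f.integrable L hL x).trans ?_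
    unfold HH
    exact le_add_self
  set c : ℝ := 2 ^ (1 / ε) with hcd
  have hc0 : 0 < c := by rw [hcd]; positivity
  set a := min 1 c with had
  set b := max 1 c with hbd
  have ha : 0 < a := lt_min one_pos hc0
  have hab : a ≤ b := min_le_max
  obtain ⟨C1, hC1, H1⟩ := HH_strong p hp (8 * b / a)
  obtain ⟨C2, hC2, H2⟩ := sum_strong ε hε0 hε1 a b ha hab p hp
  obtain ⟨q, hq0, hqd⟩ := qseq
  have t2 : (2:ℝ≥0∞) ^ (p - 1) ≠ ⊤ := ENNReal.rpow_ne_top_of_nonneg (by linarith) (by norm_num)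
  refine ⟨2 ^ (p - 1) * (C1 + C2), ENNReal.mul_ne_top t2 (ENNReal.add_ne_top.2 ⟨hC1, hC2⟩), fun f => ?_⟩
  obtain ⟨L, hL⟩ := schwartz_lip f
  set R : ℕ → ℕ → ℝ := fun j n => |q n| ^ (-(1 / ε)) * c ^ j with hRd
  have hR : ∀ j n, 0 < R j n := fun j n => by
    have := abs_pos.2 (hq0 n)
    simp only [hRd]; positivity
  obtain ⟨hm, hs⟩ := H2 R hR f f.continuous.measurable f.integrable
  refine le_trans (lintegral_mono fun x => ENNReal.rpow_le_rpow ?_ hp0)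
    (Lp_add p hp _ _ hm _ _ _ (H1 f f.continuous.measurable f.integrable) hs)
  rw [carl_eq]
  refine iSup_le fun A => ?_
  set B := HH (8 * b / a) f x + ∑' j : ℕ, ((TT ε a b (2 ^ j) (R j) f x + TT ε a b (2 ^ j) (R j) (fun z => f (-z)) (-x)) +
        (TT ε a b (-2 ^ j) (R j) f x + TT ε a b (-2 ^ j) (R j) (fun z => f (-z)) (-x))) with hB
  have hcl : IsClosed {A : ℝ | ‖∫ y in Ioi 0, GG ε A f x y‖ₑ ≤ B} :=
    isClosed_le (GG_cont ε f f.continuous f.integrable L hL x).enorm continuous_const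
  have hsub : range q ⊆ {A : ℝ | ‖∫ y in Ioi 0, GG ε A f x y‖ₑ ≤ B} := by
    rintro _ ⟨n, rfl⟩
    refine (point_bound ε (q n) c _ a b hε0 (hq0 n) hcd rfl had hbd f f.continuous f.integrable L hL x).trans ?_
    rw [hB, add_comm]
    refine add_le_add le_rfl (ENNReal.tsum_le_tsum fun j => ?_)
    have hT : ∀ (lam : ℝ) (g : ℝ → ℂ) (x : ℝ), ‖∫ z, KK ε a b lam (|q n| ^ (-(1 / ε)) * c ^ j) (x - z) * g z‖ₑ ≤
        TT ε a b lam (R j) g x := fun lam g x =>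
      le_iSup (fun n => ‖∫ z, KK ε a b lam (R j n) (x - z) * g z‖ₑ) n
    rcases lt_or_gt_of_ne (hq0 n) with h | h
    · have e : ((SignType.sign (q n) : SignType) : ℝ) * 2 ^ j = -2 ^ j := by rw [sign_neg h]; simp
      rw [e]
      exact le_trans (add_le_add (hT _ _ _) (hT _ (fun z => f (-z)) _)) le_add_self
    · have e : ((SignType.sign (q n) : SignType) : ℝ) * 2 ^ j = 2 ^ j := by rw [sign_pos h]; simp
      rw [e]
      exact le_trans (add_le_add (hT _ _ _) (hT _ (fun z => f (-z)) _)) le_self_add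
  have hall : closure (range q) ⊆ {A : ℝ | ‖∫ y in Ioi 0, GG ε A f x y‖ₑ ≤ B} := closure_minimal hsub hcl
  exact hall (hqd A)

theorem stmt_0 (ε₁ : ℝ) (hε : ε₁ ≠ 1) (p : ℝ) (hp : 1 < p) :
    ∃ C : ℝ, 0 < C ∧ ∀ f : SchwartzMap ℝ ℂ,
      (∫⁻ x : ℝ, carlesonEven ε₁ (fun y => f y) x ^ p) ^ (1 / p)
        ≤ ENNReal.ofReal C * eLpNorm (fun y => f y) (ENNReal.ofReal p) volume := by
  obtain ⟨C, hC, H⟩ := carl_main ε₁ hε p hp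
  have hp0 : 0 < p := by linarith
  refine ⟨(C ^ (1 / p)).toReal + 1, by positivity, fun f => ?_⟩
  rw [eLpNorm_eq_lintegral_rpow_enorm_toReal (by simpa using hp0) ENNReal.ofReal_ne_top, ENNReal.toReal_ofReal hp0.le]
  refine (ENNReal.rpow_le_rpow (H f) (by positivity)).trans ?_
  rw [ENNReal.mul_rpow_of_nonneg _ _ (by positivity)]
  gcongr
  rw [ENNReal.ofReal_add (by positivity) (by norm_num), ENNReal.ofReal_toReal
    (ENNReal.rpow_ne_top_of_nonneg (by positivity) hC)]
  exact le_self_add
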